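/- arXiv:nlin/0302026 — 3 statements merged into one kernel-verified Lean document; each statement's English description precedes it below -/
import Mathlib

section
/- With φ_{k,l,m} and τ_n^{k,l,m} as in the context, for every integer n ≥ 0 the functions f_0 = b·τ_n^{0,0,0}τ_{n+1}^{−1,−2,−1}/(τ_n^{−1,−1,−1}τ_{n+1}^{0,−1,0}), f_3 = (c−a)·τ_n^{0,−1,−1}τ_{n+1}^{−1,−1,0}/(τ_n^{−1,−1,−1}τ_{n+1}^{0,−1,0}), f_4 = τ_n^{0,−1,0}τ_{n+1}^{−1,−1,−1}/(τ_n^{−1,−1,−1}τ_{n+1}^{0,−1,0}), f_2 = a·t^{−1}·τ_n^{−1,−1,−1}τ_{n+1}^{0,−1,0}τ_{n−1}^{1,0,0}/(τ_n^{0,0,0}τ_n^{0,−1,−1}τ_n^{0,−1,0}) give a solution of the symmetric form of the Painlevé VI equation with parameters (α_0,α_1,α_2,α_3,α_4) = (−b, a+n, −n, c−a, b−c+1+n): on every open subinterval of (0,1) on which none of the τ-functions appearing in the denominators vanishes, the identities f_0 = f_4 − t and f_3 = f_4 − 1 hold and the two Hamilton equations of the symmetric form are satisfied. -/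
/-- Gauss's hypergeometric function `F(a,b,c;t)` as a power series (convergent
for `|t| < 1`). -/
noncomputable def gaussF (a b c : ℂ) (t : ℝ) : ℂ :=
  ∑' n : ℕ, (Polynomial.eval a (ascPochhammer ℂ n) * Polynomial.eval b (ascPochhammer ℂ n) /
    (Polynomial.eval c (ascPochhammer ℂ n) * (n.factorial : ℂ))) * (t : ℂ) ^ n

/-- The seed functions
`φ_{k,l,m} = c₁ (Γ(a+k+1)Γ(b+l+2)/Γ(c+m+1)) f^{k+1,l+2}_{m+1}
  + c₂ (Γ(a-c+1+k-m)Γ(b-c+2+l-m)/Γ(1-c-m)) g^{k+1,l+2}_{m+1}`,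
where `f^{kl}_m(t) = F(a+k,b+l,c+m;t)` and
`g^{kl}_m(t) = t^{1-c-m}F(a-c+1+k-m, b-c+1+l-m, 2-c-m;t)`. -/
noncomputable def phiVI (a b c c₁ c₂ : ℂ) (k l m : ℤ) (t : ℝ) : ℂ :=
  c₁ * (Complex.Gamma (a + k + 1) * Complex.Gamma (b + l + 2) / Complex.Gamma (c + m + 1)) *
      gaussF (a + k + 1) (b + l + 2) (c + m + 1) t
  + c₂ * (Complex.Gamma (a - c + 1 + k - m) * Complex.Gamma (b - c + 2 + l - m) /
        Complex.Gamma (1 - c - m)) *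
      ((t : ℂ) ^ (1 - c - ((m : ℂ) + 1)) *
        gaussF (a - c + 1 + ((k : ℂ) + 1) - ((m : ℂ) + 1))
          (b - c + 1 + ((l : ℂ) + 2) - ((m : ℂ) + 1)) (2 - c - ((m : ℂ) + 1)) t)

/-- The Euler derivation `δ = t d/dt`. -/
noncomputable def eulerD (f : ℝ → ℂ) : ℝ → ℂ := fun t => (t : ℂ) * deriv f t

/-- The Hankel determinants `τ_n^{k,l,m} = det((t d/dt)^{i+j} φ_{k,l,m})_{0≤i,j≤n-1}`,
extended by `0` to negative indices `n`. -/
noncomputable def tauVI (a b c c₁ c₂ : ℂ) (k l m : ℤ) (n : ℤ) (t : ℝ) : ℂ :=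
  if n < 0 then 0
  else Matrix.det (Matrix.of fun i j : Fin n.toNat =>
    eulerD^[(i : ℕ) + (j : ℕ)] (phiVI a b c c₁ c₂ k l m) t)

namespace PVI

open Matrix Finset

section Algebra

variable {R : Type*} [CommRing R]

theorem det_updateRow_updateRow_swap {ι : Type*} [Fintype ι] [DecidableEq ι]
    (M : Matrix ι ι R) {i j : ι} (hij : i ≠ j) (u v : ι → R) :
    ((M.updateRow i u).updateRow j v).det = -((M.updateRow i v).updateRow j u).det := by
  have h := det_permute (Equiv.swap i j) ((M.updateRow i v).updateRow j u)
  rw [Equiv.Perm.sign_swap hij] at h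
  simp only [Units.val_neg, Units.val_one, Int.cast_neg, Int.cast_one, neg_mul, one_mul] at h
  rw [← h]
  congr 1
  ext k l
  simp only [submatrix_apply, id_eq]
  by_cases hki : k = i
  · subst hki
    simp [updateRow_apply, hij]
  · by_cases hkj : k = j
    · subst hkj
      simp [updateRow_apply, hij]
    · rw [Equiv.swap_apply_of_ne_of_ne hki hkj]
      simp [updateRow_apply, hki, hkj]

/-- The three-term Plücker relation, for two rows of a square matrix and two further vectors. -/
theorem det_mul_det_updateRow_updateRow {ι : Type*} [Fintype ι] [DecidableEq ι]
    (M : Matrix ι ι R) {i j : ι} (hij : i ≠ j) (u v : ι → R) :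
    M.det * ((M.updateRow i u).updateRow j v).det =
      (M.updateRow i u).det * (M.updateRow j v).det -
        (M.updateRow j u).det * (M.updateRow i v).det := by
  have hu : M.det • u = ∑ k, (M.updateRow k u).det • M k := by
    have h := mulVec_cramer Mᵀ u
    rw [det_transpose] at h
    rw [← h]
    ext l
    simp [mulVec, dotProduct, cramer_transpose_apply, mul_comm]
  have hsum : ∀ (s : Finset ι) (N : Matrix ι ι R) (c : ι → R),
      (N.updateRow i (∑ k ∈ s, c k • M k)).det = ∑ k ∈ s, c k * (N.updateRow i (M k)).det := by
    intro s N c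
    have h := map_sum ((detRowAlternating (R := R) (n := ι)).toMultilinearMap.toLinearMap N i)
      (fun k => c k • M k) s
    simp only [map_smul, smul_eq_mul] at h
    exact h
  have hterm : ∀ k, k ≠ i → k ≠ j → ((M.updateRow j v).updateRow i (M k)).det = 0 := by
    intro k hki hkj
    refine det_zero_of_row_eq hki.symm ?_
    simp [updateRow_ne hki, updateRow_ne hkj]
  have hswap : ((M.updateRow j v).updateRow i (M j)).det = -(M.updateRow i v).det := by
    rw [updateRow_comm _ hij.symm, det_updateRow_updateRow_swap _ hij, updateRow_comm _ hij,
      updateRow_eq_self]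
  calc M.det * ((M.updateRow i u).updateRow j v).det
      = ((M.updateRow j v).updateRow i (M.det • u)).det := by
        rw [det_updateRow_smul, updateRow_comm _ hij]
    _ = ∑ k, (M.updateRow k u).det * ((M.updateRow j v).updateRow i (M k)).det := by
        rw [hu, hsum]
    _ = (M.updateRow i u).det * ((M.updateRow j v).updateRow i (M i)).det +
          (M.updateRow j u).det * ((M.updateRow j v).updateRow i (M j)).det := by
        rw [← Finset.sum_subset (Finset.subset_univ {i, j}), Finset.sum_pair hij]
        intro k _ hk
        simp only [Finset.mem_insert, Finset.mem_singleton, not_or] at hk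
        rw [hterm k hk.1 hk.2, mul_zero]
    _ = _ := by
        have h1 : (M.updateRow j v).updateRow i (M i) = M.updateRow j v := by
          rw [updateRow_comm _ hij.symm, updateRow_eq_self]
        rw [h1, hswap]
        ring

theorem det_updateRow_last_single {n : ℕ} (Y : Matrix (Fin (n + 1)) (Fin (n + 1)) R) :
    (Y.updateRow (Fin.last n) (Pi.single (Fin.last n) 1)).det =
      (Y.submatrix Fin.castSucc Fin.castSucc).det := by
  rw [← adjugate_apply, adjugate_fin_succ_eq_det_submatrix, Fin.succAbove_last]
  simp [← two_mul]

/-- The geometric vector `(1, -A, A², …)`, which is killed by `v ↦ (v (i + 1) + A * v i)`. -/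
def geomVec (A : R) (n : ℕ) (i : Fin n) : R := (-A) ^ (i : ℕ)

theorem det_updateRow_last_geomVec {n : ℕ} (A : R) (Y : Matrix (Fin (n + 1)) (Fin (n + 1)) R) :
    (Y.updateRow (Fin.last n) (geomVec A _)).det =
      (-1) ^ n * (Matrix.of fun i j : Fin n =>
        Y i.castSucc j.succ + A * Y i.castSucc j.castSucc).det := by
  set Z := Y.updateRow (Fin.last n) (geomVec A _) with hZ
  set B : Matrix (Fin (n + 1)) (Fin (n + 1)) R := Matrix.of fun i j =>
    Fin.cases (motive := fun _ => R) (Z i 0) (fun j => Z i j.succ + A * Z i j.castSucc) j with hB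
  have hdet : Z.det = B.det := by
    refine det_eq_of_forall_col_eq_smul_add_pred (fun _ => -A) (fun i => by simp [hB]) ?_
    intro i j
    simp [hB]
  have hlast : B = B.updateRow (Fin.last n) (Pi.single 0 1) := by
    ext i j
    refine Fin.lastCases ?_ (fun i => ?_) i
    · refine Fin.cases ?_ (fun j => ?_) j
      · simp [hB, hZ, geomVec]
      · simp [hB, hZ, geomVec, pow_succ, mul_comm]
    · simp
  rw [hdet, hlast, ← adjugate_apply, adjugate_fin_succ_eq_det_submatrix]
  simp only [Fin.val_last, Fin.val_zero, add_zero, Fin.succAbove_last, Fin.succAbove_zero]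
  congr 2
  ext i j
  simp [hB, hZ]

/-- The Hankel matrix of size `n` of a sequence. -/
def hankel (n : ℕ) (h : ℕ → R) : Matrix (Fin n) (Fin n) R := Matrix.of fun i j => h (i + j)

/-- The sequence `h (k + 1) + A * h k`. -/
def christoffel (A : R) (h : ℕ → R) (k : ℕ) : R := h (k + 1) + A * h k

/-- The determinant of the Hankel matrix of size `n + 2` with its last two rows replaced. -/
def bracket (n : ℕ) (h : ℕ → R) (u v : Fin (n + 2) → R) : R :=
  (((hankel (n + 2) h).updateRow (Fin.last n).castSucc u).updateRow (Fin.last (n + 1)) v).det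

variable (n : ℕ) (h : ℕ → R)

theorem neg_one_pow_mul_self : ((-1 : R) ^ n) * (-1) ^ n = 1 := by
  rw [← mul_pow]
  simp

theorem bracket_swap (u v : Fin (n + 2) → R) : bracket n h u v = -bracket n h v u :=
  det_updateRow_updateRow_swap _ (Fin.castSucc_lt_last _).ne _ _

theorem bracket_mul_bracket (u v w x : Fin (n + 2) → R) :
    bracket n h u v * bracket n h w x =
      bracket n h w v * bracket n h u x - bracket n h u w * bracket n h x v := by
  have hne : (Fin.last n).castSucc ≠ Fin.last (n + 1) := (Fin.castSucc_lt_last _).ne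
  have hp := det_mul_det_updateRow_updateRow
    (((hankel (n + 2) h).updateRow (Fin.last n).castSucc u).updateRow (Fin.last (n + 1)) v)
    hne w x
  simp only [updateRow_idem, updateRow_comm _ hne.symm] at hp
  exact hp

theorem hankel_updateRow_castSucc_last {α : Type*} (n : ℕ) (h : ℕ → α) :
    (hankel (n + 2) h).updateRow (Fin.last n).castSucc (fun j => h (n + j)) = hankel (n + 2) h := by
  conv_rhs => rw [← updateRow_eq_self (hankel (n + 2) h) (Fin.last n).castSucc]
  congr 1

theorem bracket_row_left (v : Fin (n + 2) → R) :
    bracket n h (fun j => h (n + j)) v =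
      ((hankel (n + 2) h).updateRow (Fin.last (n + 1)) v).det := by
  rw [bracket, hankel_updateRow_castSucc_last]

theorem bracket_row_row :
    bracket n h (fun j => h (n + j)) (fun j => h (n + 1 + j)) = (hankel (n + 2) h).det := by
  rw [bracket_row_left]
  conv_rhs => rw [← updateRow_eq_self (hankel (n + 2) h) (Fin.last (n + 1))]
  congr 2

theorem hankel_submatrix_castSucc {α : Type*} (n : ℕ) (h : ℕ → α) :
    (hankel (n + 1) h).submatrix Fin.castSucc Fin.castSucc = hankel n h := rfl

theorem bracket_single_right (u : Fin (n + 2) → R) :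
    bracket n h u (Pi.single (Fin.last (n + 1)) 1) =
      ((hankel (n + 1) h).updateRow (Fin.last n) fun j => u j.castSucc).det := by
  rw [bracket, det_updateRow_last_single]
  congr 1
  ext i j
  refine Fin.lastCases ?_ (fun i => ?_) i
  · simp
  · simp [hankel, updateRow_apply]

theorem bracket_row_single :
    bracket n h (fun j => h (n + j)) (Pi.single (Fin.last (n + 1)) 1) =
      (hankel (n + 1) h).det := by
  rw [bracket_row_left, det_updateRow_last_single, hankel_submatrix_castSucc]

theorem bracket_single_single :
    bracket n h (Pi.single (Fin.last n).castSucc 1) (Pi.single (Fin.last (n + 1)) 1) =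
      (hankel n h).det := by
  rw [bracket_single_right, ← hankel_submatrix_castSucc n h, ← det_updateRow_last_single]
  congr 2
  ext j
  simp [Pi.single_apply]

theorem det_hankel_updateRow_geomVec (A : R) :
    ((hankel (n + 1) h).updateRow (Fin.last n) (geomVec A _)).det =
      (-1) ^ n * (hankel n (christoffel A h)).det := by
  rw [det_updateRow_last_geomVec]
  congr 2

theorem bracket_row_geomVec (A : R) :
    bracket n h (fun j => h (n + j)) (geomVec A _) =
      (-1) ^ (n + 1) * (hankel (n + 1) (christoffel A h)).det := by
  rw [bracket_row_left, det_hankel_updateRow_geomVec]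

theorem bracket_geomVec_single (A : R) :
    bracket n h (geomVec A _) (Pi.single (Fin.last (n + 1)) 1) =
      (-1) ^ n * (hankel n (christoffel A h)).det := by
  rw [bracket_single_right, ← det_hankel_updateRow_geomVec]
  rfl

theorem bracket_geomVec_geomVec (A B : R) :
    bracket n h (geomVec B _) (geomVec A _) =
      (B - A) * (hankel n (christoffel B (christoffel A h))).det := by
  rw [bracket, det_updateRow_last_geomVec]
  have : (Matrix.of fun i j : Fin (n + 1) =>
      ((hankel (n + 2) h).updateRow (Fin.last n).castSucc (geomVec B _)) i.castSucc j.succ + A *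
      ((hankel (n + 2) h).updateRow (Fin.last n).castSucc (geomVec B _)) i.castSucc j.castSucc) =
      (hankel (n + 1) (christoffel A h)).updateRow (Fin.last n) ((A - B) • geomVec B _) := by
    ext i j
    refine Fin.lastCases ?_ (fun i => ?_) i
    · simp [geomVec, pow_succ]
      ring
    · simp [hankel, updateRow_apply, christoffel, add_assoc]
  rw [this, det_updateRow_smul, det_hankel_updateRow_geomVec, pow_succ]
  have h1 := neg_one_pow_mul_self (R := R) n
  linear_combination (B - A) * (hankel n (christoffel B (christoffel A h))).det * h1

/-- Discrete Toda relation between the Hankel determinants of two Christoffel transforms. -/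
theorem christoffel_mul_christoffel_sub (A B : R) :
    (hankel (n + 1) (christoffel A h)).det * (hankel n (christoffel B h)).det -
      (hankel n (christoffel A h)).det * (hankel (n + 1) (christoffel B h)).det =
    (A - B) * ((hankel (n + 1) h).det * (hankel n (christoffel B (christoffel A h))).det) := by
  have hp := bracket_mul_bracket n h (fun j => h (n + j)) (Pi.single (Fin.last (n + 1)) 1)
    (geomVec B _) (geomVec A _)
  rw [bracket_row_single, bracket_geomVec_geomVec, bracket_geomVec_single, bracket_geomVec_single,
    bracket_row_geomVec, bracket_row_geomVec, pow_succ] at hp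
  have h1 := neg_one_pow_mul_self (R := R) n
  linear_combination hp -
    ((hankel (n + 1) (christoffel A h)).det * (hankel n (christoffel B h)).det -
      (hankel n (christoffel A h)).det * (hankel (n + 1) (christoffel B h)).det) * h1

end Algebra

section Derivative

theorem hasDerivAt_det_updateCol {ι : Type*} [Fintype ι] [DecidableEq ι] {M : ℝ → Matrix ι ι ℂ}
    {M' : Matrix ι ι ℂ} {t : ℝ} (hM : ∀ i j, HasDerivAt (fun s => M s i j) (M' i j) t) :
    HasDerivAt (fun s => (M s).det) (∑ j, ((M t).updateCol j fun i => M' i j).det) t := by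
  simp only [det_apply']
  rw [Finset.sum_comm]
  refine HasDerivAt.fun_sum fun σ _ => ?_
  rw [← Finset.mul_sum]
  refine HasDerivAt.const_mul _ ?_
  convert HasDerivAt.fun_finsetProd (u := Finset.univ) (fun j _ => hM (σ j) j) using 1
  refine Finset.sum_congr rfl fun j _ => ?_
  rw [← Finset.mul_prod_erase _ _ (Finset.mem_univ j), smul_eq_mul, mul_comm]
  congr 1
  · refine Finset.prod_congr rfl fun k hk => ?_
    rw [updateCol_ne (Finset.ne_of_mem_erase hk)]
  · simp

theorem hasDerivAt_det_updateRow {ι : Type*} [Fintype ι] [DecidableEq ι] {M : ℝ → Matrix ι ι ℂ}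
    {M' : Matrix ι ι ℂ} {t : ℝ} (hM : ∀ i j, HasDerivAt (fun s => M s i j) (M' i j) t) :
    HasDerivAt (fun s => (M s).det) (∑ i, ((M t).updateRow i (M' i)).det) t := by
  have h := hasDerivAt_det_updateCol (M := fun s => (M s)ᵀ) (M' := M'ᵀ) (t := t)
    (fun i j => hM j i)
  simpa only [det_transpose, updateCol_transpose, transpose_apply] using h

/-- Derivative of a determinant each of whose columns differentiates to the next one. -/
theorem hasDerivAt_det_of_columns {m : ℕ} {x : Fin (m + 1) → ℕ → ℝ → ℂ} {r : ℂ} {t : ℝ}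
    (hx : ∀ i k, HasDerivAt (x i k) (r * x i (k + 1) t) t)
    (Z : Matrix (Fin (m + 2)) (Fin (m + 2)) ℂ) (hZ : ∀ i j, Z i.castSucc j = x i j t) :
    HasDerivAt (fun s => (Matrix.of fun i j : Fin (m + 1) => x i j s).det)
      (-r * (Z.updateRow (Fin.last (m + 1)) (Pi.single (Fin.last m).castSucc 1)).det) t := by
  have h := hasDerivAt_det_updateCol
    (M := fun s => Matrix.of fun i j : Fin (m + 1) => x i j s)
    (M' := Matrix.of fun i j : Fin (m + 1) => r * x i (j + 1) t) (t := t) (fun i j => hx i j)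
  convert h using 1
  rw [Fin.sum_univ_castSucc, Finset.sum_eq_zero, zero_add]
  · rw [← adjugate_apply, adjugate_fin_succ_eq_det_submatrix, Fin.succAbove_last]
    have hsign : ((-1 : ℂ)) ^ (((Fin.last (m + 1) : Fin (m + 2)) : ℕ) +
        (((Fin.last m).castSucc : Fin (m + 2)) : ℕ)) = -1 := by
      simp only [Fin.val_last, Fin.val_castSucc]
      exact Odd.neg_one_pow ⟨m, by ring⟩
    rw [hsign]
    have hcol : (Matrix.of fun i j : Fin (m + 1) => x i j t).updateCol (Fin.last m)
        (fun i => (Matrix.of fun i j : Fin (m + 1) => r * x i (j + 1) t) i (Fin.last m)) =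
        (Matrix.of fun i j : Fin (m + 1) => x i j t).updateCol (Fin.last m)
          (r • fun i => x i (m + 1) t) := by
      ext i j
      simp [updateCol_apply]
    rw [hcol, det_updateCol_smul, neg_mul, neg_one_mul, mul_neg, neg_neg]
    congr 2
    ext i j
    refine Fin.lastCases ?_ (fun j => ?_) j
    · simp [hZ]
    · have : ((Fin.last m).castSucc : Fin (m + 2)).succAbove j.castSucc = j.castSucc.castSucc :=
        Fin.succAbove_of_castSucc_lt _ _ (by simp [Fin.lt_def])
      simp [this, hZ, (Fin.castSucc_lt_last j).ne]
  · intro j _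
    have hcol : (Matrix.of fun i j : Fin (m + 1) => x i j t).updateCol j.castSucc
        (fun i => (Matrix.of fun i j : Fin (m + 1) => r * x i (j + 1) t) i j.castSucc) =
        (Matrix.of fun i j : Fin (m + 1) => x i j t).updateCol j.castSucc
          (r • fun i => x i (j + 1) t) := by
      ext i j
      simp [updateCol_apply]
    rw [hcol, det_updateCol_smul]
    rw [det_zero_of_column_eq (i := j.castSucc) (j := j.succ) (Fin.castSucc_lt_succ).ne, mul_zero]
    intro i
    simp [(Fin.castSucc_lt_succ (i := j)).ne']

variable {h : ℕ → ℝ → ℂ} {r : ℂ} {t : ℝ}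

theorem hasDerivAt_bracket (hh : ∀ k, HasDerivAt (h k) (r * h (k + 1) t) t) (n : ℕ)
    (v : Fin (n + 2) → ℂ) :
    HasDerivAt (fun s => bracket n (fun k => h k s) (fun j => h (n + j) s) v)
      (r * bracket n (fun k => h k t) (fun j => h (n + 1 + j) t) v) t := by
  simp only [bracket_row_left n (fun k => h k _)]
  have hd := hasDerivAt_det_updateRow
    (M := fun s => (hankel (n + 2) (fun k => h k s)).updateRow (Fin.last (n + 1)) v)
    (M' := (Matrix.of fun i j : Fin (n + 2) => r * h (i + 1 + j) t).updateRow (Fin.last (n + 1)) 0)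
    (t := t) ?_
  · convert hd using 1
    rw [Fin.sum_univ_castSucc, Fin.sum_univ_castSucc, Finset.sum_eq_zero]
    · have hlast : (((hankel (n + 2) (fun k => h k t)).updateRow (Fin.last (n + 1)) v).updateRow
          (Fin.last (n + 1)) (((Matrix.of fun i j : Fin (n + 2) =>
            r * h (i + 1 + j) t).updateRow (Fin.last (n + 1)) 0) (Fin.last (n + 1)))).det = 0 :=
        det_eq_zero_of_row_eq_zero (Fin.last (n + 1)) (by simp)
      rw [hlast, zero_add, add_zero, bracket, updateRow_comm _ (Fin.castSucc_lt_last _).ne,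
        ← det_updateRow_smul]
      congr 2
      ext j
      simp
    · intro i _
      have hrow : ((Matrix.of fun i j : Fin (n + 2) =>
          r * h (i + 1 + j) t).updateRow (Fin.last (n + 1)) 0) i.castSucc.castSucc =
          r • (fun j : Fin (n + 2) => h (i + 1 + j) t) := by
        ext j
        simp
      rw [hrow, det_updateRow_smul, det_zero_of_row_eq (i := i.castSucc.castSucc)
        (j := i.succ.castSucc), mul_zero]
      · simp [Fin.ext_iff]
      · ext j
        rw [updateRow_self, updateRow_ne (by simp [Fin.ext_iff]),
          updateRow_ne (Fin.castSucc_lt_last _).ne]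
        simp [hankel]
  · intro i j
    refine Fin.lastCases ?_ (fun i => ?_) i
    · simpa using hasDerivAt_const t (v j)
    · simp only [updateRow_ne (Fin.castSucc_lt_last i).ne]
      have h0 := hh (i + j)
      rw [add_right_comm] at h0
      simpa [hankel] using h0

theorem hasDerivAt_det_hankel (hh : ∀ k, HasDerivAt (h k) (r * h (k + 1) t) t) (n : ℕ) :
    HasDerivAt (fun s => (hankel (n + 1) (fun k => h k s)).det)
      (r * bracket n (fun k => h k t) (fun j => h (n + 1 + j) t)
        (Pi.single (Fin.last (n + 1)) 1)) t := by
  have hd := hasDerivAt_bracket hh n (Pi.single (Fin.last (n + 1)) 1)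
  simpa only [bracket_row_single n (fun k => h k _)] using hd

theorem hasDerivAt_det_hankel_christoffel (hh : ∀ k, HasDerivAt (h k) (r * h (k + 1) t) t)
    (n : ℕ) (A : ℂ) :
    HasDerivAt (fun s => (hankel (n + 1) (christoffel A fun k => h k s)).det)
      (r * ((-1) ^ (n + 1) * bracket n (fun k => h k t) (fun j => h (n + 1 + j) t)
        (geomVec A _))) t := by
  have hd := (hasDerivAt_bracket hh n (geomVec A _)).const_mul ((-1) ^ (n + 1))
  simp only [bracket_row_geomVec n (fun k => h k _), ← mul_assoc, neg_one_pow_mul_self,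
    one_mul] at hd
  refine hd.congr_deriv ?_
  ring

variable {n : ℕ} {A B T' S' SA' SB' : ℂ}

theorem bracket_row_single_castSucc (hr : r ≠ 0)
    (hh : ∀ k, HasDerivAt (h k) (r * h (k + 1) t) t)
    (hT : HasDerivAt (fun s => (hankel (n + 1) (fun k => h k s)).det) (r * T') t) :
    bracket n (fun k => h k t) (fun j => h (n + j) t) (Pi.single (Fin.last n).castSucc 1) =
      -T' := by
  have hd := hasDerivAt_det_of_columns (x := fun i k => h (i + k)) (fun i k => hh (i + k))
    (hankel (n + 2) (fun k => h k t)) (fun i j => rfl)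
  have hu := hT.unique hd
  rw [bracket_row_left n (fun k => h k t)]
  apply mul_left_cancel₀ hr
  linear_combination hu

theorem bracket_geomVec_single_castSucc (hr : r ≠ 0)
    (hh : ∀ k, HasDerivAt (h k) (r * h (k + 1) t) t)
    (hS : HasDerivAt (fun s => (hankel n (christoffel A fun k => h k s)).det) (r * S') t) :
    bracket n (fun k => h k t) (geomVec A _) (Pi.single (Fin.last n).castSucc 1) =
      (-1) ^ n * (A * (hankel n (christoffel A fun k => h k t)).det - S') := by
  have hq : HasDerivAt (fun s : ℝ => 1 - A * r * ((s : ℂ) - t)) (-(A * r)) t := by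
    simpa using (((Complex.ofRealCLM.hasDerivAt (x := t)).sub_const (t : ℂ)).const_mul
      (A * r)).const_sub 1
  let x : Fin (n + 1) → ℕ → ℝ → ℂ := fun i k s =>
    Fin.lastCases (motive := fun _ => ℂ) ((1 - A * r * ((s : ℂ) - t)) * (-A) ^ k)
      (fun i => h (i + k) s) i
  have hx : ∀ i k, HasDerivAt (x i k) (r * x i (k + 1) t) t := by
    intro i k
    refine Fin.lastCases ?_ (fun i => ?_) i
    · simp only [x, Fin.lastCases_last]
      refine (hq.mul_const ((-A) ^ k)).congr_deriv ?_
      simp only [sub_self, mul_zero, sub_zero, pow_succ]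
      ring
    · simp only [x, Fin.lastCases_castSucc]
      exact hh (i + k)
  have hd := hasDerivAt_det_of_columns hx
    ((hankel (n + 2) (fun k => h k t)).updateRow (Fin.last n).castSucc (geomVec A _)) (by
      intro i j
      refine Fin.lastCases ?_ (fun i => ?_) i
      · simp [x, geomVec]
      · simp [x, hankel, updateRow_apply])
  have hdet : ∀ s : ℝ, (Matrix.of fun i j : Fin (n + 1) => x i j s).det =
      (1 - A * r * ((s : ℂ) - t)) *
        ((-1) ^ n * (hankel n (christoffel A fun k => h k s)).det) := by
    intro s
    rw [← det_hankel_updateRow_geomVec, ← det_updateRow_smul]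
    congr 1
    ext i j
    refine Fin.lastCases ?_ (fun i => ?_) i
    · simp [x, geomVec]
    · simp [x, hankel, updateRow_apply]
  simp only [hdet] at hd
  have hu := (hq.mul (hS.const_mul ((-1) ^ n))).unique hd
  simp only [sub_self, mul_zero, sub_zero, one_mul] at hu
  apply mul_left_cancel₀ hr
  rw [bracket]
  linear_combination hu

/-- First bilinear differential relation for a Christoffel transform. -/
theorem deriv_hankel_mul_sub (hr : r ≠ 0)
    (hh : ∀ k, HasDerivAt (h k) (r * h (k + 1) t) t)
    (hT : HasDerivAt (fun s => (hankel (n + 1) (fun k => h k s)).det) (r * T') t)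
    (hS : HasDerivAt (fun s => (hankel n (christoffel A fun k => h k s)).det) (r * S') t) :
    T' * (hankel n (christoffel A fun k => h k t)).det -
        (hankel (n + 1) (fun k => h k t)).det * S' =
      (hankel (n + 1) (christoffel A fun k => h k t)).det * (hankel n (fun k => h k t)).det -
        A * ((hankel (n + 1) (fun k => h k t)).det *
          (hankel n (christoffel A fun k => h k t)).det) := by
  have hp := bracket_mul_bracket n (fun k => h k t) (fun j => h (n + j) t)
    (Pi.single (Fin.last (n + 1)) 1) (Pi.single (Fin.last n).castSucc 1) (geomVec A _)
  rw [bracket_row_single n (fun k => h k t), bracket_swap _ _ (Pi.single (Fin.last n).castSucc 1)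
    (geomVec A _), bracket_geomVec_single_castSucc hr hh hS, bracket_single_single,
    bracket_row_geomVec n (fun k => h k t), bracket_row_single_castSucc hr hh hT,
    bracket_geomVec_single, pow_succ] at hp
  apply mul_left_cancel₀ (pow_ne_zero n (neg_ne_zero.mpr (one_ne_zero (α := ℂ))))
  linear_combination -hp

/-- Second bilinear differential relation for a Christoffel transform. -/
theorem deriv_hankel_christoffel_mul_sub (hr : r ≠ 0)
    (hh : ∀ k, HasDerivAt (h k) (r * h (k + 1) t) t)
    (hT : HasDerivAt (fun s => (hankel (n + 1) (fun k => h k s)).det) (r * T') t)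
    (hS : HasDerivAt (fun s => (hankel (n + 1) (christoffel A fun k => h k s)).det) (r * S') t) :
    S' * (hankel (n + 1) (fun k => h k t)).det -
        (hankel (n + 1) (christoffel A fun k => h k t)).det * T' =
      (hankel (n + 2) (fun k => h k t)).det * (hankel n (christoffel A fun k => h k t)).det := by
  have h1 := mul_left_cancel₀ hr (hT.unique (hasDerivAt_det_hankel hh n))
  have h2 := mul_left_cancel₀ hr (hS.unique (hasDerivAt_det_hankel_christoffel hh n A))
  have hp := bracket_mul_bracket n (fun k => h k t) (fun j => h (n + j) t)
    (fun j => h (n + 1 + j) t) (geomVec A _) (Pi.single (Fin.last (n + 1)) 1)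
  rw [bracket_row_row n (fun k => h k t), bracket_geomVec_single, bracket_row_single n
    (fun k => h k t), bracket_row_geomVec n (fun k => h k t),
    bracket_swap _ _ (geomVec A _), bracket_swap _ _ (Pi.single (Fin.last (n + 1)) 1), ← h1] at hp
  rw [h2]
  have h3 := neg_one_pow_mul_self (R := ℂ) n
  rw [pow_succ] at *
  set X := bracket n (fun k => h k t) (fun j => h (n + 1 + j) t) (geomVec A _)
  linear_combination (-(-1) ^ n) * hp + ((hankel (n + 1) (christoffel A fun k => h k t)).det * T' +
    (hankel (n + 2) (fun k => h k t)).det * (hankel n (christoffel A fun k => h k t)).det) * h3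

/-- Bilinear differential relation between two Christoffel transforms. -/
theorem hankel_mul_hankel_christoffel_christoffel (hr : r ≠ 0)
    (hh : ∀ k, HasDerivAt (h k) (r * h (k + 1) t) t)
    (hA : HasDerivAt (fun s => (hankel n (christoffel A fun k => h k s)).det) (r * SA') t)
    (hB : HasDerivAt (fun s => (hankel n (christoffel B fun k => h k s)).det) (r * SB') t) :
    (A - B) * ((hankel n (fun k => h k t)).det *
        (hankel n (christoffel B (christoffel A fun k => h k t))).det) =
      (hankel n (christoffel A fun k => h k t)).det * SB' -
        (hankel n (christoffel B fun k => h k t)).det * SA' +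
        (A - B) * ((hankel n (christoffel A fun k => h k t)).det *
          (hankel n (christoffel B fun k => h k t)).det) := by
  have hp := bracket_mul_bracket n (fun k => h k t) (Pi.single (Fin.last n).castSucc 1)
    (Pi.single (Fin.last (n + 1)) 1) (geomVec B _) (geomVec A _)
  rw [bracket_single_single, bracket_geomVec_geomVec, bracket_geomVec_single,
    bracket_geomVec_single, bracket_swap _ _ (Pi.single (Fin.last n).castSucc 1),
    bracket_swap _ _ (Pi.single (Fin.last n).castSucc 1),
    bracket_geomVec_single_castSucc hr hh hA, bracket_geomVec_single_castSucc hr hh hB] at hp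
  have h3 := neg_one_pow_mul_self (R := ℂ) n
  set σA := (hankel n (christoffel A fun k => h k t)).det
  set σB := (hankel n (christoffel B fun k => h k t)).det
  linear_combination -hp + (A * σA * σB - B * σA * σB + σA * SB' - σB * SA') * h3

end Derivative

section Gauss

open Filter Topology

/-- A complex number that is not an integer. -/
def NonInt (z : ℂ) : Prop := ∀ n : ℤ, z ≠ n

theorem NonInt.add_int {z : ℂ} (hz : NonInt z) (k : ℤ) : NonInt (z + k) := by
  intro n h
  apply hz (n - k)
  push_cast
  linear_combination h

theorem NonInt.add_natCast {z : ℂ} (hz : NonInt z) (k : ℕ) : NonInt (z + k) := by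
  simpa using hz.add_int k

theorem NonInt.add_one {z : ℂ} (hz : NonInt z) : NonInt (z + 1) := by
  simpa using hz.add_int 1

theorem NonInt.sub_one {z : ℂ} (hz : NonInt z) : NonInt (z - 1) := by
  simpa [sub_eq_add_neg] using hz.add_int (-1)

theorem NonInt.ne_zero {z : ℂ} (hz : NonInt z) : z ≠ 0 := by
  simpa using hz 0

theorem NonInt.add_natCast_ne_zero {z : ℂ} (hz : NonInt z) (k : ℕ) : z + k ≠ 0 :=
  (hz.add_natCast k).ne_zero

theorem NonInt.Gamma_ne_zero {z : ℂ} (hz : NonInt z) : Complex.Gamma z ≠ 0 :=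
  Complex.Gamma_ne_zero fun m => by simpa using hz (-m)

/-- Coefficients of the Gauss series multiplied by `Γ(A)Γ(B)/Γ(C)`. -/
noncomputable def gammaCoeff (A B C : ℂ) (n : ℕ) : ℂ :=
  Complex.Gamma (A + n) * Complex.Gamma (B + n) / (Complex.Gamma (C + n) * n.factorial)

/-- The Gauss series multiplied by `Γ(A)Γ(B)/Γ(C)`. -/
noncomputable def gammaF (A B C : ℂ) (t : ℝ) : ℂ := ∑' n : ℕ, gammaCoeff A B C n * (t : ℂ) ^ n

variable {A B C : ℂ}

theorem Gamma_add_natCast (hA : NonInt A) (n : ℕ) :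
    Complex.Gamma (A + n) = Complex.Gamma A * (ascPochhammer ℂ n).eval A := by
  induction n with
  | zero => simp
  | succ n ih =>
    rw [ascPochhammer_succ_eval, Nat.cast_succ, ← add_assoc,
      Complex.Gamma_add_one _ (hA.add_natCast_ne_zero n), ih]
    ring

theorem Gamma_mul_gaussF (hA : NonInt A) (hB : NonInt B) (hC : NonInt C) (t : ℝ) :
    Complex.Gamma A * Complex.Gamma B / Complex.Gamma C * gaussF A B C t = gammaF A B C t := by
  rw [gaussF, gammaF, ← tsum_mul_left]
  congr 1
  ext n
  rw [gammaCoeff, Gamma_add_natCast hA, Gamma_add_natCast hB, Gamma_add_natCast hC]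
  have h1 := hC.Gamma_ne_zero
  have h2 : (ascPochhammer ℂ n).eval C ≠ 0 := by
    have := (hC.add_natCast n).Gamma_ne_zero
    rw [Gamma_add_natCast hC] at this
    exact right_ne_zero_of_mul this
  field_simp

theorem gammaCoeff_succ (n : ℕ) :
    (n + 1) * gammaCoeff A B C (n + 1) = gammaCoeff (A + 1) (B + 1) (C + 1) n := by
  have h : (n : ℂ) + 1 ≠ 0 := Nat.cast_add_one_ne_zero n
  rw [gammaCoeff, gammaCoeff, Nat.factorial_succ]
  push_cast
  rw [add_right_comm A, add_right_comm B, add_right_comm C, ← add_assoc, ← add_assoc, ← add_assoc]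
  field_simp

theorem gammaCoeff_left (hA : NonInt A) (n : ℕ) :
    (A + n) * gammaCoeff A B C n = gammaCoeff (A + 1) B C n := by
  rw [gammaCoeff, gammaCoeff, add_right_comm, Complex.Gamma_add_one _ (hA.add_natCast_ne_zero n)]
  ring

theorem gammaCoeff_right (hB : NonInt B) (n : ℕ) :
    (B + n) * gammaCoeff A B C n = gammaCoeff A (B + 1) C n := by
  rw [gammaCoeff, gammaCoeff, add_right_comm, Complex.Gamma_add_one _ (hB.add_natCast_ne_zero n)]
  ring

theorem gammaCoeff_denominator (hC : NonInt C) (n : ℕ) :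
    (C + n) * gammaCoeff A B (C + 1) n = gammaCoeff A B C n := by
  rw [gammaCoeff, gammaCoeff, add_right_comm C, Complex.Gamma_add_one _ (hC.add_natCast_ne_zero n)]
  have h1 := hC.add_natCast_ne_zero n
  have h2 := (hC.add_natCast n).Gamma_ne_zero
  field_simp

theorem gammaCoeff_ne_zero (hA : NonInt A) (hB : NonInt B) (hC : NonInt C) (n : ℕ) :
    gammaCoeff A B C n ≠ 0 :=
  div_ne_zero (mul_ne_zero (hA.add_natCast n).Gamma_ne_zero (hB.add_natCast n).Gamma_ne_zero)
    (mul_ne_zero (hC.add_natCast n).Gamma_ne_zero (Nat.cast_ne_zero.mpr n.factorial_ne_zero))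

theorem summable_gammaCoeff (hA : NonInt A) (hB : NonInt B) (hC : NonInt C) {r : ℝ}
    (hr0 : 0 < r) (hr1 : r < 1) : Summable fun n => ‖gammaCoeff A B C n‖ * r ^ n := by
  refine summable_of_ratio_test_tendsto_lt_one (l := r) hr1 (Eventually.of_forall fun n =>
    (mul_pos (norm_pos_iff.mpr (gammaCoeff_ne_zero hA hB hC n)) (pow_pos hr0 n)).ne') ?_
  have hlim : Tendsto (fun n : ℕ => ((A + n) / (C + n)) * ((B + n) / (1 + n))) atTop
      (𝓝 ((1 : ℂ) * 1)) := by
    refine Tendsto.mul ?_ ?_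
    · simpa using tendsto_add_mul_div_add_mul_atTop_nhds A C (1 : ℂ) one_ne_zero
    · simpa using tendsto_add_mul_div_add_mul_atTop_nhds B 1 (1 : ℂ) one_ne_zero
  have hlim' := hlim.norm.mul_const r
  simp only [mul_one, norm_one, one_mul] at hlim'
  refine hlim'.congr fun n => ?_
  have h1 : (1 : ℂ) + n ≠ 0 := by
    rw [add_comm]
    exact Nat.cast_add_one_ne_zero n
  have hs : gammaCoeff A B C (n + 1) =
      (A + n) / (C + n) * ((B + n) / (1 + n)) * gammaCoeff A B C n := by
    have h2 := hC.add_natCast_ne_zero n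
    have h3 := gammaCoeff_succ (A := A) (B := B) (C := C) n
    rw [← gammaCoeff_left hA, ← gammaCoeff_right hB] at h3
    have h4 := gammaCoeff_denominator (A := A) (B := B) hC n
    field_simp
    linear_combination (C + n) * h3 + (A + n) * (B + n) * h4
  have h5 := norm_ne_zero_iff.mpr (gammaCoeff_ne_zero hA hB hC n)
  have h6 : r ^ n ≠ 0 := (pow_pos hr0 n).ne'
  rw [Real.norm_of_nonneg (by positivity), Real.norm_of_nonneg (by positivity), hs,
    norm_mul _ (gammaCoeff A B C n), pow_succ]
  field_simp

theorem hasSum_gammaF (hA : NonInt A) (hB : NonInt B) (hC : NonInt C) {t : ℝ}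
    (ht : t ∈ Set.Ioo (0 : ℝ) 1) :
    HasSum (fun n => gammaCoeff A B C n * (t : ℂ) ^ n) (gammaF A B C t) := by
  refine (Summable.of_norm ?_).hasSum
  simpa [abs_of_pos ht.1] using summable_gammaCoeff hA hB hC ht.1 ht.2

theorem hasDerivAt_gammaF (hA : NonInt A) (hB : NonInt B) (hC : NonInt C) {t : ℝ}
    (ht : t ∈ Set.Ioo (0 : ℝ) 1) :
    HasDerivAt (gammaF A B C) (gammaF (A + 1) (B + 1) (C + 1) t) t := by
  obtain ⟨r, htr, hr1⟩ := exists_between ht.2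
  have hr0 : 0 < r := ht.1.trans htr
  have hterm : ∀ (n : ℕ) (s : ℝ), HasDerivAt (fun s : ℝ => gammaCoeff A B C n * (s : ℂ) ^ n)
      (gammaCoeff A B C n * (n * (s : ℂ) ^ (n - 1))) s := by
    intro n s
    have := (hasDerivAt_pow n (s : ℂ)).comp_ofReal
    exact this.const_mul _
  have hsucc : ∀ (n : ℕ) (s : ℝ), gammaCoeff A B C (n + 1) *
      (((n + 1 : ℕ) : ℂ) * (s : ℂ) ^ (n + 1 - 1)) =
        gammaCoeff (A + 1) (B + 1) (C + 1) n * (s : ℂ) ^ n := by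
    intro n s
    rw [← gammaCoeff_succ, Nat.add_sub_cancel]
    push_cast
    ring
  have hu : Summable fun n => ‖gammaCoeff A B C n * (n * (r : ℂ) ^ (n - 1))‖ := by
    rw [← summable_nat_add_iff 1]
    simp only [hsucc]
    simpa [abs_of_pos hr0] using summable_gammaCoeff hA.add_one hB.add_one hC.add_one hr0 hr1
  have hd := hasDerivAt_tsum_of_isPreconnected (t := Set.Ioo 0 r) (y₀ := t) (y := t) hu isOpen_Ioo
    isPreconnected_Ioo (fun n y _ => hterm n y) (fun n y hy => ?_) ⟨ht.1, htr⟩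
    (hasSum_gammaF hA hB hC ht).summable ⟨ht.1, htr⟩
  · refine hd.congr_deriv ?_
    rw [Summable.tsum_eq_zero_add, gammaF]
    · simp only [Nat.cast_zero, zero_mul, mul_zero, zero_add, hsucc]
    · rw [← summable_nat_add_iff 1]
      simp only [hsucc]
      exact (hasSum_gammaF hA.add_one hB.add_one hC.add_one ht).summable
  · simp only [norm_mul, norm_pow, Complex.norm_real, Real.norm_of_nonneg hy.1.le,
      Real.norm_of_nonneg hr0.le]
    gcongr
    exacts [hy.1.le, hy.2.le]

theorem hasSum_mul_gammaF_succ (hA : NonInt A) (hB : NonInt B) (hC : NonInt C) {t : ℝ}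
    (ht : t ∈ Set.Ioo (0 : ℝ) 1) :
    HasSum (fun n : ℕ => n * gammaCoeff A B C n * (t : ℂ) ^ n)
      (t * gammaF (A + 1) (B + 1) (C + 1) t) := by
  rw [← hasSum_nat_add_iff' 1]
  simp only [Finset.range_one, Finset.sum_singleton, Nat.cast_zero, zero_mul, sub_zero]
  refine ((hasSum_gammaF hA.add_one hB.add_one hC.add_one ht).mul_left (t : ℂ)).congr_fun
    fun n => ?_
  rw [← gammaCoeff_succ, pow_succ]
  push_cast
  ring

theorem gammaF_left (hA : NonInt A) (hB : NonInt B) (hC : NonInt C) {t : ℝ}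
    (ht : t ∈ Set.Ioo (0 : ℝ) 1) :
    t * gammaF (A + 1) (B + 1) (C + 1) t + A * gammaF A B C t = gammaF (A + 1) B C t := by
  have h1 := (hasSum_mul_gammaF_succ hA hB hC ht).add ((hasSum_gammaF hA hB hC ht).mul_left A)
  refine h1.unique ?_
  convert hasSum_gammaF hA.add_one hB hC ht using 2 with n
  rw [← gammaCoeff_left hA]
  ring

theorem gammaF_right (hA : NonInt A) (hB : NonInt B) (hC : NonInt C) {t : ℝ}
    (ht : t ∈ Set.Ioo (0 : ℝ) 1) :
    t * gammaF (A + 1) (B + 1) (C + 1) t + B * gammaF A B C t = gammaF A (B + 1) C t := by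
  have h1 := (hasSum_mul_gammaF_succ hA hB hC ht).add ((hasSum_gammaF hA hB hC ht).mul_left B)
  refine h1.unique ?_
  convert hasSum_gammaF hA hB.add_one hC ht using 2 with n
  rw [← gammaCoeff_right hB]
  ring

theorem gammaF_denominator (hA : NonInt A) (hB : NonInt B) (hC : NonInt C) {t : ℝ}
    (ht : t ∈ Set.Ioo (0 : ℝ) 1) :
    t * gammaF (A + 1) (B + 1) (C + 1) t + (C - 1) * gammaF A B C t = gammaF A B (C - 1) t := by
  have h1 := (hasSum_mul_gammaF_succ hA hB hC ht).add
    ((hasSum_gammaF hA hB hC ht).mul_left (C - 1))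
  refine h1.unique ?_
  convert hasSum_gammaF hA hB hC.sub_one ht using 2 with n
  rw [← gammaCoeff_denominator hC.sub_one, sub_add_cancel]
  ring

/-- Parameters for which the Gauss equation has no integer exponents. -/
structure Generic (A B C : ℂ) : Prop where
  left : NonInt A
  right : NonInt B
  denominator : NonInt C
  left_sub : NonInt (A - C)
  right_sub : NonInt (B - C)

theorem Generic.shift (h : Generic A B C) (k l m : ℤ) : Generic (A + k) (B + l) (C + m) where
  left := h.left.add_int k
  right := h.right.add_int l
  denominator := h.denominator.add_int m
  left_sub := by
    convert h.left_sub.add_int (k - m) using 1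
    push_cast
    ring
  right_sub := by
    convert h.right_sub.add_int (l - m) using 1
    push_cast
    ring

theorem NonInt.const_sub {z : ℂ} (hz : NonInt z) (k : ℤ) : NonInt (k - z) := by
  intro n h
  apply hz (k - n)
  push_cast
  linear_combination -h

/-- A normalized general solution of the Gauss equation on `(0, 1)`. -/
noncomputable def gaussSolution (c₁ c₂ A B C : ℂ) (t : ℝ) : ℂ :=
  c₁ * gammaF A B C t +
    c₂ * ((t : ℂ) ^ (1 - C) * gammaF (A - C + 1) (B - C + 1) (2 - C) t)

variable {t : ℝ} (c₁ c₂ : ℂ)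

theorem ofReal_cpow_add_one (ht : t ∈ Set.Ioo (0 : ℝ) 1) (z : ℂ) :
    (t : ℂ) ^ (z + 1) = (t : ℂ) ^ z * t := by
  rw [Complex.cpow_add _ _ (Complex.ofReal_ne_zero.mpr ht.1.ne'), Complex.cpow_one]

theorem hasDerivAt_gaussSolution (h : Generic A B C) (ht : t ∈ Set.Ioo (0 : ℝ) 1) :
    HasDerivAt (gaussSolution c₁ c₂ A B C)
      (gaussSolution c₁ c₂ (A + 1) (B + 1) (C + 1) t) t := by
  have hA := h.left_sub.add_one
  have hB := h.right_sub.add_one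
  have hC := h.denominator.const_sub 2
  push_cast at hC
  have h1 := hasDerivAt_gammaF h.left h.right h.denominator ht
  have h2 := hasDerivAt_gammaF hA hB hC ht
  have h3 : HasDerivAt (fun s : ℝ => (s : ℂ) ^ (1 - C)) ((1 - C) * (t : ℂ) ^ (1 - C - 1)) t := by
    have := (hasDerivAt_id (t : ℂ)).cpow_const (c := 1 - C) (Or.inl (by simpa using ht.1))
    simpa using this.comp_ofReal
  refine ((h1.const_mul c₁).add ((h3.mul h2).const_mul c₂)).congr_deriv ?_
  have h4 := gammaF_denominator hA hB hC ht
  rw [gaussSolution, show A + 1 - (C + 1) + 1 = A - C + 1 by ring,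
    show B + 1 - (C + 1) + 1 = B - C + 1 by ring, show 2 - (C + 1) = 2 - C - 1 by ring,
    show 1 - (C + 1) = 1 - C - 1 by ring, ← h4, ← sub_add_cancel (1 - C) 1,
    ofReal_cpow_add_one ht]
  ring_nf

theorem gaussSolution_left (h : Generic A B C) (ht : t ∈ Set.Ioo (0 : ℝ) 1) :
    gaussSolution c₁ c₂ (A + 1) B C t = t * gaussSolution c₁ c₂ (A + 1) (B + 1) (C + 1) t +
      A * gaussSolution c₁ c₂ A B C t := by
  have hA := h.left_sub.add_one
  have hB := h.right_sub.add_one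
  have hC := h.denominator.const_sub 2
  push_cast at hC
  have h4 := gammaF_denominator hA hB hC ht
  have h5 := gammaF_left hA hB hC ht
  have h6 := gammaF_left h.left h.right h.denominator ht
  have h7 := ofReal_cpow_add_one ht (1 - C - 1)
  rw [sub_add_cancel] at h7
  simp only [gaussSolution]
  rw [show A + 1 - (C + 1) + 1 = A - C + 1 by ring, show A + 1 - C + 1 = A - C + 1 + 1 by ring,
    show B + 1 - (C + 1) + 1 = B - C + 1 by ring, show 2 - (C + 1) = 2 - C - 1 by ring,
    show 1 - (C + 1) = 1 - C - 1 by ring, ← h4, ← h5, ← h6, h7]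
  ring

theorem gaussSolution_right (h : Generic A B C) (ht : t ∈ Set.Ioo (0 : ℝ) 1) :
    gaussSolution c₁ c₂ A (B + 1) C t = t * gaussSolution c₁ c₂ (A + 1) (B + 1) (C + 1) t +
      B * gaussSolution c₁ c₂ A B C t := by
  have hA := h.left_sub.add_one
  have hB := h.right_sub.add_one
  have hC := h.denominator.const_sub 2
  push_cast at hC
  have h4 := gammaF_denominator hA hB hC ht
  have h5 := gammaF_right hA hB hC ht
  have h6 := gammaF_right h.left h.right h.denominator ht
  have h7 := ofReal_cpow_add_one ht (1 - C - 1)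
  rw [sub_add_cancel] at h7
  simp only [gaussSolution]
  rw [show A + 1 - (C + 1) + 1 = A - C + 1 by ring, show B + 1 - C + 1 = B - C + 1 + 1 by ring,
    show B + 1 - (C + 1) + 1 = B - C + 1 by ring, show 2 - (C + 1) = 2 - C - 1 by ring,
    show 1 - (C + 1) = 1 - C - 1 by ring, ← h4, ← h5, ← h6, h7]
  ring

theorem gaussSolution_denominator (h : Generic A B C) (ht : t ∈ Set.Ioo (0 : ℝ) 1) :
    gaussSolution c₁ c₂ A B (C - 1) t = t * gaussSolution c₁ c₂ (A + 1) (B + 1) (C + 1) t +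
      (C - 1) * gaussSolution c₁ c₂ A B C t := by
  have hA := h.left_sub.add_one
  have hB := h.right_sub.add_one
  have hC := h.denominator.const_sub 2
  push_cast at hC
  have h4 := gammaF_denominator hA hB hC ht
  have h6 := gammaF_denominator h.left h.right h.denominator ht
  have h7 := ofReal_cpow_add_one ht (1 - C - 1)
  have h8 := ofReal_cpow_add_one ht (1 - C)
  rw [sub_add_cancel] at h7
  simp only [gaussSolution]
  rw [show A + 1 - (C + 1) + 1 = A - C + 1 by ring, show A - (C - 1) + 1 = A - C + 1 + 1 by ring,
    show B - (C - 1) + 1 = B - C + 1 + 1 by ring, show 2 - (C - 1) = 2 - C + 1 by ring,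
    show 1 - (C - 1) = 1 - C + 1 by ring,
    show B + 1 - (C + 1) + 1 = B - C + 1 by ring, show 2 - (C + 1) = 2 - C - 1 by ring,
    show 1 - (C + 1) = 1 - C - 1 by ring, ← h4, ← h6, h8, h7]
  ring

end Gauss

section Seed

variable {a b c : ℂ} (c₁ c₂ : ℂ) {t : ℝ}

theorem phiVI_eq_gaussSolution (h : Generic a b c) (k l m : ℤ) :
    phiVI a b c c₁ c₂ k l m = gaussSolution c₁ c₂ (a + k + 1) (b + l + 2) (c + m + 1) := by
  have hs := h.shift (k + 1) (l + 2) (m + 1)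
  push_cast at hs
  simp only [← add_assoc] at hs
  have hA := hs.left_sub.add_one
  have hB := hs.right_sub.add_one
  have hC := hs.denominator.const_sub 2
  push_cast at hC
  funext t
  have h1 := Gamma_mul_gaussF hs.left hs.right hs.denominator t
  have h2 := Gamma_mul_gaussF hA hB hC t
  rw [gaussSolution, phiVI, ← h1, ← h2]
  ring_nf

theorem Generic.phiVI_parameters (h : Generic a b c) (k l m : ℤ) :
    Generic (a + k + 1) (b + l + 2) (c + m + 1) := by
  have hs := h.shift (k + 1) (l + 2) (m + 1)
  push_cast at hs
  simpa only [← add_assoc] using hs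

theorem add_intCast_succ_add (x y : ℂ) (k : ℤ) : x + ((k + 1 : ℤ) : ℂ) + y = x + k + y + 1 := by
  push_cast
  ring

theorem hasDerivAt_phiVI (h : Generic a b c) (k l m : ℤ) (ht : t ∈ Set.Ioo (0 : ℝ) 1) :
    HasDerivAt (phiVI a b c c₁ c₂ k l m) (phiVI a b c c₁ c₂ (k + 1) (l + 1) (m + 1) t) t := by
  simp only [phiVI_eq_gaussSolution c₁ c₂ h, add_intCast_succ_add]
  exact hasDerivAt_gaussSolution c₁ c₂ (h.phiVI_parameters k l m) ht

theorem eulerD_phiVI (h : Generic a b c) (k l m : ℤ) (ht : t ∈ Set.Ioo (0 : ℝ) 1) :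
    eulerD (phiVI a b c c₁ c₂ k l m) t = t * phiVI a b c c₁ c₂ (k + 1) (l + 1) (m + 1) t := by
  rw [eulerD, (hasDerivAt_phiVI c₁ c₂ h k l m ht).deriv]

theorem phiVI_left (h : Generic a b c) (k l m : ℤ) (ht : t ∈ Set.Ioo (0 : ℝ) 1) :
    phiVI a b c c₁ c₂ (k + 1) l m t =
      eulerD (phiVI a b c c₁ c₂ k l m) t + (a + k + 1) * phiVI a b c c₁ c₂ k l m t := by
  rw [eulerD_phiVI c₁ c₂ h k l m ht]
  simp only [phiVI_eq_gaussSolution c₁ c₂ h, add_intCast_succ_add]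
  exact gaussSolution_left c₁ c₂ (h.phiVI_parameters k l m) ht

theorem phiVI_right (h : Generic a b c) (k l m : ℤ) (ht : t ∈ Set.Ioo (0 : ℝ) 1) :
    phiVI a b c c₁ c₂ k (l + 1) m t =
      eulerD (phiVI a b c c₁ c₂ k l m) t + (b + l + 2) * phiVI a b c c₁ c₂ k l m t := by
  rw [eulerD_phiVI c₁ c₂ h k l m ht]
  simp only [phiVI_eq_gaussSolution c₁ c₂ h, add_intCast_succ_add]
  exact gaussSolution_right c₁ c₂ (h.phiVI_parameters k l m) ht

theorem phiVI_denominator (h : Generic a b c) (k l m : ℤ) (ht : t ∈ Set.Ioo (0 : ℝ) 1) :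
    phiVI a b c c₁ c₂ k l (m - 1) t =
      eulerD (phiVI a b c c₁ c₂ k l m) t + (c + m) * phiVI a b c c₁ c₂ k l m t := by
  rw [eulerD_phiVI c₁ c₂ h k l m ht]
  simp only [phiVI_eq_gaussSolution c₁ c₂ h, add_intCast_succ_add]
  rw [show c + ((m - 1 : ℤ) : ℂ) + 1 = c + m + 1 - 1 by push_cast; ring]
  linear_combination gaussSolution_denominator c₁ c₂ (h.phiVI_parameters k l m) ht

end Seed

section Gauge

open Matrix Polynomial

variable {R : Type*} [CommRing R]

/-- The linear functional on polynomials with moments `x`. -/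
noncomputable def momentFunctional (x : ℕ → R) : R[X] →ₗ[R] R :=
  Polynomial.lsum fun k => LinearMap.lsmul R R (x k)

theorem momentFunctional_X_pow (x : ℕ → R) (k : ℕ) : momentFunctional x (X ^ k) = x k := by
  simp [momentFunctional, ← Polynomial.monomial_one_right_eq_X_pow]

theorem iterate_christoffel (A : R) (x : ℕ → R) (i p : ℕ) :
    (christoffel A)^[i] x p = momentFunctional x ((X + C A) ^ i * X ^ p) := by
  induction i generalizing p with
  | zero => simp [momentFunctional_X_pow]
  | succ i ih =>
    rw [Function.iterate_succ_apply', christoffel, ih, ih, ← smul_eq_mul A, ← map_smul, ← map_add]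
    congr 1
    rw [smul_eq_C_mul]
    ring

theorem det_hankel_iterate_christoffel (A : R) (x : ℕ → R) (n : ℕ) :
    (hankel n fun k => (christoffel A)^[k] x 0).det = (hankel n x).det := by
  let L : Matrix (Fin n) (Fin n) R := Matrix.of fun i p => ((X + C A) ^ (i : ℕ)).coeff p
  have hL : L.det = 1 := by
    rw [det_of_isLowerTriangular]
    · refine Finset.prod_eq_one fun i _ => ?_
      simp only [L, Matrix.of_apply, coeff_X_add_C_pow]
      simp
    · intro i j hij
      have hij' : (i : ℕ) < j := hij
      simp [L, coeff_X_add_C_pow, Nat.choose_eq_zero_of_lt hij']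
  have hsum : ∀ i : Fin n, (X + C A) ^ (i : ℕ) = ∑ p : Fin n, L i p • (X : R[X]) ^ (p : ℕ) := by
    intro i
    have hdeg1 : (X + C A).natDegree ≤ 1 := by compute_degree
    have hdeg : ((X + C A) ^ (i : ℕ)).natDegree < n :=
      (natDegree_pow_le_of_le (i : ℕ) hdeg1).trans_lt (by simp)
    refine (as_sum_range' _ n hdeg).trans ?_
    rw [Finset.sum_range]
    simp [L, ← C_mul_X_pow_eq_monomial, smul_eq_C_mul]
  have hprod : (hankel n fun k => (christoffel A)^[k] x 0) = L * hankel n x * Lᵀ := by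
    ext i j
    rw [hankel, Matrix.of_apply, iterate_christoffel, pow_zero, mul_one, pow_add, hsum i, hsum j,
      Finset.sum_mul_sum]
    simp only [smul_mul_smul_comm, map_sum, map_smul, ← pow_add, momentFunctional_X_pow,
      hankel, Matrix.of_apply, Matrix.mul_apply, Matrix.transpose_apply, Finset.sum_mul,
      smul_eq_mul]
    rw [Finset.sum_comm]
    refine Finset.sum_congr rfl fun q _ => Finset.sum_congr rfl fun p _ => ?_
    ring
  rw [hprod, det_mul, det_mul, det_transpose, hL]
  ring

end Gauge

section Euler

open scoped ContDiff

variable {f g : ℝ → ℂ} {s : Set ℝ} {t : ℝ}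

theorem contDiffOn_eulerD (hs : IsOpen s) (hf : ContDiffOn ℝ ∞ f s) :
    ContDiffOn ℝ ∞ (eulerD f) s :=
  Complex.ofRealCLM.contDiff.contDiffOn.mul (hf.deriv_of_isOpen hs (by simp))

theorem contDiffOn_iterate_eulerD (hs : IsOpen s) (hf : ContDiffOn ℝ ∞ f s) (i : ℕ) :
    ContDiffOn ℝ ∞ (eulerD^[i] f) s := by
  induction i with
  | zero => exact hf
  | succ i ih =>
    rw [Function.iterate_succ_apply']
    exact contDiffOn_eulerD hs ih

theorem differentiableAt_iterate_eulerD (hs : IsOpen s) (hf : ContDiffOn ℝ ∞ f s) (i : ℕ)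
    (ht : t ∈ s) : DifferentiableAt ℝ (eulerD^[i] f) t :=
  ((contDiffOn_iterate_eulerD hs hf i).contDiffAt (hs.mem_nhds ht)).differentiableAt (by simp)

theorem hasDerivAt_iterate_eulerD (hs : IsOpen s) (hf : ContDiffOn ℝ ∞ f s) (i : ℕ)
    (ht : t ∈ s) (ht0 : t ≠ 0) :
    HasDerivAt (eulerD^[i] f) ((t : ℂ)⁻¹ * eulerD^[i + 1] f t) t := by
  refine (differentiableAt_iterate_eulerD hs hf i ht).hasDerivAt.congr_deriv ?_
  rw [Function.iterate_succ_apply', eulerD, inv_mul_cancel_left₀ (Complex.ofReal_ne_zero.mpr ht0)]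

theorem eulerD_eqOn (hs : IsOpen s) (h : Set.EqOn f g s) : Set.EqOn (eulerD f) (eulerD g) s := by
  intro t ht
  rw [eulerD, eulerD, (h.eventuallyEq_of_mem (hs.mem_nhds ht)).deriv_eq]

theorem iterate_eulerD_christoffel (hs : IsOpen s) (hf : ContDiffOn ℝ ∞ f s) {A : ℂ}
    (hg : ∀ t ∈ s, g t = eulerD f t + A * f t) (i : ℕ) :
    ∀ t ∈ s, eulerD^[i] g t = christoffel A (fun k => eulerD^[k] f t) i := by
  induction i with
  | zero => exact hg
  | succ i ih =>
    intro t ht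
    rw [Function.iterate_succ_apply', eulerD_eqOn hs ih ht, eulerD]
    have h1 := (differentiableAt_iterate_eulerD hs hf (i + 1) ht).hasDerivAt
    have h2 := (differentiableAt_iterate_eulerD hs hf i ht).hasDerivAt
    have h3 : HasDerivAt (fun t => christoffel A (fun k => eulerD^[k] f t) i) _ t :=
      h1.add (h2.const_mul A)
    rw [h3.deriv, christoffel, Function.iterate_succ_apply' _ (i + 1), eulerD,
      Function.iterate_succ_apply' _ i f]
    simp only [eulerD]
    ring

theorem iterate_eulerD_ofReal_mul (hs : IsOpen s) (hf : ContDiffOn ℝ ∞ f s)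
    (hg : ∀ t ∈ s, g t = t * f t) (i : ℕ) :
    ∀ t ∈ s, eulerD^[i] g t = t * (christoffel 1)^[i] (fun k => eulerD^[k] f t) 0 := by
  induction i generalizing f g with
  | zero => exact hg
  | succ i ih =>
    intro t ht
    have hF : ContDiffOn ℝ ∞ (fun t => eulerD f t + 1 * f t) s :=
      (contDiffOn_eulerD hs hf).add (contDiffOn_const.mul hf)
    have h1 := ih hF (g := eulerD g) (fun t ht => by
      have h2 := (differentiableAt_iterate_eulerD hs hf 0 ht).hasDerivAt
      have h3 : HasDerivAt (fun t : ℝ => (t : ℂ) * f t) _ t :=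
        (Complex.ofRealCLM.hasDerivAt (x := t)).mul h2
      rw [eulerD_eqOn hs (fun t ht => hg t ht) ht, eulerD, h3.deriv]
      simp only [eulerD, Complex.ofRealCLM_apply, Complex.ofReal_one, Function.iterate_zero, id]
      ring) t ht
    rw [Function.iterate_succ_apply, h1, Function.iterate_succ_apply]
    have h4 : (fun k => eulerD^[k] (fun t => eulerD f t + 1 * f t) t) =
        christoffel 1 fun k => eulerD^[k] f t :=
      funext fun k => iterate_eulerD_christoffel hs hf (fun t _ => rfl) k t ht
    rw [h4]

end Euler

section EulerHankel

open scoped ContDiff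

/-- The Hankel determinant of the Euler derivatives of `f`, zero for negative size. -/
noncomputable def eulerHankel (n : ℤ) (f : ℝ → ℂ) (t : ℝ) : ℂ :=
  if n < 0 then 0 else (hankel n.toNat fun k => eulerD^[k] f t).det

theorem eulerHankel_natCast (n : ℕ) (f : ℝ → ℂ) (t : ℝ) :
    eulerHankel n f t = (hankel n fun k => eulerD^[k] f t).det :=
  if_neg (by simp)

theorem eulerHankel_natCast_eq (n : ℕ) (f : ℝ → ℂ) :
    eulerHankel n f = fun t => (hankel n fun k => eulerD^[k] f t).det :=
  funext (eulerHankel_natCast n f)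

theorem eulerHankel_zero_sub_one (f : ℝ → ℂ) : eulerHankel (((0 : ℕ) : ℤ) - 1) f = fun _ => 0 :=
  funext fun _ => if_pos (by simp)

theorem natCast_succ_sub_one (n : ℕ) : ((n + 1 : ℕ) : ℤ) - 1 = n := by simp

theorem eulerD_const (z : ℂ) (t : ℝ) : eulerD (fun _ => z) t = 0 := by simp [eulerD]

theorem eulerHankel_zero (f : ℝ → ℂ) : eulerHankel ((0 : ℕ) : ℤ) f = fun _ => 1 := by
  rw [eulerHankel_natCast_eq]
  simp

variable {f g gA gB gAB : ℝ → ℂ} {A B : ℂ} {s : Set ℝ} {t : ℝ}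

theorem hasDerivAt_eulerHankel (hs : IsOpen s) (hf : ContDiffOn ℝ ∞ f s) (n : ℤ) (ht : t ∈ s)
    (ht0 : t ≠ 0) :
    HasDerivAt (eulerHankel n f) ((t : ℂ)⁻¹ * eulerD (eulerHankel n f) t) t := by
  have hd : DifferentiableAt ℝ (eulerHankel n f) t := by
    rcases lt_or_ge n 0 with hn | hn
    · have h : eulerHankel n f = fun _ => 0 := funext fun _ => if_pos hn
      rw [h]
      exact differentiableAt_const _
    · obtain ⟨n, rfl⟩ := Int.eq_ofNat_of_zero_le hn
      rw [eulerHankel_natCast_eq]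
      cases n with
      | zero => simp
      | succ n =>
        exact (hasDerivAt_det_hankel (fun k => hasDerivAt_iterate_eulerD hs hf k ht ht0)
          n).differentiableAt
  refine hd.hasDerivAt.congr_deriv ?_
  rw [eulerD, inv_mul_cancel_left₀ (Complex.ofReal_ne_zero.mpr ht0)]

/-- `g` is obtained from the smooth function `f` by applying `δ + A` on the set `s`. -/
structure DarbouxStep (s : Set ℝ) (A : ℂ) (f g : ℝ → ℂ) : Prop where
  isOpen : IsOpen s
  ne_zero : ∀ t ∈ s, t ≠ 0
  contDiffOn : ContDiffOn ℝ ∞ f s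
  contDiffOn_image : ContDiffOn ℝ ∞ g s
  eq : ∀ t ∈ s, g t = eulerD f t + A * f t

theorem DarbouxStep.iterate_eulerD (h : DarbouxStep s A f g) (ht : t ∈ s) :
    (fun k => eulerD^[k] g t) = christoffel A fun k => eulerD^[k] f t :=
  funext fun k => iterate_eulerD_christoffel h.isOpen h.contDiffOn h.eq k t ht

theorem DarbouxStep.hasDerivAt (h : DarbouxStep s A f g) (ht : t ∈ s) (k : ℕ) :
    HasDerivAt (eulerD^[k] f) ((t : ℂ)⁻¹ * eulerD^[k + 1] f t) t :=
  hasDerivAt_iterate_eulerD h.isOpen h.contDiffOn k ht (h.ne_zero t ht)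

theorem DarbouxStep.hasDerivAt_hankel (h : DarbouxStep s A f g) (ht : t ∈ s) (n : ℕ) :
    HasDerivAt (fun u => (hankel n fun k => eulerD^[k] f u).det)
      ((t : ℂ)⁻¹ * eulerD (eulerHankel n f) t) t := by
  rw [← eulerHankel_natCast_eq]
  exact hasDerivAt_eulerHankel h.isOpen h.contDiffOn n ht (h.ne_zero t ht)

theorem DarbouxStep.hasDerivAt_hankel_christoffel (h : DarbouxStep s A f g) (ht : t ∈ s) (n : ℕ) :
    HasDerivAt (fun u => (hankel n (christoffel A fun k => eulerD^[k] f u)).det)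
      ((t : ℂ)⁻¹ * eulerD (eulerHankel n g) t) t := by
  have hd := hasDerivAt_eulerHankel h.isOpen h.contDiffOn_image n ht (h.ne_zero t ht)
  refine hd.congr_of_eventuallyEq ?_
  filter_upwards [h.isOpen.mem_nhds ht] with u hu
  rw [eulerHankel_natCast, h.iterate_eulerD hu]

theorem DarbouxStep.inv_ne_zero (h : DarbouxStep s A f g) (ht : t ∈ s) : (t : ℂ)⁻¹ ≠ 0 :=
  _root_.inv_ne_zero (Complex.ofReal_ne_zero.mpr (h.ne_zero t ht))

theorem DarbouxStep.eulerD_mul_sub (h : DarbouxStep s A f g) (n : ℕ) (ht : t ∈ s) :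
    eulerD (eulerHankel n f) t * eulerHankel (n - 1) g t -
        eulerHankel n f t * eulerD (eulerHankel (n - 1) g) t =
      eulerHankel n g t * eulerHankel (n - 1) f t -
        A * (eulerHankel n f t * eulerHankel (n - 1) g t) := by
  cases n with
  | zero => simp only [eulerHankel_zero_sub_one, eulerD_const]; ring
  | succ n =>
    have h1 := deriv_hankel_mul_sub (h.inv_ne_zero ht) (h.hasDerivAt ht)
      (h.hasDerivAt_hankel ht (n + 1)) (h.hasDerivAt_hankel_christoffel ht n)
    simp only [natCast_succ_sub_one]
    simpa only [eulerHankel_natCast, h.iterate_eulerD ht] using h1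

theorem DarbouxStep.eulerD_image_mul_sub (h : DarbouxStep s A f g) (n : ℕ) (ht : t ∈ s) :
    eulerD (eulerHankel n g) t * eulerHankel n f t -
        eulerHankel n g t * eulerD (eulerHankel n f) t =
      eulerHankel (n + 1) f t * eulerHankel (n - 1) g t := by
  cases n with
  | zero => simp only [eulerHankel_zero_sub_one, eulerHankel_zero, eulerD_const]; ring
  | succ n =>
    have h1 := deriv_hankel_christoffel_mul_sub (h.inv_ne_zero ht) (h.hasDerivAt ht)
      (h.hasDerivAt_hankel ht (n + 1)) (h.hasDerivAt_hankel_christoffel ht (n + 1))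
    simp only [natCast_succ_sub_one, ← Nat.cast_add_one (R := ℤ)]
    simpa only [eulerHankel_natCast, h.iterate_eulerD ht] using h1

theorem DarbouxStep.mul_sub_mul (hA : DarbouxStep s A f gA) (hB : DarbouxStep s B f gB)
    (hAB : DarbouxStep s B gA gAB) (n : ℕ) (ht : t ∈ s) :
    eulerHankel n gA t * eulerHankel (n - 1) gB t -
        eulerHankel (n - 1) gA t * eulerHankel n gB t =
      (A - B) * (eulerHankel n f t * eulerHankel (n - 1) gAB t) := by
  cases n with
  | zero => simp only [eulerHankel_zero_sub_one]; ring
  | succ n =>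
    simp only [natCast_succ_sub_one, eulerHankel_natCast, hAB.iterate_eulerD ht,
      hA.iterate_eulerD ht, hB.iterate_eulerD ht]
    exact christoffel_mul_christoffel_sub n _ A B

theorem DarbouxStep.mul_eulerD_sub (hA : DarbouxStep s A f gA) (hB : DarbouxStep s B f gB)
    (hAB : DarbouxStep s B gA gAB) (n : ℕ) (ht : t ∈ s) :
    (A - B) * (eulerHankel n f t * eulerHankel n gAB t) =
      eulerHankel n gA t * eulerD (eulerHankel n gB) t -
        eulerHankel n gB t * eulerD (eulerHankel n gA) t +
        (A - B) * (eulerHankel n gA t * eulerHankel n gB t) := by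
  simp only [eulerHankel_natCast _ _ t, hAB.iterate_eulerD ht,
    hA.iterate_eulerD ht, hB.iterate_eulerD ht]
  exact hankel_mul_hankel_christoffel_christoffel (hA.inv_ne_zero ht) (hA.hasDerivAt ht)
    (hA.hasDerivAt_hankel_christoffel ht n) (hB.hasDerivAt_hankel_christoffel ht n)

theorem eulerHankel_ofReal_mul (hs : IsOpen s) (hf : ContDiffOn ℝ ∞ f s) (n : ℕ) (ht : t ∈ s) :
    eulerHankel n (fun u => u * f u) t = (t : ℂ) ^ n * eulerHankel n f t := by
  rw [eulerHankel_natCast, eulerHankel_natCast,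
    ← det_hankel_iterate_christoffel 1 (fun k => eulerD^[k] f t)]
  have h : (hankel n fun k => eulerD^[k] (fun u => u * f u) t) =
      (t : ℂ) • hankel n fun k => (christoffel 1)^[k] (fun k => eulerD^[k] f t) 0 := by
    ext i j
    exact iterate_eulerD_ofReal_mul hs hf (fun _ _ => rfl) _ t ht
  rw [h, Matrix.det_smul, Fintype.card_fin]

theorem eulerHankel_sub_one_ofReal_mul (hs : IsOpen s) (hf : ContDiffOn ℝ ∞ f s) (n : ℕ)
    (ht : t ∈ s) :
    t * eulerHankel (n - 1) (fun u => u * f u) t = (t : ℂ) ^ n * eulerHankel (n - 1) f t := by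
  cases n with
  | zero => simp [eulerHankel]
  | succ n =>
    simp only [natCast_succ_sub_one]
    rw [eulerHankel_ofReal_mul hs hf n ht]
    ring

theorem eulerD_eulerHankel_ofReal_mul (hs : IsOpen s) (hf : ContDiffOn ℝ ∞ f s) (n : ℕ)
    (ht : t ∈ s) (ht0 : t ≠ 0) :
    eulerD (eulerHankel n fun u => u * f u) t =
      (t : ℂ) ^ n * (n * eulerHankel n f t + eulerD (eulerHankel n f) t) := by
  rw [eulerD_eqOn hs (fun u hu => eulerHankel_ofReal_mul hs hf n hu) ht, eulerD]
  change (t : ℂ) * deriv ((fun u : ℝ => (u : ℂ) ^ n) * eulerHankel n f) t = _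
  have h1 : HasDerivAt (fun u : ℝ => (u : ℂ) ^ n) (n * (t : ℂ) ^ (n - 1)) t :=
    (hasDerivAt_pow n (t : ℂ)).comp_ofReal
  rw [(h1.mul (hasDerivAt_eulerHankel hs hf n ht ht0)).deriv]
  have h2 : (t : ℂ) ≠ 0 := Complex.ofReal_ne_zero.mpr ht0
  cases n with
  | zero => simp; field_simp
  | succ n =>
    rw [Nat.add_sub_cancel, pow_succ]
    field_simp

end EulerHankel

section Seed

open scoped ContDiff

variable {a b c : ℂ} (c₁ c₂ : ℂ) {t : ℝ}

theorem contDiffOn_phiVI (h : Generic a b c) (k l m : ℤ) :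
    ContDiffOn ℝ ∞ (phiVI a b c c₁ c₂ k l m) (Set.Ioo 0 1) := by
  rw [contDiffOn_infty]
  intro n
  induction n generalizing k l m with
  | zero =>
    exact contDiffOn_zero.mpr fun t ht =>
      (hasDerivAt_phiVI c₁ c₂ h k l m ht).continuousAt.continuousWithinAt
  | succ n ih =>
    rw [Nat.cast_succ, contDiffOn_succ_iff_deriv_of_isOpen isOpen_Ioo]
    refine ⟨fun t ht =>
      (hasDerivAt_phiVI c₁ c₂ h k l m ht).differentiableAt.differentiableWithinAt, by simp, ?_⟩
    exact (ih (k + 1) (l + 1) (m + 1)).congr fun t ht => (hasDerivAt_phiVI c₁ c₂ h k l m ht).deriv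

theorem darbouxStep_left (h : Generic a b c) (k l m : ℤ) :
    DarbouxStep (Set.Ioo 0 1) (a + k + 1) (phiVI a b c c₁ c₂ k l m)
      (phiVI a b c c₁ c₂ (k + 1) l m) where
  isOpen := isOpen_Ioo
  ne_zero _ ht := ht.1.ne'
  contDiffOn := contDiffOn_phiVI c₁ c₂ h k l m
  contDiffOn_image := contDiffOn_phiVI c₁ c₂ h _ _ _
  eq _ ht := phiVI_left c₁ c₂ h k l m ht

theorem darbouxStep_right (h : Generic a b c) (k l m : ℤ) :
    DarbouxStep (Set.Ioo 0 1) (b + l + 2) (phiVI a b c c₁ c₂ k l m)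
      (phiVI a b c c₁ c₂ k (l + 1) m) where
  isOpen := isOpen_Ioo
  ne_zero _ ht := ht.1.ne'
  contDiffOn := contDiffOn_phiVI c₁ c₂ h k l m
  contDiffOn_image := contDiffOn_phiVI c₁ c₂ h _ _ _
  eq _ ht := phiVI_right c₁ c₂ h k l m ht

theorem darbouxStep_denominator (h : Generic a b c) (k l m : ℤ) :
    DarbouxStep (Set.Ioo 0 1) (c + m) (phiVI a b c c₁ c₂ k l m)
      (phiVI a b c c₁ c₂ k l (m - 1)) where
  isOpen := isOpen_Ioo
  ne_zero _ ht := ht.1.ne'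
  contDiffOn := contDiffOn_phiVI c₁ c₂ h k l m
  contDiffOn_image := contDiffOn_phiVI c₁ c₂ h _ _ _
  eq _ ht := phiVI_denominator c₁ c₂ h k l m ht

theorem darbouxStep_euler (h : Generic a b c) (k l m : ℤ) :
    DarbouxStep (Set.Ioo 0 1) 0 (phiVI a b c c₁ c₂ k l m)
      (fun u => u * phiVI a b c c₁ c₂ (k + 1) (l + 1) (m + 1) u) where
  isOpen := isOpen_Ioo
  ne_zero _ ht := ht.1.ne'
  contDiffOn := contDiffOn_phiVI c₁ c₂ h k l m
  contDiffOn_image := Complex.ofRealCLM.contDiff.contDiffOn.mul (contDiffOn_phiVI c₁ c₂ h _ _ _)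
  eq _ ht := by rw [eulerD_phiVI c₁ c₂ h k l m ht, zero_mul, add_zero]

end Seed

section Hamiltonian

variable {K : Type*} [Field K]

theorem hamiltonian_fst {t f X y r n a b c L₁ L₂ L₃ L₅ N₂ e : K}
    (h₃ : L₃ - L₂ = t * X) (h₅ : L₅ - L₂ = y) (h₅₁ : L₅ - L₁ = f * y) (h₃₁ : L₃ - L₁ = f * X - n)
    {s : K} (hr : N₂ - L₃ = r - b - 1) (hs : N₂ - L₅ = s - c) (he : e = f * L₅ + s - a * f)
    (he' : e = f * (L₃ + n) + t * r) :
    (t - 1) * (f * (L₂ - L₁ - N₂) + e) =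
      2 * (X - y) * (f - t) * (f - 1) * f - (-b - 1) * (f - 1) * f - (c - a) * (f - t) * f -
        (b - c + 1 + n) * (f - t) * (f - 1) := by
  obtain rfl : L₃ = L₂ + t * X := by linear_combination h₃
  obtain rfl : L₅ = L₂ + y := by linear_combination h₅
  obtain rfl : L₁ = L₂ + y - f * y := by linear_combination -h₅₁
  obtain rfl : n = (f - t) * X - (f - 1) * y := by linear_combination h₃₁
  obtain rfl : N₂ = L₂ + t * X + r - b - 1 := by linear_combination hr
  obtain rfl : s = t * X + r - b - 1 - y + c := by linear_combination -hs
  subst he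
  linear_combination (f - 1) * he'

theorem hamiltonian_snd {t f X y r n a b c L₁ L₂ L₃ L₅ N₂ e : K}
    (h₃ : L₃ - L₂ = t * X) (h₅ : L₅ - L₂ = y) (h₅₁ : L₅ - L₁ = f * y) (h₃₁ : L₃ - L₁ = f * X - n)
    {s : K} (hr : N₂ - L₃ = r - b - 1) (hs : N₂ - L₅ = s - c) (he : e = f * L₅ + s - a * f)
    (he' : e = f * (L₃ + n) + t * r) :
    (t - 1) * ((X - y) * (L₁ + N₂ - L₅ - L₂ + a) - (L₃ - L₅ + n + a) * X) =
      -((f - t) * (f - 1) + (f - t) * f + (f - 1) * f) * (X - y) ^ 2 +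
        ((-b - 1) * (f - 1 + f) + (c - a) * (f - t + f) +
          (b - c + 1 + n) * (f - t + (f - 1))) * (X - y) - -n * (a + n + -n) := by
  obtain rfl : L₃ = L₂ + t * X := by linear_combination h₃
  obtain rfl : L₅ = L₂ + y := by linear_combination h₅
  obtain rfl : L₁ = L₂ + y - f * y := by linear_combination -h₅₁
  obtain rfl : n = (f - t) * X - (f - 1) * y := by linear_combination h₃₁
  obtain rfl : N₂ = L₂ + t * X + r - b - 1 := by linear_combination hr
  obtain rfl : s = t * X + r - b - 1 - y + c := by linear_combination -hs
  subst he
  linear_combination -(X - y) * he'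

theorem hamiltonian_of_bilinear {t n a b c v₁ v₂ v₃ v₅ v₇ V₁ V₂ V₃ V₅ w₃ w₅ w₇
    D₁ D₂ D₃ D₅ E₁ E₂ G₇ : K} (ht : t ≠ 0) (h₁ : v₁ ≠ 0) (h₂ : v₂ ≠ 0) (h₃ : v₃ ≠ 0)
    (h₅ : v₅ ≠ 0) (hV₂ : V₂ ≠ 0)
    (r₁₅₃ : a * (v₁ * w₇) = v₅ * w₃ - t * (w₅ * v₃))
    (r₂₃ : D₃ * v₂ - v₃ * D₂ = V₂ * w₃) (r₂₅ : D₅ * v₂ - v₅ * D₂ = V₂ * w₅)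
    (r₁₅ : D₅ * v₁ - v₅ * D₁ = V₁ * w₅)
    (r₁₃ : t * ((n * v₃ + D₃) * v₁ - v₃ * D₁) = V₁ * w₃)
    (q₂₃ : E₂ * v₃ - V₂ * D₃ = V₃ * v₂ - (b + 1) * (V₂ * v₃))
    (q₂₅ : E₂ * v₅ - V₂ * D₅ = V₅ * v₂ - c * (V₂ * v₅))
    (q₁₅ : E₁ * v₅ - V₁ * D₅ = V₅ * v₁ - a * (V₁ * v₅))
    (q₁₃ : E₁ * v₃ - V₁ * (n * v₃ + D₃) = t * (V₃ * v₁))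
    (q₃₇ : D₃ * w₇ - v₃ * G₇ = v₇ * w₃ - (a + 1) * (v₃ * w₇))
    (p₁ : a * (v₁ * v₇) = v₅ * (n * v₃ + D₃) - v₃ * D₅ + a * (v₅ * v₃))
    {f₀ f₂ f₃ f₄ : K} (hf₀ : f₀ = f₄ - t) (hf₃ : f₃ = f₄ - 1)
    (hf₄ : f₄ = v₂ * V₁ / (v₁ * V₂))
    (hf₂ : f₂ = a * t⁻¹ * (v₁ * V₂ * w₇) / (v₃ * v₅ * v₂)) :
    (t - 1) * ((D₂ * V₁ + v₂ * E₁) / (v₁ * V₂) - f₄ * (D₁ / v₁ + E₂ / V₂)) =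
      2 * f₂ * f₀ * f₃ * f₄ - (-b - 1) * f₃ * f₄ - (c - a) * f₀ * f₄ -
        (b - c + 1 + n) * f₀ * f₃ ∧
    (t - 1) * (a * t⁻¹ * (v₁ * V₂ * G₇) / (v₃ * v₅ * v₂) +
        f₂ * (D₁ / v₁ + E₂ / V₂ - D₃ / v₃ - D₅ / v₅ - D₂ / v₂ - 1)) =
      -(f₀ * f₃ + f₀ * f₄ + f₃ * f₄) * f₂ ^ 2 +
        ((-b - 1) * (f₃ + f₄) + (c - a) * (f₀ + f₄) + (b - c + 1 + n) * (f₀ + f₃)) * f₂ -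
        -n * (a + n + -n) := by
  have e₃ : D₃ / v₃ - D₂ / v₂ = t * (V₂ * w₃ / (t * v₂ * v₃)) := by
    field_simp
    linear_combination r₂₃
  have e₅ : D₅ / v₅ - D₂ / v₂ = V₂ * w₅ / (v₂ * v₅) := by
    field_simp
    linear_combination r₂₅
  have e₅₁ : D₅ / v₅ - D₁ / v₁ = f₄ * (V₂ * w₅ / (v₂ * v₅)) := by
    rw [hf₄]
    field_simp
    linear_combination r₁₅
  have e₃₁ : D₃ / v₃ - D₁ / v₁ = f₄ * (V₂ * w₃ / (t * v₂ * v₃)) - n := by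
    rw [hf₄]
    field_simp
    linear_combination r₁₃
  have er : E₂ / V₂ - D₃ / v₃ = V₃ * v₂ / (V₂ * v₃) - b - 1 := by
    field_simp
    linear_combination q₂₃
  have es : E₂ / V₂ - D₅ / v₅ = V₅ * v₂ / (V₂ * v₅) - c := by
    field_simp
    linear_combination q₂₅
  have ee : E₁ * v₂ / (v₁ * V₂) = f₄ * (D₅ / v₅) + V₅ * v₂ / (V₂ * v₅) - a * f₄ := by
    rw [hf₄]
    field_simp
    linear_combination q₁₅
  have ee' : E₁ * v₂ / (v₁ * V₂) = f₄ * (D₃ / v₃ + n) + t * (V₃ * v₂ / (V₂ * v₃)) := by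
    rw [hf₄]
    field_simp
    linear_combination q₁₃
  have ef₂ : f₂ = V₂ * w₃ / (t * v₂ * v₃) - V₂ * w₅ / (v₂ * v₅) := by
    rw [hf₂]
    field_simp
    linear_combination r₁₅₃
  have ew : a * (v₁ * v₇) / (v₃ * v₅) = D₃ / v₃ - D₅ / v₅ + n + a := by
    field_simp
    linear_combination p₁
  have eg : a * t⁻¹ * (v₁ * V₂ * G₇) / (v₃ * v₅ * v₂) =
      f₂ * (D₃ / v₃ + a + 1) - a * (v₁ * v₇) / (v₃ * v₅) * (V₂ * w₃ / (t * v₂ * v₃)) := by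
    rw [hf₂]
    field_simp
    linear_combination -a * q₃₇
  constructor
  · have h := hamiltonian_fst e₃ e₅ e₅₁ e₃₁ er es ee ee'
    rw [← ef₂, ← hf₀, ← hf₃] at h
    rw [← h]
    congr 1
    have : D₂ * V₁ / (v₁ * V₂) = f₄ * (D₂ / v₂) := by
      rw [hf₄]
      field_simp
    rw [add_div, this, mul_comm v₂ E₁]
    ring
  · have h := hamiltonian_snd e₃ e₅ e₅₁ e₃₁ er es ee ee'
    rw [← ef₂, ← hf₀, ← hf₃, ← ew] at h
    rw [← h, eg]
    ring

end Hamiltonian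

section Derivative

variable {t : ℝ} {u v w x y z : ℝ → ℂ} {r u' v' w' x' y' z' : ℂ}

theorem hasDerivAt_mul_div_mul (hu : HasDerivAt u (r * u') t) (hv : HasDerivAt v (r * v') t)
    (hw : HasDerivAt w (r * w') t) (hx : HasDerivAt x (r * x') t) (hw0 : w t ≠ 0)
    (hx0 : x t ≠ 0) :
    HasDerivAt (fun s => u s * v s / (w s * x s))
      (r * ((u' * v t + u t * v') / (w t * x t) -
        u t * v t / (w t * x t) * (w' / w t + x' / x t))) t := by
  refine ((hu.mul hv).div (hw.mul hx) (mul_ne_zero hw0 hx0)).congr_deriv ?_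
  simp only [Pi.mul_apply]
  field_simp

theorem hasDerivAt_mul_mul_div_mul_mul (a : ℂ) (ht : t ≠ 0)
    (hu : HasDerivAt u ((t : ℂ)⁻¹ * u') t)
    (hv : HasDerivAt v ((t : ℂ)⁻¹ * v') t) (hw : HasDerivAt w ((t : ℂ)⁻¹ * w') t)
    (hx : HasDerivAt x ((t : ℂ)⁻¹ * x') t) (hy : HasDerivAt y ((t : ℂ)⁻¹ * y') t)
    (hz : HasDerivAt z ((t : ℂ)⁻¹ * z') t) (hu0 : u t ≠ 0) (hv0 : v t ≠ 0)
    (hx0 : x t ≠ 0) (hy0 : y t ≠ 0) (hz0 : z t ≠ 0) :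
    HasDerivAt (fun s : ℝ => a * (s : ℂ)⁻¹ * (u s * v s * w s) / (x s * y s * z s))
      ((t : ℂ)⁻¹ * (a * (t : ℂ)⁻¹ * (u t * v t * w') / (x t * y t * z t) +
        a * (t : ℂ)⁻¹ * (u t * v t * w t) / (x t * y t * z t) *
          (u' / u t + v' / v t - x' / x t - y' / y t - z' / z t - 1))) t := by
  have ht' : (t : ℂ) ≠ 0 := Complex.ofReal_ne_zero.mpr ht
  have h1 : HasDerivAt (fun s : ℝ => a * (s : ℂ)⁻¹) (a * -((t : ℂ) ^ 2)⁻¹) t :=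
    ((hasDerivAt_inv ht').comp_ofReal).const_mul a
  refine ((h1.mul ((hu.mul hv).mul hw)).div ((hx.mul hy).mul hz)
    (mul_ne_zero (mul_ne_zero hx0 hy0) hz0)).congr_deriv ?_
  simp only [Pi.mul_apply]
  field_simp
  ring

end Derivative

theorem tauVI_eq_eulerHankel (a b c c₁ c₂ : ℂ) (k l m n : ℤ) :
    tauVI a b c c₁ c₂ k l m n = eulerHankel n (phiVI a b c c₁ c₂ k l m) := rfl

end PVI

/-- determinant formula for a family of classical transcendental
solutions of the symmetric form of P_VI with parameters
`(α₀,α₁,α₂,α₃,α₄) = (-b, a+n, -n, c-a, b-c+1+n)`. -/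
theorem pVI_det_solution
    (a b c c₁ c₂ : ℂ)
    (ha : a ∉ Set.range ((↑·) : ℤ → ℂ))
    (hb : b ∉ Set.range ((↑·) : ℤ → ℂ))
    (hc : c ∉ Set.range ((↑·) : ℤ → ℂ))
    (hca : c - a ∉ Set.range ((↑·) : ℤ → ℂ))
    (hcb : c - b ∉ Set.range ((↑·) : ℤ → ℂ))
    (n : ℕ) (U : Set ℝ) (hU : IsOpen U) (hU01 : U ⊆ Set.Ioo 0 1)
    (hden1 : ∀ t ∈ U, tauVI a b c c₁ c₂ (-1) (-1) (-1) n t ≠ 0)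
    (hden2 : ∀ t ∈ U, tauVI a b c c₁ c₂ 0 (-1) 0 (n + 1) t ≠ 0)
    (hden3 : ∀ t ∈ U, tauVI a b c c₁ c₂ 0 0 0 n t ≠ 0)
    (hden4 : ∀ t ∈ U, tauVI a b c c₁ c₂ 0 (-1) (-1) n t ≠ 0)
    (hden5 : ∀ t ∈ U, tauVI a b c c₁ c₂ 0 (-1) 0 n t ≠ 0)
    (f₀ f₂ f₃ f₄ : ℝ → ℂ)
    (hf₀ : ∀ t, f₀ t = b *
      (tauVI a b c c₁ c₂ 0 0 0 n t * tauVI a b c c₁ c₂ (-1) (-2) (-1) (n + 1) t) /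
      (tauVI a b c c₁ c₂ (-1) (-1) (-1) n t * tauVI a b c c₁ c₂ 0 (-1) 0 (n + 1) t))
    (hf₃ : ∀ t, f₃ t = (c - a) *
      (tauVI a b c c₁ c₂ 0 (-1) (-1) n t * tauVI a b c c₁ c₂ (-1) (-1) 0 (n + 1) t) /
      (tauVI a b c c₁ c₂ (-1) (-1) (-1) n t * tauVI a b c c₁ c₂ 0 (-1) 0 (n + 1) t))
    (hf₄ : ∀ t, f₄ t =
      (tauVI a b c c₁ c₂ 0 (-1) 0 n t * tauVI a b c c₁ c₂ (-1) (-1) (-1) (n + 1) t) /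
      (tauVI a b c c₁ c₂ (-1) (-1) (-1) n t * tauVI a b c c₁ c₂ 0 (-1) 0 (n + 1) t))
    (hf₂ : ∀ t, f₂ t = a * (t : ℂ)⁻¹ *
      (tauVI a b c c₁ c₂ (-1) (-1) (-1) n t * tauVI a b c c₁ c₂ 0 (-1) 0 (n + 1) t *
        tauVI a b c c₁ c₂ 1 0 0 (n - 1) t) /
      (tauVI a b c c₁ c₂ 0 0 0 n t * tauVI a b c c₁ c₂ 0 (-1) (-1) n t *
        tauVI a b c c₁ c₂ 0 (-1) 0 n t)) :
    ∀ t ∈ U,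
      f₀ t = f₄ t - (t : ℂ) ∧
      f₃ t = f₄ t - 1 ∧
      (t : ℂ) * ((t : ℂ) - 1) * deriv f₄ t =
        2 * f₂ t * f₀ t * f₃ t * f₄ t - ((-b) - 1) * f₃ t * f₄ t
          - (c - a) * f₀ t * f₄ t - (b - c + 1 + n) * f₀ t * f₃ t ∧
      (t : ℂ) * ((t : ℂ) - 1) * deriv f₂ t =
        -(f₀ t * f₃ t + f₀ t * f₄ t + f₃ t * f₄ t) * (f₂ t) ^ 2
          + (((-b) - 1) * (f₃ t + f₄ t) + (c - a) * (f₀ t + f₄ t)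
              + (b - c + 1 + n) * (f₀ t + f₃ t)) * f₂ t
          - (-(n : ℂ)) * ((a + n) + (-(n : ℂ))) := by
  have hnon : ∀ z : ℂ, z ∉ Set.range ((↑·) : ℤ → ℂ) → PVI.NonInt z :=
    fun z hz n hn => hz ⟨n, hn.symm⟩
  have hg : PVI.Generic a b c := by
    refine ⟨hnon a ha, hnon b hb, hnon c hc, ?_, ?_⟩
    · simpa using (hnon _ hca).const_sub 0
    · simpa using (hnon _ hcb).const_sub 0
  simp only [PVI.tauVI_eq_eulerHankel] at *
  have S := fun k l m => PVI.contDiffOn_phiVI c₁ c₂ hg k l m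
  have s₄₁ := PVI.darbouxStep_right c₁ c₂ hg (-1) (-2) (-1)
  have s₄₂ := PVI.darbouxStep_euler c₁ c₂ hg (-1) (-2) (-1)
  have s₁₃ := PVI.darbouxStep_euler c₁ c₂ hg (-1) (-1) (-1)
  have s₆₁ := PVI.darbouxStep_denominator c₁ c₂ hg (-1) (-1) 0
  have s₆₂ := PVI.darbouxStep_left c₁ c₂ hg (-1) (-1) 0
  have s₁₅ := PVI.darbouxStep_left c₁ c₂ hg (-1) (-1) (-1)
  have s₂₃ := PVI.darbouxStep_right c₁ c₂ hg 0 (-1) 0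
  have s₂₅ := PVI.darbouxStep_denominator c₁ c₂ hg 0 (-1) 0
  have s₃₇ := PVI.darbouxStep_left c₁ c₂ hg 0 0 0
  have s₅₇ := PVI.darbouxStep_euler c₁ c₂ hg 0 (-1) (-1)
  rw [show b + ((-2 : ℤ) : ℂ) + 2 = b by push_cast; ring] at s₄₁
  rw [show c + ((0 : ℤ) : ℂ) = c by simp] at s₆₁ s₂₅
  rw [show a + ((-1 : ℤ) : ℂ) + 1 = a by push_cast; ring] at s₆₂ s₁₅
  rw [show b + ((-1 : ℤ) : ℂ) + 2 = b + 1 by push_cast; ring] at s₂₃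
  rw [show a + ((0 : ℤ) : ℂ) + 1 = a + 1 by simp] at s₃₇
  simp only [Int.reduceNeg, Int.reduceAdd, Int.reduceSub] at s₄₁ s₄₂ s₁₃ s₆₁ s₆₂
  simp only [Int.reduceNeg, Int.reduceAdd, Int.reduceSub] at s₁₅ s₂₃ s₂₅ s₃₇ s₅₇
  set p₁ := phiVI a b c c₁ c₂ (-1) (-1) (-1)
  set p₂ := phiVI a b c c₁ c₂ 0 (-1) 0
  set p₃ := phiVI a b c c₁ c₂ 0 0 0
  set p₄ := phiVI a b c c₁ c₂ (-1) (-2) (-1)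
  set p₅ := phiVI a b c c₁ c₂ 0 (-1) (-1)
  set p₆ := phiVI a b c c₁ c₂ (-1) (-1) 0
  set p₇ := phiVI a b c c₁ c₂ 1 0 0
  intro t ht
  have htI : t ∈ Set.Ioo (0 : ℝ) 1 := hU01 ht
  have ht0 : t ≠ 0 := htI.1.ne'
  have htC : (t : ℂ) ≠ 0 := Complex.ofReal_ne_zero.mpr ht0
  have htn : (t : ℂ) ^ n ≠ 0 := pow_ne_zero n htC
  have h₁ := hden1 t ht
  have hV₂ := hden2 t ht
  have h₃ := hden3 t ht
  have h₅ := hden4 t ht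
  have h₂ := hden5 t ht
  have T := fun (p : ℝ → ℂ) (hp : ContDiffOn ℝ (⊤ : ℕ∞) p (Set.Ioo 0 1)) (m : ℕ) =>
    PVI.eulerHankel_ofReal_mul isOpen_Ioo hp m htI
  have T' := fun (p : ℝ → ℂ) (hp : ContDiffOn ℝ (⊤ : ℕ∞) p (Set.Ioo 0 1)) (m : ℕ) =>
    PVI.eulerHankel_sub_one_ofReal_mul isOpen_Ioo hp m htI
  have hp₂ : ContDiffOn ℝ (⊤ : ℕ∞) p₂ (Set.Ioo 0 1) := S _ _ _
  have hp₃ : ContDiffOn ℝ (⊤ : ℕ∞) p₃ (Set.Ioo 0 1) := S _ _ _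
  have hp₇ : ContDiffOn ℝ (⊤ : ℕ∞) p₇ (Set.Ioo 0 1) := S _ _ _
  have T₂ := T p₂ hp₂ (n + 1)
  rw [Nat.cast_add_one] at T₂
  have T₃ := T p₃ hp₃ (n + 1)
  rw [Nat.cast_add_one] at T₃
  have TD₃ := PVI.eulerD_eulerHankel_ofReal_mul isOpen_Ioo hp₃ n htI ht0
  have R₁ := s₄₁.mul_sub_mul s₄₂ s₁₃ (n + 1) htI
  rw [PVI.natCast_succ_sub_one, Nat.cast_add_one, T₂, T p₂ hp₂ n, T p₃ hp₃ n] at R₁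
  have R₂ := s₆₁.mul_sub_mul s₆₂ s₁₅ (n + 1) htI
  rw [PVI.natCast_succ_sub_one, Nat.cast_add_one] at R₂
  have hf₀' : f₀ t = f₄ t - t := by
    rw [hf₀, hf₄]
    field_simp
    apply mul_left_cancel₀ htn
    linear_combination -R₁
  have hf₃' : f₃ t = f₄ t - 1 := by
    rw [hf₃, hf₄]
    field_simp
    linear_combination -R₂
  refine ⟨hf₀', hf₃', ?_⟩
  have q₂₃ := s₂₃.eulerD_mul_sub (n + 1) htI
  have q₂₅ := s₂₅.eulerD_mul_sub (n + 1) htI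
  have q₁₅ := s₁₅.eulerD_mul_sub (n + 1) htI
  have q₁₃ := s₁₃.eulerD_mul_sub (n + 1) htI
  rw [PVI.natCast_succ_sub_one, Nat.cast_add_one] at q₂₃ q₂₅ q₁₅ q₁₃
  rw [T₃, T p₃ hp₃ n, TD₃] at q₁₃
  have r₁₃ := s₁₃.eulerD_image_mul_sub n htI
  rw [T p₃ hp₃ n, TD₃] at r₁₃
  have r₁₅₃ := s₁₅.mul_sub_mul s₁₃ s₅₇ n htI
  rw [T p₃ hp₃ n] at r₁₅₃
  have p₁₅₃ := s₁₅.mul_eulerD_sub s₁₃ s₅₇ n htI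
  rw [T p₃ hp₃ n, T p₇ hp₇ n, TD₃] at p₁₅₃
  have key := PVI.hamiltonian_of_bilinear (n := (n : ℂ)) (c := c) htC h₁ h₂ h₃ h₅ hV₂
    (mul_left_cancel₀ htn (by
      linear_combination -t * r₁₅₃ - a * PVI.eulerHankel n p₁ t * T' p₇ hp₇ n +
        PVI.eulerHankel n p₅ t * T' p₃ hp₃ n))
    (s₂₃.eulerD_image_mul_sub n htI) (s₂₅.eulerD_image_mul_sub n htI)
    (s₁₅.eulerD_image_mul_sub n htI)
    (mul_left_cancel₀ htn (by
      linear_combination t * r₁₃ + PVI.eulerHankel (n + 1) p₁ t * T' p₃ hp₃ n))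
    q₂₃ q₂₅ q₁₅ (mul_left_cancel₀ htn (by linear_combination q₁₃))
    (s₃₇.eulerD_mul_sub n htI) (mul_left_cancel₀ htn (by linear_combination p₁₅₃))
    hf₀' hf₃' (hf₄ t) (hf₂ t)
  have H := fun k l m (i : ℤ) => PVI.hasDerivAt_eulerHankel isOpen_Ioo (S k l m) i htI ht0
  have d₄ := PVI.hasDerivAt_mul_div_mul (H 0 (-1) 0 n) (H (-1) (-1) (-1) (n + 1))
    (H (-1) (-1) (-1) n) (H 0 (-1) 0 (n + 1)) h₁ hV₂
  rw [← funext hf₄] at d₄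
  have d₂ := PVI.hasDerivAt_mul_mul_div_mul_mul a ht0 (H (-1) (-1) (-1) n)
    (H 0 (-1) 0 (n + 1)) (H 1 0 0 (n - 1)) (H 0 0 0 n) (H 0 (-1) (-1) n) (H 0 (-1) 0 n)
    h₁ hV₂ h₃ h₅ h₂
  rw [← funext hf₂] at d₂
  have cancel : ∀ x : ℂ, (t : ℂ) * (t - 1) * ((t : ℂ)⁻¹ * x) = (t - 1) * x := fun x => by
    field_simp
  rw [d₄.deriv, d₂.deriv, cancel, cancel, ← key.1, ← key.2, hf₂ t, hf₄ t]
  exact ⟨rfl, rfl⟩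
end

section
/- With φ_{k,l,m} as in the context, on every open subinterval of (0,1) on which φ_{0,−1,0} does not vanish, the functions f_0 = b·φ_{−1,−2,−1}/φ_{0,−1,0}, f_3 = (c−a)·φ_{−1,−1,0}/φ_{0,−1,0}, f_4 = φ_{−1,−1,−1}/φ_{0,−1,0}, together with f_2 = 0, give a (Riccati) solution of the symmetric form of the Painlevé VI equation with parameters (α_0,α_1,α_2,α_3,α_4) = (−b, a, 0, c−a, b−c+1): the identities f_0 = f_4 − t and f_3 = f_4 − 1 hold and the two Hamilton equations of the symmetric form are satisfied. -/
/-- The `n`-th Taylor coefficient of Gauss's hypergeometric function. -/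
noncomputable def gaussCoeff (a b c : ℂ) (n : ℕ) : ℂ :=
  Polynomial.eval a (ascPochhammer ℂ n) * Polynomial.eval b (ascPochhammer ℂ n) /
    (Polynomial.eval c (ascPochhammer ℂ n) * (n.factorial : ℂ))

/-- A complex number that is not an integer. -/
def NonInt (z : ℂ) : Prop := z ∉ Set.range ((↑·) : ℤ → ℂ)

namespace NonInt

theorem add_intCast {z : ℂ} (h : NonInt z) (n : ℤ) : NonInt (z + n) := by
  rintro ⟨m, hm⟩
  exact h ⟨m - n, by push_cast; linear_combination hm⟩

theorem neg {z : ℂ} (h : NonInt z) : NonInt (-z) := by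
  rintro ⟨m, hm⟩
  exact h ⟨-m, by push_cast; linear_combination -hm⟩

theorem add_one {z : ℂ} (h : NonInt z) : NonInt (z + 1) := by
  simpa using h.add_intCast 1

theorem sub_one {z : ℂ} (h : NonInt z) : NonInt (z - 1) := by
  simpa [sub_eq_add_neg] using h.add_intCast (-1)

theorem one_sub {z : ℂ} (h : NonInt z) : NonInt (1 - z) := by
  simpa [sub_eq_add_neg, add_comm] using h.neg.add_one

theorem add_natCast_ne_zero {z : ℂ} (h : NonInt z) (n : ℕ) : z + n ≠ 0 := fun h0 =>
  h ⟨-n, by push_cast; linear_combination -h0⟩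

theorem ne_zero {z : ℂ} (h : NonInt z) : z ≠ 0 := by
  simpa using h.add_natCast_ne_zero 0

theorem ne_neg_natCast {z : ℂ} (h : NonInt z) (n : ℕ) : z ≠ -n := fun h0 =>
  h.add_natCast_ne_zero n (by rw [h0]; ring)

theorem natCast_ne_neg {z : ℂ} (h : NonInt z) (n : ℕ) : (n : ℂ) ≠ -z := fun h0 =>
  h.add_natCast_ne_zero n (by rw [h0]; ring)

theorem ascPochhammer_eval_ne_zero {z : ℂ} (h : NonInt z) (n : ℕ) :
    Polynomial.eval z (ascPochhammer ℂ n) ≠ 0 := by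
  rw [Ne, ascPochhammer_eval_eq_zero_iff]
  rintro ⟨k, -, hk⟩
  exact h.natCast_ne_neg k hk

end NonInt

theorem mul_ascPochhammer_eval_add_one (x : ℂ) (n : ℕ) :
    x * Polynomial.eval (x + 1) (ascPochhammer ℂ n) =
      Polynomial.eval x (ascPochhammer ℂ n) * (x + n) := by
  rw [← ascPochhammer_succ_eval, ascPochhammer_succ_left]
  simp

section Coefficients

variable {a b c : ℂ}

theorem gaussCoeff_succ (hc : NonInt c) (n : ℕ) :
    ((n + 1 : ℕ) : ℂ) * gaussCoeff a b c (n + 1) =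
      a * b / c * gaussCoeff (a + 1) (b + 1) (c + 1) n := by
  have h1 := hc.add_one.ascPochhammer_eval_ne_zero n
  have h2 := hc.ne_zero
  have h3 : (n.factorial : ℂ) ≠ 0 := by exact_mod_cast n.factorial_ne_zero
  have h4 : (n : ℂ) + 1 ≠ 0 := by exact_mod_cast n.succ_ne_zero
  simp only [gaussCoeff, ascPochhammer_succ_eval, ← mul_ascPochhammer_eval_add_one,
    Nat.factorial_succ]
  push_cast
  field_simp

theorem mul_gaussCoeff_add_one_right (n : ℕ) :
    b * gaussCoeff a (b + 1) c n = (n + b) * gaussCoeff a b c n := by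
  have h := mul_ascPochhammer_eval_add_one b n
  simp only [gaussCoeff]
  linear_combination (Polynomial.eval a (ascPochhammer ℂ n) /
    (Polynomial.eval c (ascPochhammer ℂ n) * (n.factorial : ℂ))) * h

theorem mul_gaussCoeff_add_one_bottom (hc : NonInt c) (n : ℕ) :
    c * gaussCoeff a b c n = (n + c) * gaussCoeff a b (c + 1) n := by
  have h := mul_ascPochhammer_eval_add_one c n
  have h1 := hc.add_one.ascPochhammer_eval_ne_zero n
  have h2 := hc.ascPochhammer_eval_ne_zero n
  have h3 : (n.factorial : ℂ) ≠ 0 := by exact_mod_cast n.factorial_ne_zero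
  simp only [gaussCoeff]
  field_simp
  linear_combination Polynomial.eval a (ascPochhammer ℂ n) *
    Polynomial.eval b (ascPochhammer ℂ n) * h

end Coefficients

section Series

variable {a b c : ℂ}

theorem summable_norm_gaussCoeff_mul_pow (ha : NonInt a) (hb : NonInt b) (hc : NonInt c)
    {r : ℝ} (hr0 : 0 ≤ r) (hr : r < 1) :
    Summable fun n : ℕ => ‖gaussCoeff a b c n‖ * r ^ n := by
  have hrad := ordinaryHypergeometricSeries_radius_eq_one (𝕂 := ℂ) ℂ a b c
    fun k => ⟨ha.natCast_ne_neg k, hb.natCast_ne_neg k, hc.natCast_ne_neg k⟩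
  lift r to NNReal using hr0
  have hlt : (r : ENNReal) < (ordinaryHypergeometricSeries ℂ a b c).radius := by
    rw [hrad]
    exact_mod_cast hr
  refine ((ordinaryHypergeometricSeries ℂ a b c).summable_norm_mul_pow hlt).congr fun n => ?_
  rw [ordinaryHypergeometricSeries, FormalMultilinearSeries.ofScalars_norm]
  simp only [ordinaryHypergeometricCoefficient, gaussCoeff]
  congr 2
  rw [div_eq_mul_inv, mul_inv]
  ring

theorem hasSum_gaussF (ha : NonInt a) (hb : NonInt b) (hc : NonInt c)
    {t : ℝ} (ht : t ∈ Set.Ioo (0 : ℝ) 1) :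
    HasSum (fun n : ℕ => gaussCoeff a b c n * (t : ℂ) ^ n) (gaussF a b c t) := by
  refine Summable.hasSum (.of_norm ?_)
  simpa [abs_of_pos ht.1] using summable_norm_gaussCoeff_mul_pow ha hb hc ht.1.le ht.2

theorem hasDerivAt_gaussF (ha : NonInt a) (hb : NonInt b) (hc : NonInt c)
    {t : ℝ} (ht : t ∈ Set.Ioo (0 : ℝ) 1) :
    HasDerivAt (gaussF a b c) (a * b / c * gaussF (a + 1) (b + 1) (c + 1) t) t := by
  obtain ⟨r, htr, hr⟩ := exists_between ht.2
  have hr0 : 0 ≤ r := ht.1.le.trans htr.le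
  have hu := summable_norm_gaussCoeff_mul_pow ha hb hc hr0 hr
  have hdiff (n : ℕ) : DifferentiableOn ℂ (fun z : ℂ => gaussCoeff a b c n * z ^ n)
      (Metric.ball 0 r) := by fun_prop
  have hle (n : ℕ) (z : ℂ) (hz : z ∈ Metric.ball (0 : ℂ) r) :
      ‖gaussCoeff a b c n * z ^ n‖ ≤ ‖gaussCoeff a b c n‖ * r ^ n := by
    rw [norm_mul, norm_pow]
    gcongr
    exact (mem_ball_zero_iff.1 hz).le
  have hmem : (t : ℂ) ∈ Metric.ball (0 : ℂ) r := by
    simpa [abs_of_pos ht.1] using htr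
  have hsum := Complex.hasSum_deriv_of_summable_norm hu hdiff Metric.isOpen_ball hle hmem
  have hder := ((Complex.differentiableOn_tsum_of_summable_norm hu hdiff Metric.isOpen_ball
    hle).differentiableAt (Metric.isOpen_ball.mem_nhds hmem)).hasDerivAt
  have hval : HasSum (fun n : ℕ => deriv (fun z : ℂ => gaussCoeff a b c n * z ^ n) t)
      (a * b / c * gaussF (a + 1) (b + 1) (c + 1) t) := by
    rw [← hasSum_nat_add_iff' 1]
    have h := (hasSum_gaussF ha.add_one hb.add_one hc.add_one ht).mul_left (a * b / c)
    simp only [← mul_assoc, ← gaussCoeff_succ hc] at h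
    simpa [mul_assoc, mul_left_comm] using h
  rw [hsum.unique hval] at hder
  exact hder.comp_ofReal

/-- The Euler operator `t d/dt` multiplies the `n`-th Taylor coefficient by `n`. -/
theorem hasSum_natCast_mul_gaussCoeff (ha : NonInt a) (hb : NonInt b) (hc : NonInt c)
    {t : ℝ} (ht : t ∈ Set.Ioo (0 : ℝ) 1) :
    HasSum (fun n : ℕ => n * gaussCoeff a b c n * (t : ℂ) ^ n)
      (t * (a * b / c * gaussF (a + 1) (b + 1) (c + 1) t)) := by
  rw [← hasSum_nat_add_iff' 1]
  have h := ((hasSum_gaussF ha.add_one hb.add_one hc.add_one ht).mul_left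
    (a * b / c)).mul_left (t : ℂ)
  simp only [Finset.range_one, Finset.sum_singleton, Nat.cast_zero, zero_mul, sub_zero]
  refine h.congr_fun fun n => ?_
  rw [gaussCoeff_succ hc, pow_succ]
  ring

theorem gaussF_comm (a b c : ℂ) (t : ℝ) : gaussF a b c t = gaussF b a c t := by
  simp only [gaussF, mul_comm]

theorem mul_gaussF_add_one_right (ha : NonInt a) (hb : NonInt b) (hc : NonInt c)
    {t : ℝ} (ht : t ∈ Set.Ioo (0 : ℝ) 1) :
    b * gaussF a (b + 1) c t =
      t * (a * b / c * gaussF (a + 1) (b + 1) (c + 1) t) + b * gaussF a b c t := by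
  refine ((hasSum_gaussF ha hb.add_one hc ht).mul_left b).unique
    (((hasSum_natCast_mul_gaussCoeff ha hb hc ht).add
      ((hasSum_gaussF ha hb hc ht).mul_left b)).congr_fun fun n => ?_)
  linear_combination (t : ℂ) ^ n * mul_gaussCoeff_add_one_right (a := a) (b := b) (c := c) n

theorem mul_gaussF_add_one_left (ha : NonInt a) (hb : NonInt b) (hc : NonInt c)
    {t : ℝ} (ht : t ∈ Set.Ioo (0 : ℝ) 1) :
    a * gaussF (a + 1) b c t =
      t * (a * b / c * gaussF (a + 1) (b + 1) (c + 1) t) + a * gaussF a b c t := by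
  rw [gaussF_comm (a + 1) b, mul_gaussF_add_one_right hb ha hc ht, gaussF_comm b a,
    gaussF_comm (b + 1), mul_comm b a]

theorem mul_gaussF_bottom (ha : NonInt a) (hb : NonInt b) (hc : NonInt c)
    {t : ℝ} (ht : t ∈ Set.Ioo (0 : ℝ) 1) :
    c * gaussF a b c t =
      t * (a * b / (c + 1) * gaussF (a + 1) (b + 1) (c + 1 + 1) t) +
        c * gaussF a b (c + 1) t := by
  refine ((hasSum_gaussF ha hb hc ht).mul_left c).unique
    (((hasSum_natCast_mul_gaussCoeff ha hb hc.add_one ht).add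
      ((hasSum_gaussF ha hb hc.add_one ht).mul_left c)).congr_fun fun n => ?_)
  linear_combination (t : ℂ) ^ n * mul_gaussCoeff_add_one_bottom (a := a) (b := b) hc n

theorem mul_gaussF_top_bottom (ha : NonInt a) (hb : NonInt b) (hc : NonInt c)
    {t : ℝ} (ht : t ∈ Set.Ioo (0 : ℝ) 1) :
    (c - a) * gaussF a b (c + 1) t + a * gaussF (a + 1) b (c + 1) t = c * gaussF a b c t := by
  linear_combination mul_gaussF_add_one_left ha hb hc.add_one ht - mul_gaussF_bottom ha hb hc ht

/-- Gauss's hypergeometric differential equation, with the derivatives written as contiguous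
hypergeometric functions. -/
theorem gaussF_ode (ha : NonInt a) (hb : NonInt b) (hc : NonInt c)
    {t : ℝ} (ht : t ∈ Set.Ioo (0 : ℝ) 1) :
    t * (1 - t) * (a * b / c * ((a + 1) * (b + 1) / (c + 1) *
        gaussF (a + 1 + 1) (b + 1 + 1) (c + 1 + 1) t)) +
      (c - (a + b + 1) * t) * (a * b / c * gaussF (a + 1) (b + 1) (c + 1) t) =
      a * b * gaussF a b c t := by
  have h1 := mul_gaussF_bottom ha.add_one hb.add_one hc ht
  have h2 := mul_gaussF_add_one_left ha hb.add_one hc ht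
  have h3 := mul_gaussF_add_one_right ha.add_one hb.add_one hc.add_one ht
  have h4 := mul_gaussF_add_one_right ha hb hc ht
  have hcancel : a * b / c * c = a * b := div_mul_cancel₀ _ hc.ne_zero
  linear_combination -(a * b / c) * h1 + b * h2 + (t * a * b / c) * h3 + a * h4 +
    gaussF (a + 1) (b + 1) c t * hcancel

end Series

section SecondSolution

variable {a b s : ℂ}

theorem hasDerivAt_ofReal_cpow (s : ℂ) {t : ℝ} (ht : 0 < t) :
    HasDerivAt (fun x : ℝ => (x : ℂ) ^ s) (s * (t : ℂ) ^ (s - 1)) t := by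
  have h := ((hasDerivAt_id (t : ℂ)).cpow_const (c := s) (Or.inl (by simpa using ht))).comp_ofReal
  simpa using h

theorem ofReal_cpow_eq_mul_cpow_sub_one (s : ℂ) {t : ℝ} (ht : 0 < t) :
    (t : ℂ) ^ s = t * (t : ℂ) ^ (s - 1) := by
  have h0 : (t : ℂ) ≠ 0 := by exact_mod_cast ht.ne'
  rw [Complex.cpow_sub _ _ h0, Complex.cpow_one, mul_div_cancel₀ _ h0]

theorem hasDerivAt_cpow_mul_gaussF (ha : NonInt a) (hb : NonInt b) (hs : NonInt s)
    {t : ℝ} (ht : t ∈ Set.Ioo (0 : ℝ) 1) :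
    HasDerivAt (fun x : ℝ => (x : ℂ) ^ s * gaussF a b (s + 1) x)
      (s * ((t : ℂ) ^ (s - 1) * gaussF a b s t)) t := by
  refine ((hasDerivAt_ofReal_cpow s ht.1).mul
    (hasDerivAt_gaussF ha hb hs.add_one ht)).congr_deriv ?_
  rw [ofReal_cpow_eq_mul_cpow_sub_one s ht.1]
  linear_combination -(t : ℂ) ^ (s - 1) * mul_gaussF_bottom ha hb hs ht

theorem hasDerivAt_cpow_sub_one_mul_gaussF (ha : NonInt a) (hb : NonInt b) (hs : NonInt s)
    {t : ℝ} (ht : t ∈ Set.Ioo (0 : ℝ) 1) :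
    HasDerivAt (fun x : ℝ => s * ((x : ℂ) ^ (s - 1) * gaussF a b s x))
      (s * (s - 1) * (t : ℂ) ^ (s - 1 - 1) * gaussF a b s t +
        (t : ℂ) ^ (s - 1) * (a * b * gaussF (a + 1) (b + 1) (s + 1) t)) t := by
  refine (((hasDerivAt_ofReal_cpow (s - 1) ht.1).mul
    (hasDerivAt_gaussF ha hb hs ht)).const_mul s).congr_deriv ?_
  have hs0 := hs.ne_zero
  field_simp

/-- The function `t ^ s * F(a, b, s + 1; t)` solves the hypergeometric equation with parameters
`a - s, b - s, 1 - s`. -/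
theorem cpow_mul_gaussF_ode (ha : NonInt a) (hb : NonInt b) (hs : NonInt s)
    {t : ℝ} (ht : t ∈ Set.Ioo (0 : ℝ) 1) :
    t * (1 - t) * (s * (s - 1) * (t : ℂ) ^ (s - 1 - 1) * gaussF a b s t +
        (t : ℂ) ^ (s - 1) * (a * b * gaussF (a + 1) (b + 1) (s + 1) t)) +
      (1 - s - (a - s + (b - s) + 1) * t) * (s * ((t : ℂ) ^ (s - 1) * gaussF a b s t)) =
      (a - s) * (b - s) * ((t : ℂ) ^ s * gaussF a b (s + 1) t) := by
  have h1 := mul_gaussF_bottom ha hb hs ht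
  have h2 := mul_gaussF_bottom ha.add_one hb.add_one hs.add_one ht
  have h3 := gaussF_ode ha hb hs.add_one ht
  have hcancel : a * b / (s + 1) * (s + 1) = a * b := div_mul_cancel₀ _ hs.add_one.ne_zero
  rw [ofReal_cpow_eq_mul_cpow_sub_one s ht.1, ofReal_cpow_eq_mul_cpow_sub_one (s - 1) ht.1]
  set P := (t : ℂ) ^ (s - 1 - 1)
  set D₁ := a * b / (s + 1) * gaussF (a + 1) (b + 1) (s + 1 + 1) t
  have h4 : a * b * gaussF (a + 1) (b + 1) (s + 1) t =
      t * (a * b / (s + 1) * ((a + 1) * (b + 1) / (s + 1 + 1) *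
        gaussF (a + 1 + 1) (b + 1 + 1) (s + 1 + 1 + 1) t)) + (s + 1) * D₁ := by
    linear_combination (a * b / (s + 1)) * h2 - gaussF (a + 1) (b + 1) (s + 1) t * hcancel
  rw [h4]
  linear_combination (t * (1 - t) * (s - 1) * P +
    (1 - s - (a - s + (b - s) + 1) * t) * t * P) * h1 + t ^ 2 * P * h3

theorem cpow_mul_gaussF_add_one_right (ha : NonInt a) (hb : NonInt b) (hs : NonInt s)
    {t : ℝ} (ht : t ∈ Set.Ioo (0 : ℝ) 1) :
    b * ((t : ℂ) ^ s * gaussF a (b + 1) (s + 1) t) =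
      t * (s * ((t : ℂ) ^ (s - 1) * gaussF a b s t)) +
        (b - s) * ((t : ℂ) ^ s * gaussF a b (s + 1) t) := by
  rw [ofReal_cpow_eq_mul_cpow_sub_one s ht.1]
  linear_combination t * (t : ℂ) ^ (s - 1) * (mul_gaussF_add_one_right ha hb hs.add_one ht -
    mul_gaussF_bottom ha hb hs ht)

theorem cpow_mul_gaussF_add_one_left (ha : NonInt a) (hb : NonInt b) (hs : NonInt s)
    {t : ℝ} (ht : t ∈ Set.Ioo (0 : ℝ) 1) :
    b * ((t : ℂ) ^ s * gaussF (a + 1) (b + 1) (s + 1) t) =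
      s * ((t : ℂ) ^ (s - 1) * gaussF (a + 1) b s t) -
        s * ((t : ℂ) ^ (s - 1) * gaussF a b s t) := by
  rw [ofReal_cpow_eq_mul_cpow_sub_one s ht.1]
  have h := mul_gaussF_add_one_left ha hb hs ht
  have hcancel : a * b / s * s = a * b := div_mul_cancel₀ _ hs.ne_zero
  refine mul_left_cancel₀ ha.ne_zero ?_
  linear_combination -(t : ℂ) ^ (s - 1) * s * h -
    t * (t : ℂ) ^ (s - 1) * gaussF (a + 1) (b + 1) (s + 1) t * hcancel

end SecondSolution

section Phi

variable {a b c c₁ c₂ : ℂ}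

theorem phiVI_eq {p q r x y s : ℂ} {k l m : ℤ} (hp : a + k + 1 = p) (hq : b + l + 2 = q)
    (hr : c + m + 1 = r) (hx : a - c + 1 + k - m = x) (hy : b - c + 2 + l - m = y)
    (hs : 1 - c - m = s) (t : ℝ) :
    phiVI a b c c₁ c₂ k l m t =
      c₁ * (Complex.Gamma p * Complex.Gamma q / Complex.Gamma r) * gaussF p q r t +
      c₂ * (Complex.Gamma x * Complex.Gamma y / Complex.Gamma s) *
        ((t : ℂ) ^ (s - 1) * gaussF x y s t) := by
  have h1 : 1 - c - ((m : ℂ) + 1) = s - 1 := by linear_combination hs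
  have h2 : a - c + 1 + ((k : ℂ) + 1) - ((m : ℂ) + 1) = x := by linear_combination hx
  have h3 : b - c + 1 + ((l : ℂ) + 2) - ((m : ℂ) + 1) = y := by linear_combination hy
  have h4 : 2 - c - ((m : ℂ) + 1) = s := by linear_combination hs
  rw [phiVI, h1, h2, h3, h4, hp, hq, hr, hx, hy, hs]

theorem NonInt.Gamma_ne_zero {z : ℂ} (h : NonInt z) : Complex.Gamma z ≠ 0 :=
  Complex.Gamma_ne_zero h.ne_neg_natCast

/-- Normalising constant of the first solution in `phiVI`. -/
noncomputable def gammaFst (a b c c₁ : ℂ) : ℂ :=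
  c₁ * (Complex.Gamma a * Complex.Gamma b / Complex.Gamma c)

/-- Normalising constant of the second solution in `phiVI`. -/
noncomputable def gammaSnd (a b c c₂ : ℂ) : ℂ :=
  c₂ * (Complex.Gamma (a - c + 1) * Complex.Gamma (b - c + 1) / Complex.Gamma (1 - c + 1))

theorem phiVI_neg_one_neg_two_neg_one (a b c c₁ c₂ : ℂ) (t : ℝ) :
    phiVI a b c c₁ c₂ (-1) (-2) (-1) t = gammaFst a b c c₁ * gaussF a b c t +
      gammaSnd a b c c₂ *
        ((t : ℂ) ^ (1 - c) * gaussF (a - c + 1) (b - c + 1) (1 - c + 1) t) := by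
  rw [phiVI_eq (p := a) (q := b) (r := c) (x := a - c + 1) (y := b - c + 1) (s := 1 - c + 1),
    add_sub_cancel_right, gammaFst, gammaSnd] <;> (push_cast; ring)

theorem phiVI_zero_neg_one_zero (ha : NonInt a) (hb : NonInt b) (hc : NonInt c) (t : ℝ) :
    phiVI a b c c₁ c₂ 0 (-1) 0 t =
      gammaFst a b c c₁ * (a * b / c * gaussF (a + 1) (b + 1) (c + 1) t) +
      gammaSnd a b c c₂ * ((1 - c) *
        ((t : ℂ) ^ (1 - c - 1) * gaussF (a - c + 1) (b - c + 1) (1 - c) t)) := by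
  rw [phiVI_eq (p := a + 1) (q := b + 1) (r := c + 1) (x := a - c + 1) (y := b - c + 1)
    (s := 1 - c), gammaFst, gammaSnd, Complex.Gamma_add_one a ha.ne_zero,
    Complex.Gamma_add_one b hb.ne_zero, Complex.Gamma_add_one c hc.ne_zero,
    Complex.Gamma_add_one (1 - c) hc.one_sub.ne_zero]
  · have h1 := hc.ne_zero
    have h2 := hc.one_sub.ne_zero
    have h3 := hc.Gamma_ne_zero
    have h4 := hc.one_sub.Gamma_ne_zero
    field_simp
  all_goals push_cast; ring

theorem phiVI_neg_one_neg_one_neg_one (hb : NonInt b) (hbc : NonInt (b - c + 1)) (t : ℝ) :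
    phiVI a b c c₁ c₂ (-1) (-1) (-1) t =
      gammaFst a b c c₁ * (b * gaussF a (b + 1) c t) +
      gammaSnd a b c c₂ * ((b - c + 1) *
        ((t : ℂ) ^ (1 - c) * gaussF (a - c + 1) (b - c + 1 + 1) (1 - c + 1) t)) := by
  rw [phiVI_eq (p := a) (q := b + 1) (r := c) (x := a - c + 1) (y := b - c + 1 + 1)
    (s := 1 - c + 1), gammaFst, gammaSnd, Complex.Gamma_add_one b hb.ne_zero,
    Complex.Gamma_add_one (b - c + 1) hbc.ne_zero, add_sub_cancel_right]
  · ring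
  all_goals push_cast; ring

theorem sub_mul_phiVI_neg_one_neg_one_zero (hb : NonInt b) (hc : NonInt c)
    (hac : NonInt (a - c)) (t : ℝ) :
    (c - a) * phiVI a b c c₁ c₂ (-1) (-1) 0 t =
      gammaFst a b c c₁ * (b / c * ((c - a) * gaussF a (b + 1) (c + 1) t)) -
      gammaSnd a b c c₂ * ((1 - c) *
        ((t : ℂ) ^ (1 - c - 1) * gaussF (a - c) (b - c + 1) (1 - c) t)) := by
  rw [phiVI_eq (p := a) (q := b + 1) (r := c + 1) (x := a - c) (y := b - c + 1)
    (s := 1 - c), gammaFst, gammaSnd, Complex.Gamma_add_one (a - c) hac.ne_zero,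
    Complex.Gamma_add_one b hb.ne_zero, Complex.Gamma_add_one c hc.ne_zero,
    Complex.Gamma_add_one (1 - c) hc.one_sub.ne_zero]
  · have h1 := hc.ne_zero
    have h2 := hc.one_sub.ne_zero
    have h3 := hc.Gamma_ne_zero
    have h4 := hc.one_sub.Gamma_ne_zero
    field_simp
    ring
  all_goals push_cast; ring

theorem mul_phiVI_neg_one_neg_two_neg_one (ha : NonInt a) (hb : NonInt b) (hc : NonInt c)
    (hac : NonInt (a - c + 1)) (hbc : NonInt (b - c + 1))
    {t : ℝ} (ht : t ∈ Set.Ioo (0 : ℝ) 1) :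
    b * phiVI a b c c₁ c₂ (-1) (-2) (-1) t =
      phiVI a b c c₁ c₂ (-1) (-1) (-1) t - t * phiVI a b c c₁ c₂ 0 (-1) 0 t := by
  rw [phiVI_neg_one_neg_two_neg_one, phiVI_zero_neg_one_zero ha hb hc,
    phiVI_neg_one_neg_one_neg_one hb hbc]
  linear_combination -gammaFst a b c c₁ * mul_gaussF_add_one_right ha hb hc ht -
    gammaSnd a b c c₂ * cpow_mul_gaussF_add_one_right hac hbc hc.one_sub ht

theorem sub_mul_phiVI_eq_sub (ha : NonInt a) (hb : NonInt b) (hc : NonInt c)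
    (hac : NonInt (a - c)) (hbc : NonInt (b - c + 1))
    {t : ℝ} (ht : t ∈ Set.Ioo (0 : ℝ) 1) :
    (c - a) * phiVI a b c c₁ c₂ (-1) (-1) 0 t =
      phiVI a b c c₁ c₂ (-1) (-1) (-1) t - phiVI a b c c₁ c₂ 0 (-1) 0 t := by
  rw [sub_mul_phiVI_neg_one_neg_one_zero hb hc hac, phiVI_zero_neg_one_zero ha hb hc,
    phiVI_neg_one_neg_one_neg_one hb hbc]
  have hcancel : b / c * c = b := div_mul_cancel₀ _ hc.ne_zero
  linear_combination gammaFst a b c c₁ * (b / c) *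
      mul_gaussF_top_bottom ha hb.add_one hc ht +
    gammaFst a b c c₁ * gaussF a (b + 1) c t * hcancel -
    gammaSnd a b c c₂ * cpow_mul_gaussF_add_one_left hac hbc hc.one_sub ht

theorem hasDerivAt_phiVI_neg_one_neg_two_neg_one (ha : NonInt a) (hb : NonInt b)
    (hc : NonInt c) (hac : NonInt (a - c + 1)) (hbc : NonInt (b - c + 1))
    {t : ℝ} (ht : t ∈ Set.Ioo (0 : ℝ) 1) :
    HasDerivAt (phiVI a b c c₁ c₂ (-1) (-2) (-1)) (phiVI a b c c₁ c₂ 0 (-1) 0 t) t := by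
  rw [funext (phiVI_neg_one_neg_two_neg_one a b c c₁ c₂), phiVI_zero_neg_one_zero ha hb hc]
  exact ((hasDerivAt_gaussF ha hb hc ht).const_mul _).add
    ((hasDerivAt_cpow_mul_gaussF hac hbc hc.one_sub ht).const_mul _)

/-- The function `φ_{-1,-2,-1}`, whose derivative is `φ_{0,-1,0}`, solves the hypergeometric
equation with parameters `a, b, c`. -/
theorem exists_hasDerivAt_phiVI_zero_neg_one_zero (ha : NonInt a) (hb : NonInt b)
    (hc : NonInt c) (hac : NonInt (a - c + 1)) (hbc : NonInt (b - c + 1))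
    {t : ℝ} (ht : t ∈ Set.Ioo (0 : ℝ) 1) :
    ∃ y : ℂ, HasDerivAt (phiVI a b c c₁ c₂ 0 (-1) 0) y t ∧
      t * (1 - t) * y + (c - (a + b + 1) * t) * phiVI a b c c₁ c₂ 0 (-1) 0 t =
        a * b * phiVI a b c c₁ c₂ (-1) (-2) (-1) t := by
  rw [funext (phiVI_zero_neg_one_zero ha hb hc), phiVI_neg_one_neg_two_neg_one]
  refine ⟨_, (((hasDerivAt_gaussF ha.add_one hb.add_one hc.add_one ht).const_mul _).const_mul
    _).add ((hasDerivAt_cpow_sub_one_mul_gaussF hac hbc hc.one_sub ht).const_mul _), ?_⟩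
  linear_combination gammaFst a b c c₁ * gaussF_ode ha hb hc ht +
    gammaSnd a b c c₂ * cpow_mul_gaussF_ode hac hbc hc.one_sub ht

end Phi



/-- the Riccati solution of the symmetric form of P_VI:
`f₀ = b φ_{-1,-2,-1}/φ_{0,-1,0}`, `f₃ = (c-a) φ_{-1,-1,0}/φ_{0,-1,0}`,
`f₄ = φ_{-1,-1,-1}/φ_{0,-1,0}`, `f₂ = 0`, with parameters
`(α₀,α₁,α₂,α₃,α₄) = (-b, a, 0, c-a, b-c+1)`. -/
theorem pVI_riccati_solution
    (a b c c₁ c₂ : ℂ)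
    (ha : a ∉ Set.range ((↑·) : ℤ → ℂ))
    (hb : b ∉ Set.range ((↑·) : ℤ → ℂ))
    (hc : c ∉ Set.range ((↑·) : ℤ → ℂ))
    (hca : c - a ∉ Set.range ((↑·) : ℤ → ℂ))
    (hcb : c - b ∉ Set.range ((↑·) : ℤ → ℂ))
    (U : Set ℝ) (hU : IsOpen U) (hU01 : U ⊆ Set.Ioo 0 1)
    (hden : ∀ t ∈ U, phiVI a b c c₁ c₂ 0 (-1) 0 t ≠ 0)
    (f₀ f₂ f₃ f₄ : ℝ → ℂ)
    (hf₀ : ∀ t, f₀ t = b * phiVI a b c c₁ c₂ (-1) (-2) (-1) t / phiVI a b c c₁ c₂ 0 (-1) 0 t)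
    (hf₃ : ∀ t, f₃ t = (c - a) * phiVI a b c c₁ c₂ (-1) (-1) 0 t / phiVI a b c c₁ c₂ 0 (-1) 0 t)
    (hf₄ : ∀ t, f₄ t = phiVI a b c c₁ c₂ (-1) (-1) (-1) t / phiVI a b c c₁ c₂ 0 (-1) 0 t)
    (hf₂ : ∀ t, f₂ t = 0) :
    ∀ t ∈ U,
      f₀ t = f₄ t - (t : ℂ) ∧
      f₃ t = f₄ t - 1 ∧
      (t : ℂ) * ((t : ℂ) - 1) * deriv f₄ t =
        2 * f₂ t * f₀ t * f₃ t * f₄ t - ((-b) - 1) * f₃ t * f₄ t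
          - (c - a) * f₀ t * f₄ t - (b - c + 1) * f₀ t * f₃ t ∧
      (t : ℂ) * ((t : ℂ) - 1) * deriv f₂ t =
        -(f₀ t * f₃ t + f₀ t * f₄ t + f₃ t * f₄ t) * (f₂ t) ^ 2
          + (((-b) - 1) * (f₃ t + f₄ t) + (c - a) * (f₀ t + f₄ t)
              + (b - c + 1) * (f₀ t + f₃ t)) * f₂ t
          - 0 * (a + 0) := by
  have hac : NonInt (a - c) := by simpa using NonInt.neg hca
  have hbc : NonInt (b - c + 1) := by
    have h : NonInt (b - c) := by simpa using NonInt.neg hcb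
    exact h.add_one
  intro t ht
  have ht01 := hU01 ht
  have hne := hden t ht
  obtain ⟨y, hy, hode⟩ := exists_hasDerivAt_phiVI_zero_neg_one_zero (c₁ := c₁) (c₂ := c₂)
    ha hb hc hac.add_one hbc ht01
  have h₀ : ∀ x ∈ U, f₀ x = f₄ x - x := fun x hx => by
    have hx0 := hden x hx
    rw [hf₀, hf₄, mul_phiVI_neg_one_neg_two_neg_one ha hb hc hac.add_one hbc (hU01 hx)]
    field_simp
  have h₃ : f₃ t = f₄ t - 1 := by
    rw [hf₃, hf₄, sub_mul_phiVI_eq_sub ha hb hc hac hbc ht01]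
    field_simp
  have hd : HasDerivAt f₄ _ t :=
    (Complex.ofRealCLM.hasDerivAt.add
      (((hasDerivAt_phiVI_neg_one_neg_two_neg_one (c₁ := c₁) (c₂ := c₂)
        ha hb hc hac.add_one hbc ht01).const_mul b).div hy hne)).congr_of_eventuallyEq <| by
      filter_upwards [hU.mem_nhds ht] with x hx
      simp [← hf₀, h₀ x hx]
  have h₄ : f₄ t = t + f₀ t := by rw [h₀ t ht]; ring
  refine ⟨h₀ t ht, h₃, ?_, ?_⟩
  · rw [hd.deriv, h₃, h₄, hf₂, hf₀]
    simp only [Complex.ofRealCLM_apply, Complex.ofReal_one]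
    field_simp
    linear_combination b * phiVI a b c c₁ c₂ (-1) (-2) (-1) t *
      phiVI a b c c₁ c₂ 0 (-1) 0 t * hode
  · simp [funext hf₂]
end

section
/- With φ_{ν+j} and τ_n^{ν+j} as in the context (Bessel case σ = +1 or modified Bessel case σ = −1), for every integer n ≥ 0, on every open subinterval of (0,∞) on which none of the τ-functions appearing in the denominators vanishes: q = σ·τ_{n+1}^{ν}τ_n^{ν+1}/(τ_n^{ν}τ_{n+1}^{ν+1}) satisfies q = σ( (d/dt) log(τ_{n+1}^{ν+1}/τ_n^{ν}) + (ν+1−n)/t ), and the pair q, p = −(1/(2t))·τ_{n+1}^{ν+1}τ_{n−1}^{ν+1}/(τ_n^{ν+1})² gives a solution of the Hamiltonian system S_III with parameters θ∞ = ν+n+1, θ₀ = −ν+n−1, η∞ = σ/2, η₀ = 1/2. -/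
/-- The Bessel function `J_ν(t) = Σ_k ((-1)^k/(k! Γ(ν+k+1))) (t/2)^{ν+2k}`. -/
noncomputable def besselJ (ν : ℝ) (t : ℝ) : ℝ :=
  ∑' k : ℕ, ((-1 : ℝ) ^ k / (k.factorial * Real.Gamma (ν + k + 1))) *
    (t / 2) ^ (ν + 2 * (k : ℝ))

/-- The modified Bessel function `I_ν(t) = Σ_k (1/(k! Γ(ν+k+1))) (t/2)^{ν+2k}`. -/
noncomputable def besselI (ν : ℝ) (t : ℝ) : ℝ :=
  ∑' k : ℕ, (1 / (k.factorial * Real.Gamma (ν + k + 1))) *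
    (t / 2) ^ (ν + 2 * (k : ℝ))

section BesselSeries

open Filter Topology

/-- The coefficients of the entire part of the (modified) Bessel functions. -/
noncomputable def besselCoeff (ε μ : ℝ) (k : ℕ) : ℝ :=
  ε ^ k / (k.factorial * Real.Gamma (μ + k + 1))

/-- The entire part of the (modified) Bessel functions. -/
noncomputable def besselEntire (ε μ x : ℝ) : ℝ :=
  ∑' k : ℕ, besselCoeff ε μ k * x ^ k

/-- The (modified) Bessel function `J_μ` (for `ε = -1`) or `I_μ` (for `ε = 1`). -/
noncomputable def besselZ (ε μ t : ℝ) : ℝ :=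
  (t / 2) ^ μ * besselEntire ε μ ((t / 2) ^ 2)

theorem add_natCast_ne_zero {μ : ℝ} (hμ : μ ∉ Set.range ((↑·) : ℤ → ℝ)) (k : ℕ) :
    μ + k ≠ 0 :=
  fun h => hμ ⟨-k, by push_cast; linarith⟩

theorem add_one_notMem_range {μ : ℝ} (hμ : μ ∉ Set.range ((↑·) : ℤ → ℝ)) :
    μ + 1 ∉ Set.range ((↑·) : ℤ → ℝ) := by
  rintro ⟨m, hm⟩
  exact hμ ⟨m - 1, by push_cast; linarith⟩

theorem besselCoeff_succ {μ : ℝ} (ε : ℝ) (hμ : μ ∉ Set.range ((↑·) : ℤ → ℝ)) (k : ℕ) :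
    besselCoeff ε μ (k + 1) = besselCoeff ε μ k * (ε / ((k + 1) * (μ + 1 + k))) := by
  have h := add_natCast_ne_zero (add_one_notMem_range hμ) k
  rw [besselCoeff, besselCoeff, Nat.factorial_succ,
    show μ + ((k + 1 : ℕ) : ℝ) + 1 = (μ + k + 1) + 1 by push_cast; ring,
    Real.Gamma_add_one (by convert h using 1; ring), show μ + 1 + (k : ℝ) = μ + k + 1 by ring]
  push_cast
  rw [div_mul_div_comm]
  ring_nf

theorem succ_mul_besselCoeff_succ (ε μ : ℝ) (k : ℕ) :
    (k + 1) * besselCoeff ε μ (k + 1) = ε * besselCoeff ε (μ + 1) k := by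
  rw [besselCoeff, besselCoeff, Nat.factorial_succ,
    show μ + ((k + 1 : ℕ) : ℝ) + 1 = μ + 1 + k + 1 by push_cast; ring]
  have : (k : ℝ) + 1 ≠ 0 := by positivity
  push_cast
  rw [pow_succ, ← mul_div_assoc, mul_assoc, mul_div_mul_left _ _ this]
  ring

theorem besselCoeff_eq_add {μ : ℝ} (ε : ℝ) (hμ : μ ∉ Set.range ((↑·) : ℤ → ℝ)) (k : ℕ) :
    besselCoeff ε μ k = (μ + 1 + k) * besselCoeff ε (μ + 1) k := by
  have h := add_natCast_ne_zero (add_one_notMem_range hμ) k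
  rw [besselCoeff, besselCoeff, show μ + 1 + (k : ℝ) + 1 = (μ + 1 + k) + 1 by ring,
    Real.Gamma_add_one h, show μ + (k : ℝ) + 1 = μ + 1 + k by ring]
  rw [← mul_div_assoc, mul_left_comm, mul_div_mul_left _ _ h]

theorem summable_besselCoeff {μ : ℝ} (ε : ℝ) (hμ : μ ∉ Set.range ((↑·) : ℤ → ℝ)) (x : ℝ) :
    Summable fun k : ℕ => besselCoeff ε μ k * x ^ k := by
  have htend : Tendsto (fun k : ℕ => ε * x / (((k : ℝ) + 1) * (μ + 1 + k))) atTop (𝓝 0) := by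
    refine Tendsto.div_atTop tendsto_const_nhds (Tendsto.atTop_mul_atTop₀ ?_ ?_)
    · exact tendsto_atTop_add_const_right _ _ tendsto_natCast_atTop_atTop
    · exact tendsto_atTop_add_const_left _ _ tendsto_natCast_atTop_atTop
  have hev := htend.norm.eventually (gt_mem_nhds (show ‖(0 : ℝ)‖ < 1 / 2 by norm_num))
  refine summable_of_ratio_norm_eventually_le (r := 1 / 2) (by norm_num) ?_
  filter_upwards [hev] with k hk
  have : besselCoeff ε μ (k + 1) * x ^ (k + 1) =
      ε * x / (((k : ℝ) + 1) * (μ + 1 + k)) * (besselCoeff ε μ k * x ^ k) := by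
    rw [besselCoeff_succ ε hμ]; ring
  rw [this, norm_mul]
  exact mul_le_mul_of_nonneg_right hk.le (norm_nonneg _)

theorem hasDerivAt_besselEntire {μ : ℝ} (ε : ℝ) (hμ : μ ∉ Set.range ((↑·) : ℤ → ℝ)) (x : ℝ) :
    HasDerivAt (besselEntire ε μ) (ε * besselEntire ε (μ + 1) x) x := by
  have hshift : ∀ (y : ℝ) (k : ℕ), besselCoeff ε μ (k + 1) * (((k + 1 : ℕ) : ℝ) * y ^ k) =
      ε * (besselCoeff ε (μ + 1) k * y ^ k) := fun y k => by
    rw [← mul_assoc ε, ← succ_mul_besselCoeff_succ]; push_cast; ring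
  have hsum : ∀ y : ℝ, Summable fun k : ℕ => besselCoeff ε μ k * ((k : ℝ) * y ^ (k - 1)) :=
    fun y => by
    rw [← summable_nat_add_iff 1]
    simp only [Nat.add_sub_cancel, hshift]
    exact (summable_besselCoeff ε (add_one_notMem_range hμ) y).mul_left ε
  have h := hasDerivAt_tsum_of_isPreconnected (t := Metric.ball (0 : ℝ) (|x| + 1))
    (g := fun k y => besselCoeff ε μ k * y ^ k) (hsum (|x| + 1)).norm Metric.isOpen_ball
    (convex_ball 0 _).isPreconnected
    (fun k y _ => (hasDerivAt_pow k y).const_mul (besselCoeff ε μ k)) (fun k y hy => ?_)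
    (Metric.mem_ball_self (by positivity)) (summable_besselCoeff ε hμ 0)
    (show x ∈ Metric.ball (0 : ℝ) (|x| + 1) by simp)
  · refine h.congr_deriv ?_
    rw [(hsum x).tsum_eq_zero_add]
    simp only [Nat.add_sub_cancel, hshift, tsum_mul_left, besselEntire]
    simp
  · have hy' : |y| ≤ |x| + 1 := by simpa using (Metric.mem_ball.1 hy).le
    have hx : |(|x| + 1)| = |x| + 1 := abs_of_nonneg (by positivity)
    simp only [norm_mul, norm_pow, Real.norm_eq_abs, hx]
    gcongr

theorem besselEntire_eq_add {μ : ℝ} (ε : ℝ) (hμ : μ ∉ Set.range ((↑·) : ℤ → ℝ)) (x : ℝ) :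
    besselEntire ε μ x =
      (μ + 1) * besselEntire ε (μ + 1) x + ε * x * besselEntire ε (μ + 2) x := by
  have h₁ := add_one_notMem_range hμ
  have h₂ := add_one_notMem_range h₁
  rw [show μ + 1 + 1 = μ + 2 by ring] at h₂
  have hshift : ∀ k : ℕ, ((k + 1 : ℕ) : ℝ) * (besselCoeff ε (μ + 1) (k + 1) * x ^ (k + 1)) =
      ε * x * (besselCoeff ε (μ + 2) k * x ^ k) := fun k => by
    have := succ_mul_besselCoeff_succ ε (μ + 1) k
    rw [show μ + 1 + 1 = μ + 2 by ring] at this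
    push_cast
    linear_combination x ^ (k + 1) * this
  have hs : Summable fun k : ℕ => (k : ℝ) * (besselCoeff ε (μ + 1) k * x ^ k) := by
    rw [← summable_nat_add_iff 1]
    simp only [hshift]
    exact (summable_besselCoeff ε h₂ x).mul_left _
  have hk : ∀ k : ℕ, besselCoeff ε μ k * x ^ k =
      (μ + 1) * (besselCoeff ε (μ + 1) k * x ^ k) +
        (k : ℝ) * (besselCoeff ε (μ + 1) k * x ^ k) := fun k => by
    rw [besselCoeff_eq_add ε hμ]; ring
  simp only [besselEntire, hk]
  rw [((summable_besselCoeff ε h₁ x).mul_left _).tsum_add hs, hs.tsum_eq_zero_add, tsum_mul_left]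
  simp only [hshift, tsum_mul_left]
  simp

theorem mul_besselZ {μ : ℝ} (ε : ℝ) (hμ : μ ∉ Set.range ((↑·) : ℤ → ℝ)) {t : ℝ} (ht : 0 < t) :
    t * besselZ ε μ t =
      2 * (μ + 1) * besselZ ε (μ + 1) t + ε * t * besselZ ε (μ + 2) t := by
  have ht' : t / 2 ≠ 0 := by positivity
  rw [besselZ, besselZ, besselZ, besselEntire_eq_add ε hμ, Real.rpow_add_one ht',
    show μ + 2 = μ + 1 + 1 by ring, Real.rpow_add_one ht', Real.rpow_add_one ht']
  ring

theorem hasDerivAt_besselZ {μ : ℝ} (ε : ℝ) (hμ : μ ∉ Set.range ((↑·) : ℤ → ℝ)) {t : ℝ}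
    (ht : 0 < t) :
    HasDerivAt (besselZ ε μ) (μ / t * besselZ ε μ t + ε * besselZ ε (μ + 1) t) t := by
  have ht' : t / 2 ≠ 0 := by positivity
  have h₀ : HasDerivAt (fun s : ℝ => s / 2) (1 / 2) t := (hasDerivAt_id t).div_const 2
  have h := (h₀.rpow_const (p := μ) (Or.inl ht')).mul
    ((hasDerivAt_besselEntire ε hμ _).comp t (h₀.pow 2))
  refine h.congr_deriv ?_
  rw [besselZ, besselZ, Real.rpow_add_one ht', Real.rpow_sub_one ht']
  simp only [Function.comp, Pi.pow_apply]
  field_simp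
  ring

theorem hasDerivAt_besselZ_sub {μ : ℝ} (ε : ℝ)
    (hμ : μ ∉ Set.range ((↑·) : ℤ → ℝ)) {t : ℝ} (ht : 0 < t) :
    HasDerivAt (besselZ ε μ) (-μ / t * besselZ ε μ t + besselZ ε (μ - 1) t) t := by
  have hμ' : μ - 1 ∉ Set.range ((↑·) : ℤ → ℝ) := by
    rintro ⟨m, hm⟩
    exact hμ ⟨m + 1, by push_cast; linarith⟩
  refine (hasDerivAt_besselZ ε hμ ht).congr_deriv ?_
  have h := mul_besselZ ε hμ' ht
  rw [show μ - 1 + 1 = μ by ring, show μ - 1 + 2 = μ + 1 by ring] at h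
  field_simp
  linear_combination -h

theorem besselZ_eq_tsum (ε μ : ℝ) {t : ℝ} (ht : 0 < t) :
    besselZ ε μ t = ∑' k : ℕ, besselCoeff ε μ k * (t / 2) ^ (μ + 2 * (k : ℝ)) := by
  have ht' : 0 < t / 2 := by positivity
  rw [besselZ, besselEntire, ← tsum_mul_left]
  refine tsum_congr fun k => ?_
  rw [Real.rpow_add ht', Real.rpow_mul ht'.le, Real.rpow_natCast, Real.rpow_two]
  ring

theorem besselJ_eq_besselZ (μ : ℝ) {t : ℝ} (ht : 0 < t) : besselJ μ t = besselZ (-1) μ t :=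
  (besselZ_eq_tsum (-1) μ ht).symm

theorem besselI_eq_besselZ (μ : ℝ) {t : ℝ} (ht : 0 < t) : besselI μ t = besselZ 1 μ t := by
  simp [besselZ_eq_tsum 1 μ ht, besselI, besselCoeff]

theorem neg_notMem_range {μ : ℝ} (hμ : μ ∉ Set.range ((↑·) : ℤ → ℝ)) :
    -μ ∉ Set.range ((↑·) : ℤ → ℝ) := by
  rintro ⟨m, hm⟩
  exact hμ ⟨-m, by push_cast; linarith⟩

theorem hasDerivAt_bessel_combination {ε ν : ℝ} (hε : ε ^ 2 = 1)
    (hν : ν ∉ Set.range ((↑·) : ℤ → ℝ)) (c₁ c₂ : ℂ) {t : ℝ} (ht : 0 < t) :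
    HasDerivAt (fun s => c₁ * (besselZ ε ν s : ℂ) + c₂ * (besselZ ε (-ν) s : ℂ))
      ((ν * (c₁ * (besselZ ε ν t : ℂ) + c₂ * (besselZ ε (-ν) t : ℂ)) + ε * t *
        (c₁ * (besselZ ε (ν + 1) t : ℂ) + c₂ * ε * (besselZ ε (-ν - 1) t : ℂ))) / t) t := by
  have ht0 : (t : ℂ) ≠ 0 := by exact_mod_cast ht.ne'
  have hε' : (ε : ℂ) ^ 2 = 1 := by exact_mod_cast hε
  refine (((hasDerivAt_besselZ ε hν ht).ofReal_comp.const_mul c₁).add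
    ((hasDerivAt_besselZ_sub ε (neg_notMem_range hν) ht).ofReal_comp.const_mul c₂)).congr_deriv ?_
  push_cast
  field_simp
  linear_combination -c₂ * t * besselZ ε (-ν - 1) t * hε'

theorem hasDerivAt_bessel_combination_succ {ε ν : ℝ} (hε : ε ^ 2 = 1)
    (hν : ν ∉ Set.range ((↑·) : ℤ → ℝ)) (c₁ c₂ : ℂ) {t : ℝ} (ht : 0 < t) :
    HasDerivAt
      (fun s => c₁ * (besselZ ε (ν + 1) s : ℂ) + c₂ * ε * (besselZ ε (-ν - 1) s : ℂ))
      ((t * (c₁ * (besselZ ε ν t : ℂ) + c₂ * (besselZ ε (-ν) t : ℂ)) - (ν + 1) *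
        (c₁ * (besselZ ε (ν + 1) t : ℂ) + c₂ * ε * (besselZ ε (-ν - 1) t : ℂ))) / t) t := by
  have ht0 : (t : ℂ) ≠ 0 := by exact_mod_cast ht.ne'
  have hε' : (ε : ℂ) ^ 2 = 1 := by exact_mod_cast hε
  have hν' := neg_notMem_range (add_one_notMem_range hν)
  rw [neg_add'] at hν'
  refine (((hasDerivAt_besselZ_sub ε (add_one_notMem_range hν) ht).ofReal_comp.const_mul c₁).add
    ((hasDerivAt_besselZ ε hν' ht).ofReal_comp.const_mul (c₂ * ε))).congr_deriv ?_
  rw [add_sub_cancel_right, sub_add_cancel]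
  push_cast
  field_simp
  linear_combination c₂ * t * besselZ ε (-ν) t * hε'

end BesselSeries

section HankelIdentities

variable {k R : Type*} [CommRing k] [CommRing R] [Algebra k R]

theorem Derivation.leibniz_prod_update {ι : Type*} [DecidableEq ι] (D : Derivation k R R)
    (s : Finset ι) (f : ι → R) :
    D (∏ i ∈ s, f i) = ∑ j ∈ s, ∏ i ∈ s, Function.update f j (D (f j)) i := by
  induction s using Finset.induction_on with
  | empty => simp
  | insert a s ha ih =>
    have hne : ∀ i ∈ s, i ≠ a := fun i hi h => ha (h ▸ hi)
    rw [Finset.prod_insert ha, D.leibniz, ih, Finset.sum_insert ha, Finset.prod_insert ha,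
      Finset.prod_congr rfl fun i hi => Function.update_of_ne (hne i hi) _ f, smul_eq_mul,
      smul_eq_mul, Finset.mul_sum, Function.update_self, add_comm, mul_comm]
    refine congrArg _ (Finset.sum_congr rfl fun j hj => ?_)
    rw [Finset.prod_insert ha, Function.update_of_ne (hne j hj).symm]

theorem Derivation.map_det {n : Type*} [Fintype n] [DecidableEq n] (D : Derivation k R R)
    (M : Matrix n n R) :
    D M.det = ∑ i, (M.updateRow i fun j => D (M i j)).det := by
  have hcol : ∀ i, (M.updateRow i fun j => D (M i j)).det =
      (M.transpose.updateCol i fun j => D (M i j)).det := fun i => by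
    rw [← Matrix.det_transpose, Matrix.updateCol_transpose]
  simp_rw [hcol]
  rw [← Matrix.det_transpose M]
  simp_rw [Matrix.det_apply, map_sum]
  rw [Finset.sum_comm]
  refine Finset.sum_congr rfl fun σ _ => ?_
  rw [← Finset.smul_sum, Units.smul_def, Units.smul_def, map_zsmul, D.leibniz_prod_update]
  refine congrArg _ (Finset.sum_congr rfl fun j _ => Finset.prod_congr rfl fun i _ => ?_)
  by_cases h : i = j
  · subst h; simp
  · simp [h]

/-- If `D` maps each term of a sequence of row vectors to a multiple of itself plus the next term,
then the derivative of the determinant of the first rows only sees the multiples and the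
replacement of the last row by its successor. -/
theorem Derivation.map_det_of_succ_row (D : Derivation k R R) {N : ℕ}
    (f : ℕ → Fin (N + 1) → R) (c : ℕ → R) (h : ∀ i j, D (f i j) = c i * f i j + f (i + 1) j) :
    D (Matrix.of fun i : Fin (N + 1) => f i).det =
      (∑ i : Fin (N + 1), c i) * (Matrix.of fun i : Fin (N + 1) => f i).det +
      (Matrix.of (Fin.snoc (fun i : Fin N => f i) (f (N + 1)) :
        Fin (N + 1) → Fin (N + 1) → R)).det := by
  have hrow : ∀ i : Fin (N + 1), (fun j => D (Matrix.of (fun i : Fin (N + 1) => f i) i j)) =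
      c i • f i + f (i + 1) := fun i => by
    ext j; simp [h]
  simp_rw [D.map_det, hrow, Matrix.det_updateRow_add, Matrix.det_updateRow_smul]
  have hzero : ∀ i : Fin N, ((Matrix.of fun i : Fin (N + 1) => f i).updateRow i.castSucc
      (f (i.castSucc + 1))).det = 0 := fun i => by
    refine Matrix.det_zero_of_row_eq (i := i.castSucc) (j := i.succ) Fin.castSucc_lt_succ.ne ?_
    rw [Matrix.updateRow_self, Matrix.updateRow_ne Fin.castSucc_lt_succ.ne']
    rfl
  rw [Finset.sum_add_distrib, Finset.sum_mul, Fin.sum_univ_castSucc (n := N) (f := fun i =>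
    ((Matrix.of fun i : Fin (N + 1) => f i).updateRow i (f (i + 1))).det),
    Finset.sum_eq_zero fun i _ => hzero i, zero_add]
  congr 1
  · refine Finset.sum_congr rfl fun i _ => ?_
    congr 2
    exact Matrix.updateRow_eq_self _ _
  · congr 1
    ext i l
    refine Fin.lastCases ?_ (fun i => ?_) i
    · simp
    · rw [Matrix.updateRow_ne (Fin.castSucc_lt_last i).ne]; simp

namespace Matrix

theorem det_snoc_eq_det_cons {N : ℕ} (w : Fin N → Fin (N + 1) → R) (a : Fin (N + 1) → R) :
    det (of (Fin.snoc w a : Fin (N + 1) → Fin (N + 1) → R)) =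
      (-1) ^ N * det (of (Fin.cons a w : Fin (N + 1) → Fin (N + 1) → R)) := by
  rw [det_succ_row _ (Fin.last N), det_succ_row_zero, Finset.mul_sum]
  refine Finset.sum_congr rfl fun j _ => ?_
  have h₁ : (of (Fin.snoc w a : Fin (N + 1) → Fin (N + 1) → R)).submatrix
      (Fin.last N).succAbove j.succAbove = of fun i l => w i (j.succAbove l) := by
    ext i l; simp [Fin.succAbove_last]
  have h₂ : (of (Fin.cons a w : Fin (N + 1) → Fin (N + 1) → R)).submatrix
      Fin.succ j.succAbove = of fun i l => w i (j.succAbove l) := by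
    ext i l; simp
  rw [h₁, h₂]
  simp only [of_apply, Fin.snoc_last, Fin.cons_zero, Fin.val_last]
  ring

theorem det_snoc_single {N : ℕ} (w : Fin N → Fin (N + 1) → R) (j : Fin (N + 1)) :
    det (of (Fin.snoc w (Pi.single j 1) : Fin (N + 1) → Fin (N + 1) → R)) =
      (-1) ^ (N + j : ℕ) * det (of fun i l => w i (j.succAbove l)) := by
  rw [det_succ_row _ (Fin.last N), Finset.sum_eq_single j]
  · have h₁ : (of (Fin.snoc w (Pi.single j 1) : Fin (N + 1) → Fin (N + 1) → R)).submatrix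
        (Fin.last N).succAbove j.succAbove = of fun i l => w i (j.succAbove l) := by
      ext i l; simp [Fin.succAbove_last]
    rw [h₁]
    simp
  · intro b _ hb
    simp [hb]
  · simp

theorem det_snoc_snoc_eq_det_cons_cons {N : ℕ} (w : Fin N → Fin (N + 2) → R)
    (a b : Fin (N + 2) → R) :
    det (of (Fin.snoc (Fin.snoc w a : Fin (N + 1) → Fin (N + 2) → R) b :
        Fin (N + 2) → Fin (N + 2) → R)) =
      (-1) ^ N * det (of (Fin.snoc (Fin.cons a w : Fin (N + 1) → Fin (N + 2) → R) b :
        Fin (N + 2) → Fin (N + 2) → R)) := by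
  rw [det_succ_row _ (Fin.last _), det_succ_row _ (Fin.last _), Finset.mul_sum]
  refine Finset.sum_congr rfl fun j _ => ?_
  have h := det_snoc_eq_det_cons (fun i l => w i (j.succAbove l)) (fun l => a (j.succAbove l))
  have h₁ : (of (Fin.snoc (Fin.snoc w a : Fin (N + 1) → Fin (N + 2) → R) b :
        Fin (N + 2) → Fin (N + 2) → R)).submatrix
      (Fin.last _).succAbove j.succAbove = of (Fin.snoc (fun i l => w i (j.succAbove l))
        (fun l => a (j.succAbove l)) : Fin (N + 1) → Fin (N + 1) → R) := by
    ext i l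
    refine Fin.lastCases ?_ (fun i => ?_) i <;> simp [Fin.succAbove_last]
  have h₂ : (of (Fin.snoc (Fin.cons a w : Fin (N + 1) → Fin (N + 2) → R) b :
        Fin (N + 2) → Fin (N + 2) → R)).submatrix
      (Fin.last _).succAbove j.succAbove = of (Fin.cons (fun l => a (j.succAbove l))
        (fun i l => w i (j.succAbove l)) : Fin (N + 1) → Fin (N + 1) → R) := by
    ext i l
    refine Fin.cases ?_ (fun i => ?_) i <;> simp [Fin.succAbove_last, -Fin.castSucc_succ]
  rw [h₁, h₂, h]
  simp only [of_apply, Fin.snoc_last]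
  ring

variable [IsDomain R]

/-- Three-term Plücker relation. -/
theorem det_cons_cons_plucker {N : ℕ} (w : Fin N → Fin (N + 2) → R) (a b c d : Fin (N + 2) → R)
    (F : (Fin (N + 2) → R) → (Fin (N + 2) → R) → R)
    (hF : ∀ x y, F x y = det (of (Fin.cons x (Fin.cons y w : Fin (N + 1) → Fin (N + 2) → R) :
        Fin (N + 2) → Fin (N + 2) → R))) :
    F a b * F c d - F a c * F b d + F a d * F b c = 0 := by
  let v : Fin (N + 3) → Fin (N + 2) → R := Fin.cons b (Fin.cons c (Fin.cons d w))
  let M : Matrix (Fin (N + 3)) (Fin (N + 3)) R :=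
    of fun i => Fin.cons (F a (v i)) (v i)
  have hlin : ∃ g : Fin (N + 2) → R, ∀ x, F a x = ∑ l, g l * x l := by
    refine ⟨fun l => F a (Pi.single l 1), fun x => ?_⟩
    have hup : ∀ x, F a x = det (updateRow (of (Fin.cons a (Fin.cons 0 w : Fin (N + 1) →
        Fin (N + 2) → R) : Fin (N + 2) → Fin (N + 2) → R)) 1 x) := by
      intro x
      rw [hF]
      congr 1
      ext i l
      refine Fin.cases ?_ (fun i => Fin.cases ?_ (fun i => ?_) i) i
      · rw [updateRow_ne (by simp)]; simp
      · rw [Fin.succ_zero_eq_one, updateRow_self]; rfl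
      · rw [updateRow_ne (by simp [Fin.ext_iff])]; simp
    let T : (Fin (N + 2) → R) →ₗ[R] R := (detRowAlternating (n := Fin (N + 2))
      (R := R)).toMultilinearMap.toLinearMap (of (Fin.cons a (Fin.cons 0 w : Fin (N + 1) →
        Fin (N + 2) → R) : Fin (N + 2) → Fin (N + 2) → R)) 1
    have hT : ∀ x, F a x = T x := hup
    rw [hT, LinearMap.pi_apply_eq_sum_univ T x]
    refine Finset.sum_congr rfl fun l _ => ?_
    simp only [hT, smul_eq_mul]
    rw [mul_comm]
    congr 2
    ext i
    simp [Pi.single_apply, eq_comm]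
  have hM : M.det = 0 := by
    obtain ⟨g, hg⟩ := hlin
    rw [← exists_mulVec_eq_zero_iff]
    refine ⟨Fin.cons (-1) g, fun h => by simpa using congrFun h 0, ?_⟩
    ext i
    simp [mulVec, dotProduct, Fin.sum_univ_succ (n := N + 2), M, hg, mul_comm]
  have h0 : ∀ i, F a (w i) = 0 := fun i => by
    rw [hF]
    exact det_zero_of_row_eq (i := 1) (j := i.succ.succ) (by simp [Fin.ext_iff]) (by ext l; rfl)
  rw [det_succ_column_zero, Fin.sum_univ_succ, Fin.sum_univ_succ, Fin.sum_univ_succ,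
    Finset.sum_eq_zero fun i _ => ?_] at hM
  · have e₁ : M.submatrix (Fin.succAbove 0) Fin.succ = of (Fin.cons c (Fin.cons d w)) := by
      ext i l
      refine Fin.cases ?_ (fun i => ?_) i <;> simp [M, v]
    have e₂ : M.submatrix (Fin.succAbove (Fin.succ 0)) Fin.succ =
        of (Fin.cons b (Fin.cons d w)) := by
      ext i l
      refine Fin.cases ?_ (fun i => ?_) i <;> simp [M, v]
    have e₃ : M.submatrix (Fin.succAbove (Fin.succ (Fin.succ 0))) Fin.succ =
        of (Fin.cons b (Fin.cons c w)) := by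
      ext i l
      refine Fin.cases ?_ (fun i => Fin.cases ?_ (fun i => ?_) i) i
      · rfl
      · rfl
      · rfl
    rw [e₁, e₂, e₃, ← hF, ← hF, ← hF] at hM
    have m₀ : M 0 0 = F a b := rfl
    have m₁ : M (Fin.succ 0) 0 = F a c := rfl
    have m₂ : M (Fin.succ (Fin.succ 0)) 0 = F a d := rfl
    rw [m₀, m₁, m₂] at hM
    simp only [Fin.val_zero, Fin.val_succ] at hM
    linear_combination hM
  · have : M i.succ.succ.succ 0 = F a (w i) := rfl
    rw [this, h0]; simp

theorem det_snoc_snoc_plucker {N : ℕ} (w : Fin N → Fin (N + 2) → R) (a b c d : Fin (N + 2) → R)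
    (G : (Fin (N + 2) → R) → (Fin (N + 2) → R) → R)
    (hG : ∀ x y, G x y = det (of (Fin.snoc (Fin.snoc w x : Fin (N + 1) → Fin (N + 2) → R) y :
        Fin (N + 2) → Fin (N + 2) → R))) :
    G a b * G c d - G a c * G b d + G a d * G b c = 0 := by
  refine (?_ : _ = _).trans (det_cons_cons_plucker w d c b a (fun x y => -G y x) fun x y => ?_)
  · ring
  · rw [hG, det_snoc_snoc_eq_det_cons_cons, det_snoc_eq_det_cons]
    have := Even.neg_one_pow (α := R) (Even.add_self N)
    rw [pow_succ, ← mul_assoc, mul_left_comm]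
    linear_combination (det (of (Fin.cons x (Fin.cons y w : Fin (N + 1) → Fin (N + 2) → R) :
        Fin (N + 2) → Fin (N + 2) → R))) * this

end Matrix

/-- The Hankel determinant of the iterated derivatives of `a`. -/
def hankelDet (D : Derivation k R R) (a : R) (n : ℕ) : R :=
  (Matrix.of fun i j : Fin n => D^[(i : ℕ) + j] a).det

theorem Fin.snoc_val_eq {α : Type*} (f : ℕ → α) (n : ℕ) :
    (Fin.snoc (fun i : Fin n => f i) (f n) : Fin (n + 1) → α) = fun i : Fin (n + 1) => f i := by
  ext i
  refine Fin.lastCases ?_ (fun i => ?_) i <;> simp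

section Christoffel

variable (D : Derivation k R R) {a s c : R}

theorem iterate_derivation_of_eq_sub (hc : D c = 0) (hs : s = D a - c * a) (i : ℕ) :
    D^[i] s = D^[i + 1] a - c * D^[i] a := by
  induction i with
  | zero => simpa using hs
  | succ i ih =>
    simp only [Function.iterate_succ_apply'] at ih ⊢
    simp [ih, D.leibniz, hc]

theorem hankelDet_eq_det_cons (hc : D c = 0) (hs : s = D a - c * a) (n : ℕ) :
    hankelDet D a (n + 1) = (Matrix.of fun i : Fin (n + 1) =>
      (Fin.cons (D^[(i : ℕ)] a) fun j : Fin n => D^[(i : ℕ) + j] s : Fin (n + 1) → R)).det := by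
  refine Matrix.det_eq_of_forall_col_eq_smul_add_pred (fun _ => c) (fun i => by simp) fun i j => ?_
  simp [iterate_derivation_of_eq_sub D hc hs, add_assoc]

variable [IsDomain R]

theorem hankelDet_bilinear_succ (hc : D c = 0) (hs : s = D a - c * a) (n : ℕ) :
    hankelDet D a (n + 2) * hankelDet D s n =
      hankelDet D a (n + 1) * D (hankelDet D s (n + 1)) -
        hankelDet D s (n + 1) * D (hankelDet D a (n + 1)) := by
  let ρ : ℕ → Fin (n + 2) → R := fun i => Fin.cons (D^[i] a) fun j : Fin (n + 1) => D^[i + j] s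
  let G : (Fin (n + 2) → R) → (Fin (n + 2) → R) → R := fun x y => (Matrix.of
    (Fin.snoc (Fin.snoc (fun i : Fin n => ρ i) x : Fin (n + 1) → Fin (n + 2) → R) y :
      Fin (n + 2) → Fin (n + 2) → R)).det
  have hpl := Matrix.det_snoc_snoc_plucker (fun i : Fin n => ρ i) (ρ n) (ρ (n + 1))
    (Pi.single 0 1) (Pi.single (Fin.last _) 1) G fun _ _ => rfl
  have hρ : ∀ i, (fun l : Fin (n + 1) => ρ i l.castSucc) =
      (Fin.cons (D^[i] a) fun j : Fin n => D^[i + j] s : Fin (n + 1) → R) := fun i => by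
    ext l; refine Fin.cases ?_ (fun l => ?_) l <;> simp [ρ]
  have hDρ : ∀ i l, D (ρ i l) = ρ (i + 1) l := fun i l => by
    refine Fin.cases ?_ (fun l => ?_) l <;>
      simp [ρ, ← Function.iterate_succ_apply' D, add_right_comm]
  have hlast : ∀ x, G x (Pi.single (Fin.last _) 1) = (Matrix.of (Fin.snoc
      (fun (i : Fin n) (l : Fin (n + 1)) => ρ i l.castSucc) (fun l => x l.castSucc) :
        Fin (n + 1) → Fin (n + 1) → R)).det := fun x => by
    simp only [G, Matrix.det_snoc_single, Fin.val_last, ← two_mul, pow_mul, neg_one_sq, one_pow,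
      one_mul, Fin.succAbove_last]
    congr 1
    ext i l
    refine Fin.lastCases ?_ (fun i => ?_) i <;> simp
  have hfirst : ∀ x, G x (Pi.single 0 1) = (-1) ^ (n + 1) * (Matrix.of (Fin.snoc
      (fun (i : Fin n) (l : Fin (n + 1)) => ρ i l.succ) (fun l => x l.succ) :
        Fin (n + 1) → Fin (n + 1) → R)).det := fun x => by
    simp only [G, Matrix.det_snoc_single, Fin.val_zero, add_zero, Fin.succAbove_zero]
    congr 2
    ext i l
    refine Fin.lastCases ?_ (fun i => ?_) i <;> simp
  have hA : hankelDet D a (n + 1) =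
      (Matrix.of fun (i : Fin (n + 1)) (l : Fin (n + 1)) => ρ i l.castSucc).det := by
    rw [hankelDet_eq_det_cons D hc hs]
    exact congrArg (fun M => (Matrix.of M).det) (funext fun i => (hρ i).symm)
  have hC : hankelDet D s (n + 1) =
      (Matrix.of fun (i : Fin (n + 1)) (l : Fin (n + 1)) => ρ i l.succ).det := rfl
  have hDA := D.map_det_of_succ_row (fun i (l : Fin (n + 1)) => ρ i l.castSucc) 0
    fun i l => by simp [hDρ]
  have hDC := D.map_det_of_succ_row (fun i (l : Fin (n + 1)) => ρ i l.succ) 0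
    fun i l => by simp [hDρ]
  simp only [Pi.zero_apply, Finset.sum_const_zero, zero_mul, zero_add, ← hA, ← hC] at hDA hDC
  have e₁ : G (ρ n) (ρ (n + 1)) = hankelDet D a (n + 2) := by
    simp only [G, Fin.snoc_val_eq ρ, hankelDet_eq_det_cons D hc hs, ρ]
  have e₂ : G (ρ n) (Pi.single (Fin.last _) 1) = hankelDet D a (n + 1) := by
    rw [hlast, hA]
    exact congrArg (fun M => (Matrix.of M).det)
      (Fin.snoc_val_eq (fun i (l : Fin (n + 1)) => ρ i l.castSucc) n)
  have e₃ : G (ρ n) (Pi.single 0 1) = (-1) ^ (n + 1) * hankelDet D s (n + 1) := by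
    rw [hfirst, hC]
    exact congrArg (fun M => (-1) ^ (n + 1) * (Matrix.of M).det)
      (Fin.snoc_val_eq (fun i (l : Fin (n + 1)) => ρ i l.succ) n)
  have e₄ : G (Pi.single 0 1) (Pi.single (Fin.last _) 1) = (-1) ^ n * hankelDet D s n := by
    rw [hlast]
    have : (fun l : Fin (n + 1) => (Pi.single 0 1 : Fin (n + 2) → R) l.castSucc) =
        Pi.single 0 1 := by
      ext l; simp [Pi.single_apply]
    rw [this, Matrix.det_snoc_single]
    simp [hankelDet, ρ]
  rw [e₁, e₂, e₃, e₄, hlast, ← hDA, hfirst, ← hDC] at hpl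
  have hsq : ((-1 : R) ^ n) * (-1) ^ n = 1 := by rw [← mul_pow]; simp
  linear_combination (-1) ^ n * hpl - (hankelDet D a (n + 2) * hankelDet D s n -
      hankelDet D a (n + 1) * D (hankelDet D s (n + 1)) +
        hankelDet D s (n + 1) * D (hankelDet D a (n + 1))) * hsq

theorem hankelDet_bilinear_mul (hc : D c = 0) (hs : s = D a - c * a) (n : ℕ) :
    hankelDet D s (n + 1) * hankelDet D a n =
      hankelDet D s n * (D (hankelDet D a (n + 1)) - c * hankelDet D a (n + 1)) -
        hankelDet D a (n + 1) * D (hankelDet D s n) := by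
  rcases n with _ | n
  · simp [hankelDet, hs]
  let σ : ℕ → Fin (n + 2) → R := fun i l => D^[i + l] s
  let μ : Fin (n + 2) → R := fun l => D^[(l : ℕ)] a
  let G : (Fin (n + 2) → R) → (Fin (n + 2) → R) → R := fun x y => (Matrix.of
    (Fin.snoc (Fin.snoc (fun i : Fin n => σ i) x : Fin (n + 1) → Fin (n + 2) → R) y :
      Fin (n + 2) → Fin (n + 2) → R)).det
  have hpl := Matrix.det_snoc_snoc_plucker (fun i : Fin n => σ i) μ (σ n) (σ (n + 1))
    (Pi.single (Fin.last _) 1) G fun _ _ => rfl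
  have hDσ : ∀ i l, D (σ i l) = σ (i + 1) l := fun i l => by
    simp [σ, ← Function.iterate_succ_apply' D, add_right_comm]
  have hlast : ∀ x, G x (Pi.single (Fin.last _) 1) = (Matrix.of (Fin.snoc
      (fun (i : Fin n) (l : Fin (n + 1)) => σ i l.castSucc) (fun l => x l.castSucc) :
        Fin (n + 1) → Fin (n + 1) → R)).det := fun x => by
    simp only [G, Matrix.det_snoc_single, Fin.val_last, ← two_mul, pow_mul, neg_one_sq, one_pow,
      one_mul, Fin.succAbove_last]
    congr 1
    ext i l
    refine Fin.lastCases ?_ (fun i => ?_) i <;> simp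
  let f : ℕ → Fin (n + 2) → R := fun i => Nat.casesOn i μ σ
  have hA : ∀ m, (Matrix.of (Fin.cons (fun l : Fin (m + 1) => D^[(l : ℕ)] a)
      fun (i : Fin m) l => D^[i + l] s : Fin (m + 1) → Fin (m + 1) → R)).det =
        hankelDet D a (m + 1) := fun m => by
    rw [hankelDet_eq_det_cons D hc hs, ← Matrix.det_transpose]
    congr 1
    ext i l
    refine Fin.cases ?_ (fun l => ?_) l <;> simp [add_comm]
  have hf : ∀ m, (fun i : Fin (m + 1) => f i) = Fin.cons μ fun i : Fin m => σ i := fun m => by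
    ext i l
    refine Fin.cases ?_ (fun l => ?_) i <;> simp [f]
  have hA' : (Matrix.of fun i : Fin (n + 2) => f i).det = hankelDet D a (n + 2) := by
    rw [← hA, hf]
  have hDA := D.map_det_of_succ_row f (fun i => Nat.casesOn i c fun _ => 0) fun i l => by
    cases i with
    | zero =>
      change D (D^[(l : ℕ)] a) = c * D^[(l : ℕ)] a + D^[0 + (l : ℕ)] s
      rw [zero_add, iterate_derivation_of_eq_sub D hc hs, Function.iterate_succ_apply']
      ring
    | succ i => simpa [f] using hDσ i l
  have hDC := D.map_det_of_succ_row (fun i (l : Fin (n + 1)) => σ i l.castSucc) 0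
    fun i l => by simp [hDσ]
  have hC : (Matrix.of fun i (l : Fin (n + 1)) => σ (i : Fin (n + 1)) l.castSucc).det =
    hankelDet D s (n + 1) := rfl
  simp only [Pi.zero_apply, Finset.sum_const_zero, zero_mul, zero_add, hC] at hDC
  simp only [Fin.sum_univ_succ, Fin.val_zero, Fin.val_succ, Finset.sum_const_zero, add_zero, hA']
    at hDA
  rw [hf] at hDA
  change _ = c * _ + _ at hDA
  have e₁ : G (σ n) (σ (n + 1)) = hankelDet D s (n + 2) := by
    simp only [G, Fin.snoc_val_eq σ]; rfl
  have e₂ : G (σ n) (Pi.single (Fin.last _) 1) = hankelDet D s (n + 1) := by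
    rw [hlast, ← hC]
    exact congrArg (fun M => (Matrix.of M).det)
      (Fin.snoc_val_eq (fun i (l : Fin (n + 1)) => σ i l.castSucc) n)
  have e₃ : G μ (Pi.single (Fin.last _) 1) = (-1) ^ n * hankelDet D a (n + 1) := by
    rw [hlast, Matrix.det_snoc_eq_det_cons, ← hA]; rfl
  have e₄ : G μ (σ n) = (-1) ^ n * hankelDet D a (n + 2) := by
    simp only [G, Matrix.det_snoc_snoc_eq_det_cons_cons, ← Fin.cons_snoc_eq_snoc_cons,
      Fin.snoc_val_eq σ, ← hA', hf]
  have e₅ : G μ (σ (n + 1)) =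
      (-1) ^ n * (D (hankelDet D a (n + 2)) - c * hankelDet D a (n + 2)) := by
    rw [hDA, add_sub_cancel_left]
    simp only [G, Matrix.det_snoc_snoc_eq_det_cons_cons]; rfl
  rw [e₁, e₂, e₃, e₄, e₅, hlast, ← hDC] at hpl
  have hsq : ((-1 : R) ^ n) * (-1) ^ n = 1 := by rw [← mul_pow]; simp
  linear_combination (-1) ^ n * hpl - (hankelDet D a (n + 2) * D (hankelDet D s (n + 1)) -
      hankelDet D s (n + 1) * (D (hankelDet D a (n + 2)) - c * hankelDet D a (n + 2)) +
        hankelDet D a (n + 1) * hankelDet D s (n + 2)) * hsq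

end Christoffel

section Scaling

variable (D : Derivation k R R) {a b c u : R}

theorem iterate_derivation_mul_of_fixed (hu : D u = u) (i : ℕ) :
    D^[i] (u * a) = u * ((D.toLinearMap + 1 : Module.End k R) ^ i) a := by
  induction i with
  | zero => simp
  | succ i ih =>
    rw [Function.iterate_succ_apply', ih, D.leibniz, hu, pow_succ', Module.End.mul_apply]
    simp only [smul_eq_mul, LinearMap.add_apply, Derivation.coeFn_coe, Module.End.one_apply]
    ring

theorem derivation_add_one_pow_apply {i n : ℕ} (hi : i < n) (x : R) :
    ((D.toLinearMap + 1 : Module.End k R) ^ i) x = ∑ p : Fin n, i.choose p • D^[(p : ℕ)] x := by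
  have hsub : Finset.range (i + 1) ⊆ Finset.range n := Finset.range_subset_range.2 hi
  rw [(Commute.one_right D.toLinearMap).add_pow, LinearMap.sum_apply,
    ← Finset.sum_range fun p => i.choose p • D^[p] x, ← Finset.sum_subset hsub fun p _ hp => by
      rw [Nat.choose_eq_zero_of_lt (by simpa using hp), zero_smul]]
  refine Finset.sum_congr rfl fun p _ => ?_
  rw [one_pow, mul_one, ← Nat.cast_comm, Module.End.mul_apply, Module.End.natCast_apply,
    Module.End.pow_apply]
  rfl

/-- Hankel determinants of iterated derivatives scale under multiplication by a fixed point of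
the derivation. -/
theorem hankelDet_mul_of_fixed (hu : D u = u) (n : ℕ) :
    hankelDet D (u * a) n = u ^ n * hankelDet D a n := by
  let T : Matrix (Fin n) (Fin n) R := Matrix.of fun i p => ((i : ℕ).choose p : R)
  have hT : T.det = 1 := by
    rw [Matrix.det_of_isLowerTriangular T fun i j hij => by
      simp [T, Nat.choose_eq_zero_of_lt (show (i : ℕ) < j from hij)]]
    simp [T]
  have hmat : (Matrix.of fun i j : Fin n => D^[(i : ℕ) + j] (u * a)) =
      u • (T * (Matrix.of fun i j : Fin n => D^[(i : ℕ) + j] a) * T.transpose) := by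
    ext i j
    simp only [Matrix.of_apply, Matrix.smul_apply, smul_eq_mul, Matrix.mul_apply,
      Matrix.transpose_apply, T, iterate_derivation_mul_of_fixed D hu]
    rw [pow_add, Module.End.mul_apply, derivation_add_one_pow_apply D j.2, map_sum]
    congr 1
    refine Finset.sum_congr rfl fun q _ => ?_
    rw [map_nsmul, derivation_add_one_pow_apply D i.2, nsmul_eq_mul, mul_comm]
    simp only [← Function.iterate_add_apply, nsmul_eq_mul]
  rw [hankelDet, hmat, Matrix.det_smul, Matrix.det_mul, Matrix.det_mul, Matrix.det_transpose, hT,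
    Fintype.card_fin, one_mul, mul_one, hankelDet]

theorem derivation_pow_mul_of_fixed (hu : D u = u) (n : ℕ) (x : R) :
    D (u ^ n * x) = u ^ n * (D x + n * x) := by
  rcases n with _ | n
  · simp
  · rw [D.leibniz, D.leibniz_pow, hu]
    simp only [smul_eq_mul, nsmul_eq_mul, Nat.add_sub_cancel]
    ring

variable [IsDomain R]

theorem hankelDet_toda_succ (hc : D c = 0) (hu : D u = u) (hu0 : u ≠ 0)
    (hb : D a = c * a + u * b) (n : ℕ) :
    hankelDet D a (n + 2) * hankelDet D b n =
      u * (hankelDet D a (n + 1) * (D (hankelDet D b (n + 1)) + (n + 1) * hankelDet D b (n + 1)) -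
        hankelDet D b (n + 1) * D (hankelDet D a (n + 1))) := by
  have h := hankelDet_bilinear_succ D hc (s := u * b) (by rw [hb]; ring) n
  simp only [hankelDet_mul_of_fixed D hu, derivation_pow_mul_of_fixed D hu] at h
  refine mul_left_cancel₀ (pow_ne_zero n hu0) ?_
  push_cast at h
  linear_combination h

theorem hankelDet_toda_mul (hc : D c = 0) (hu : D u = u) (hu0 : u ≠ 0)
    (hb : D a = c * a + u * b) (n : ℕ) :
    u * (hankelDet D b (n + 1) * hankelDet D a n) =
      hankelDet D b n * (D (hankelDet D a (n + 1)) - c * hankelDet D a (n + 1)) -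
        hankelDet D a (n + 1) * (D (hankelDet D b n) + n * hankelDet D b n) := by
  have h := hankelDet_bilinear_mul D hc (s := u * b) (by rw [hb]; ring) n
  simp only [hankelDet_mul_of_fixed D hu, derivation_pow_mul_of_fixed D hu] at h
  refine mul_left_cancel₀ (pow_ne_zero n hu0) ?_
  linear_combination h

end Scaling

end HankelIdentities

section Algebra

variable {K : Type*} [Field K]

theorem painleve_algebra {t σ ν N a₀ a₁ aₘ b₀ b₁ bₘ da₀ da₁ db₀ db₁ dbₘ : K} (h2 : (2 : K) ≠ 0)
    (hσ : σ ^ 2 = 1) (ht : t ≠ 0) (ha₀ : a₀ ≠ 0) (hb₀ : b₀ ≠ 0) (hb₁ : b₁ ≠ 0)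
    (h₁ : a₁ * bₘ = -σ * t * (a₀ * (db₀ + N * b₀) - b₀ * da₀))
    (h₂ : -σ * t * (b₁ * a₀) = b₀ * (da₁ - ν * a₁) - a₁ * (db₀ + N * b₀))
    (h₃ : b₁ * aₘ = t * (b₀ * (da₀ + N * a₀) - a₀ * db₀))
    (h₄ : t * (a₁ * b₀) = a₀ * (db₁ + (ν + 1) * b₁) - b₁ * (da₀ + N * a₀))
    (h₅ : -σ * t * (b₀ * aₘ) = bₘ * (da₀ - ν * a₀) - a₀ * (dbₘ + (N - 1) * bₘ))
    {q p : K} (hq : q = σ * (a₁ * b₀) / (a₀ * b₁))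
    (hp : p = -(1 / (2 * t)) * (b₁ * bₘ) / b₀ ^ 2) :
    q = σ * (db₁ / t / b₁ - da₀ / t / a₀ + (ν + 1 - N) / t) ∧
      (σ * ((da₁ * b₀ + a₁ * db₀) * (a₀ * b₁) - a₁ * b₀ * (da₀ * b₁ + a₀ * db₁))) /
          (a₀ * b₁) ^ 2 =
        4 * q ^ 2 * p - (2 * (σ / 2) * t * q ^ 2 + (2 * (-ν + N - 1) + 1) * q + 2 * (1 / 2) * t) ∧
      p * (db₁ / b₁ - 2 * db₀ / b₀ - 1) - (1 / (2 * t)) * b₁ * dbₘ / b₀ ^ 2 =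
        -(4 * q * p ^ 2 - (4 * (σ / 2) * t * q + (2 * (-ν + N - 1) + 1)) * p +
          (σ / 2) * ((-ν + N - 1) + (ν + N + 1)) * t) := by
  have hσ0 : σ ≠ 0 := fun h => by simp [h] at hσ
  have k₁ : db₀ = b₀ * da₀ / a₀ - N * b₀ - a₁ * bₘ / (σ * t * a₀) := by
    field_simp; linear_combination h₁
  have k₂ : da₁ = ν * a₁ + (a₁ * (db₀ + N * b₀) - σ * t * (b₁ * a₀)) / b₀ := by
    field_simp; linear_combination -h₂
  have k₃ : aₘ = t * (b₀ * (da₀ + N * a₀) - a₀ * db₀) / b₁ := by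
    field_simp; linear_combination h₃
  have k₄ : db₁ = (t * (a₁ * b₀) + b₁ * (da₀ + N * a₀)) / a₀ - (ν + 1) * b₁ := by
    field_simp; linear_combination -h₄
  have k₅ : dbₘ = (bₘ * (da₀ - ν * a₀) + σ * t * (b₀ * aₘ)) / a₀ - (N - 1) * bₘ := by
    field_simp; linear_combination h₅
  refine ⟨?_, ?_, ?_⟩
  · rw [hq, k₄]; field_simp; ring
  · rw [hq, hp, k₂, k₄, k₁]
    field_simp
    linear_combination
      (4 * a₁ ^ 2 * bₘ * b₁ - 2 * a₀ ^ 2 * t ^ 2 * b₁ ^ 2 + 2 * σ * a₁ ^ 2 * b₀ ^ 2 * t ^ 2) * hσ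
  · rw [hq, hp, k₅, k₃, k₄, k₁]
    field_simp
    linear_combination (4 * b₁ * bₘ ^ 2 * a₁ + 4 * σ * t ^ 2 * b₀ ^ 2 * a₁ * bₘ) * hσ

end Algebra

theorem painleve_of_toda {A A' B B' Bₘ q p : ℝ → ℂ} {t : ℝ} {σ ν N aₘ da da' db db' dbₘ : ℂ}
    (hσ : σ ^ 2 = 1) (ht : (t : ℂ) ≠ 0)
    (hA : HasDerivAt A (da / t) t) (hA' : HasDerivAt A' (da' / t) t)
    (hB : HasDerivAt B (db / t) t) (hB' : HasDerivAt B' (db' / t) t)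
    (hBₘ : HasDerivAt Bₘ (dbₘ / t) t) (hA0 : A t ≠ 0) (hB0 : B t ≠ 0) (hB'0 : B' t ≠ 0)
    (h₁ : A' t * Bₘ t = -σ * t * (A t * (db + N * B t) - B t * da))
    (h₂ : -σ * t * (B' t * A t) = B t * (da' - ν * A' t) - A' t * (db + N * B t))
    (h₃ : B' t * aₘ = t * (B t * (da + N * A t) - A t * db))
    (h₄ : t * (A' t * B t) = A t * (db' + (ν + 1) * B' t) - B' t * (da + N * A t))
    (h₅ : -σ * t * (B t * aₘ) = Bₘ t * (da - ν * A t) - A t * (dbₘ + (N - 1) * Bₘ t))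
    (hq : ∀ s, q s = σ * (A' s * B s) / (A s * B' s))
    (hp : ∀ s, p s = -(1 / (2 * (s : ℂ))) * (B' s * Bₘ s) / B s ^ 2) :
    q t = σ * (deriv B' t / B' t - deriv A t / A t + (ν + 1 - N) / t) ∧
      t * deriv q t = 4 * q t ^ 2 * p t -
        (2 * (σ / 2) * t * q t ^ 2 + (2 * (-ν + N - 1) + 1) * q t + 2 * (1 / 2) * t) ∧
      t * deriv p t = -(4 * q t * p t ^ 2 -
        (4 * (σ / 2) * t * q t + (2 * (-ν + N - 1) + 1)) * p t +
          (σ / 2) * ((-ν + N - 1) + (ν + N + 1)) * t) := by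
  obtain ⟨e₁, e₂, e₃⟩ := painleve_algebra two_ne_zero hσ ht hA0 hB0 hB'0 h₁ h₂ h₃ h₄ h₅
    (hq t) (hp t)
  have hdq := ((hA'.mul hB).const_mul σ).div (hA.mul hB') (mul_ne_zero hA0 hB'0)
  have hdt : HasDerivAt (fun s : ℝ => -(1 / (2 * (s : ℂ)))) (1 / (2 * (t : ℂ) ^ 2)) t := by
    have h := ((hasDerivAt_id t).ofReal_comp.const_mul (2 : ℂ)).inv (mul_ne_zero two_ne_zero ht)
    simp only [one_div]
    refine h.neg.congr_deriv ?_
    simp only [id]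
    field_simp
    norm_num
  have hdp := (hdt.mul (hB'.mul hBₘ)).div (hB.pow 2) (pow_ne_zero 2 hB0)
  refine ⟨?_, ?_, ?_⟩
  · rwa [hB'.deriv, hA.deriv]
  · rw [← e₂, (hdq.congr_of_eventuallyEq (Filter.Eventually.of_forall hq)).deriv]
    simp only [Pi.mul_apply]
    field_simp
  · rw [← e₃, (hdp.congr_of_eventuallyEq (Filter.Eventually.of_forall hp)).deriv, hp]
    simp only [Pi.mul_apply, Pi.pow_apply]
    field_simp
    ring

section Evaluation

open MvPolynomial

variable {ι : Type*} (D : Derivation ℂ (MvPolynomial ι ℂ) (MvPolynomial ι ℂ)) {v : ℝ → ι → ℂ}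

theorem hasDerivAt_eval_of_derivation {t : ℝ}
    (hv : ∀ i, HasDerivAt (fun s => v s i) (eval (v t) (D (X i)) / t) t) (P : MvPolynomial ι ℂ) :
    HasDerivAt (fun s => eval (v s) P) (eval (v t) (D P) / t) t := by
  induction P using MvPolynomial.induction_on with
  | C a => simpa using hasDerivAt_const t a
  | add P Q hP hQ =>
    simp only [map_add, add_div]
    exact hP.add hQ
  | mul_X P i hP =>
    simp only [map_mul, eval_X, Derivation.leibniz, smul_eq_mul, map_add]
    refine (hP.mul (hv i)).congr_deriv ?_
    ring

theorem iterate_mul_deriv_eval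
    (hv : ∀ t > 0, ∀ i, HasDerivAt (fun s => v s i) (eval (v t) (D (X i)) / t) t)
    (P : MvPolynomial ι ℂ) (k : ℕ) {t : ℝ} (ht : 0 < t) :
    (fun (f : ℝ → ℂ) (s : ℝ) => (s : ℂ) * deriv f s)^[k] (fun s => eval (v s) P) t =
      eval (v t) (D^[k] P) := by
  induction k generalizing t with
  | zero => rfl
  | succ k ih =>
    have ht' : (t : ℂ) ≠ 0 := by exact_mod_cast ht.ne'
    have he : (fun (f : ℝ → ℂ) (s : ℝ) => (s : ℂ) * deriv f s)^[k]
        (fun s => eval (v s) P) =ᶠ[nhds t]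
        fun s => eval (v s) (D^[k] P) := by
      filter_upwards [Ioi_mem_nhds ht] with s hs using ih hs
    rw [Function.iterate_succ_apply', Function.iterate_succ_apply', he.deriv_eq,
      (hasDerivAt_eval_of_derivation D (hv t ht) _).deriv, mul_div_cancel₀ _ ht']

theorem det_iterate_mul_deriv_eval
    (hv : ∀ t > 0, ∀ i, HasDerivAt (fun s => v s i) (eval (v t) (D (X i)) / t) t)
    (P : MvPolynomial ι ℂ) (n : ℕ) {t : ℝ} (ht : 0 < t) :
    Matrix.det (Matrix.of fun k l : Fin n =>
      (fun (f : ℝ → ℂ) (s : ℝ) => (s : ℂ) * deriv f s)^[(k : ℕ) + (l : ℕ)]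
        (fun s => eval (v s) P) t) = eval (v t) (hankelDet D P n) := by
  rw [hankelDet, RingHom.map_det]
  congr 1
  ext k l
  simp [iterate_mul_deriv_eval D hv P _ ht]

end Evaluation

section BesselDerivation

open MvPolynomial

/-- The derivation acting on `t`, `φ_ν`, `φ_{ν+1}` (the variables `X 0`, `X 1`, `X 2`) as
`t d/dt`. -/
noncomputable def besselDerivation (ν ε : ℂ) :
    Derivation ℂ (MvPolynomial (Fin 3) ℂ) (MvPolynomial (Fin 3) ℂ) :=
  mkDerivation ℂ ![X 0, C ν * X 1 + C ε * X 0 * X 2, X 0 * X 1 - C (ν + 1) * X 2]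

variable (ν ε : ℂ)

@[simp] theorem besselDerivation_zero : besselDerivation ν ε (X 0) = X 0 := by
  simp [besselDerivation, mkDerivation_X]

@[simp] theorem besselDerivation_one :
    besselDerivation ν ε (X 1) = C ν * X 1 + C ε * X 0 * X 2 := by
  simp [besselDerivation, mkDerivation_X]

@[simp] theorem besselDerivation_two :
    besselDerivation ν ε (X 2) = X 0 * X 1 - C (ν + 1) * X 2 := by
  simp [besselDerivation, mkDerivation_X]

@[simp] theorem besselDerivation_C (a : ℂ) : besselDerivation ν ε (C a) = 0 := by
  simp [besselDerivation]

/-- The Hankel determinants of `φ_ν` (for `i = 1`) and `φ_{ν+1}` (for `i = 2`). -/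
noncomputable abbrev besselHankel (i : Fin 3) (n : ℕ) : MvPolynomial (Fin 3) ℂ :=
  hankelDet (besselDerivation ν ε) (X i) n

variable {ε}

theorem besselHankel_toda_succ (hε : ε ≠ 0) (n : ℕ) :
    besselHankel ν ε 1 (n + 2) * besselHankel ν ε 2 n =
      C ε * X 0 * (besselHankel ν ε 1 (n + 1) *
        (besselDerivation ν ε (besselHankel ν ε 2 (n + 1)) +
          ((n : MvPolynomial (Fin 3) ℂ) + 1) * besselHankel ν ε 2 (n + 1)) -
        besselHankel ν ε 2 (n + 1) * besselDerivation ν ε (besselHankel ν ε 1 (n + 1))) :=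
  hankelDet_toda_succ (besselDerivation ν ε) (c := C ν) (by simp)
    (by simp [Derivation.leibniz, mul_comm]) (by simpa using hε) (by simp) n

theorem besselHankel_toda_mul (hε : ε ≠ 0) (n : ℕ) :
    C ε * X 0 * (besselHankel ν ε 2 (n + 1) * besselHankel ν ε 1 n) =
      besselHankel ν ε 2 n * (besselDerivation ν ε (besselHankel ν ε 1 (n + 1)) -
        C ν * besselHankel ν ε 1 (n + 1)) -
      besselHankel ν ε 1 (n + 1) *
        (besselDerivation ν ε (besselHankel ν ε 2 n) +
          (n : MvPolynomial (Fin 3) ℂ) * besselHankel ν ε 2 n) :=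
  hankelDet_toda_mul (besselDerivation ν ε) (c := C ν) (by simp)
    (by simp [Derivation.leibniz, mul_comm]) (by simpa using hε) (by simp) n

theorem besselHankel_toda_succ_swap (n : ℕ) :
    besselHankel ν ε 2 (n + 2) * besselHankel ν ε 1 n =
      X 0 * (besselHankel ν ε 2 (n + 1) *
        (besselDerivation ν ε (besselHankel ν ε 1 (n + 1)) +
          ((n : MvPolynomial (Fin 3) ℂ) + 1) * besselHankel ν ε 1 (n + 1)) -
        besselHankel ν ε 1 (n + 1) * besselDerivation ν ε (besselHankel ν ε 2 (n + 1))) :=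
  hankelDet_toda_succ (besselDerivation ν ε) (c := -C (ν + 1)) (by rw [map_neg]; simp)
    (by simp) (by simp) (by rw [besselDerivation_two]; ring) n

theorem besselHankel_toda_mul_swap (n : ℕ) :
    X 0 * (besselHankel ν ε 1 (n + 1) * besselHankel ν ε 2 n) =
      besselHankel ν ε 1 n * (besselDerivation ν ε (besselHankel ν ε 2 (n + 1)) +
        C (ν + 1) * besselHankel ν ε 2 (n + 1)) -
      besselHankel ν ε 2 (n + 1) *
        (besselDerivation ν ε (besselHankel ν ε 1 n) +
          (n : MvPolynomial (Fin 3) ℂ) * besselHankel ν ε 1 n) := by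
  have h := hankelDet_toda_mul (besselDerivation ν ε) (c := -C (ν + 1)) (a := X 2) (b := X 1)
    (by rw [map_neg]; simp) (besselDerivation_zero ν ε) (by simp)
    (by rw [besselDerivation_two]; ring) n
  linear_combination h

variable (ε) in
/-- The Hankel determinants `besselHankel ν ε i (n - 1)`, vanishing for `n = 0`. -/
noncomputable def besselHankelPred (i : Fin 3) : ℕ → MvPolynomial (Fin 3) ℂ
  | 0 => 0
  | n + 1 => besselHankel ν ε i n

theorem besselHankel_toda_succ_pred (hε : ε ≠ 0) (n : ℕ) :
    besselHankel ν ε 1 (n + 1) * besselHankelPred ν ε 2 n =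
      C ε * X 0 * (besselHankel ν ε 1 n *
        (besselDerivation ν ε (besselHankel ν ε 2 n) +
          (n : MvPolynomial (Fin 3) ℂ) * besselHankel ν ε 2 n) -
        besselHankel ν ε 2 n * besselDerivation ν ε (besselHankel ν ε 1 n)) := by
  cases n with
  | zero => simp [besselHankelPred, hankelDet]
  | succ n => simpa [besselHankelPred] using besselHankel_toda_succ ν hε n

theorem besselHankel_toda_succ_swap_pred (n : ℕ) :
    besselHankel ν ε 2 (n + 1) * besselHankelPred ν ε 1 n =
      X 0 * (besselHankel ν ε 2 n *
        (besselDerivation ν ε (besselHankel ν ε 1 n) +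
          (n : MvPolynomial (Fin 3) ℂ) * besselHankel ν ε 1 n) -
        besselHankel ν ε 1 n * besselDerivation ν ε (besselHankel ν ε 2 n)) := by
  cases n with
  | zero => simp [besselHankelPred, hankelDet]
  | succ n => simpa [besselHankelPred] using besselHankel_toda_succ_swap ν n

theorem besselHankel_toda_mul_pred (hε : ε ≠ 0) (n : ℕ) :
    C ε * X 0 * (besselHankel ν ε 2 n * besselHankelPred ν ε 1 n) =
      besselHankelPred ν ε 2 n * (besselDerivation ν ε (besselHankel ν ε 1 n) -
        C ν * besselHankel ν ε 1 n) -
      besselHankel ν ε 1 n * (besselDerivation ν ε (besselHankelPred ν ε 2 n) +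
        ((n : MvPolynomial (Fin 3) ℂ) - 1) * besselHankelPred ν ε 2 n) := by
  cases n with
  | zero => simp [besselHankelPred]
  | succ n => simpa [besselHankelPred] using besselHankel_toda_mul ν hε n

end BesselDerivation

theorem painleve_of_bessel_system {σ ν : ℂ} (hσ : σ ^ 2 = 1) {f g : ℝ → ℂ}
    (hf : ∀ t > 0, HasDerivAt f ((ν * f t + -σ * t * g t) / t) t)
    (hg : ∀ t > 0, HasDerivAt g ((t * f t - (ν + 1) * g t) / t) t)
    {A B : ℕ → ℝ → ℂ} {Bₘ q p : ℝ → ℂ}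
    (hA : ∀ m t, A m t = Matrix.det (Matrix.of fun k l : Fin m =>
      (fun (f : ℝ → ℂ) (s : ℝ) => (s : ℂ) * deriv f s)^[(k : ℕ) + (l : ℕ)] f t))
    (hB : ∀ m t, B m t = Matrix.det (Matrix.of fun k l : Fin m =>
      (fun (f : ℝ → ℂ) (s : ℝ) => (s : ℂ) * deriv f s)^[(k : ℕ) + (l : ℕ)] g t))
    (n : ℕ) (hB₀ : n = 0 → Bₘ = 0) (hBₘ : ∀ m, n = m + 1 → Bₘ = B m)
    {t : ℝ} (ht : 0 < t) (hA0 : A n t ≠ 0) (hB0 : B n t ≠ 0) (hB'0 : B (n + 1) t ≠ 0)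
    (hq : ∀ s, q s = σ * (A (n + 1) s * B n s) / (A n s * B (n + 1) s))
    (hp : ∀ s, p s = -(1 / (2 * (s : ℂ))) * (B (n + 1) s * Bₘ s) / B n s ^ 2) :
    q t = σ * (deriv (B (n + 1)) t / B (n + 1) t - deriv (A n) t / A n t + (ν + 1 - n) / t) ∧
      t * deriv q t = 4 * q t ^ 2 * p t -
        (2 * (σ / 2) * t * q t ^ 2 + (2 * (-ν + n - 1) + 1) * q t + 2 * (1 / 2) * t) ∧
      t * deriv p t = -(4 * q t * p t ^ 2 -
        (4 * (σ / 2) * t * q t + (2 * (-ν + n - 1) + 1)) * p t +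
          (σ / 2) * ((-ν + n - 1) + (ν + n + 1)) * t) := by
  have hε : -σ ≠ 0 := neg_ne_zero.2 fun h => by simp [h] at hσ
  let v : ℝ → Fin 3 → ℂ := fun s => ![(s : ℂ), f s, g s]
  have hv : ∀ t > 0, ∀ i, HasDerivAt (fun s => v s i)
      (MvPolynomial.eval (v t) (besselDerivation ν (-σ) (MvPolynomial.X i)) / t) t :=
    fun t ht i => by
    have ht0 : (t : ℂ) ≠ 0 := by exact_mod_cast ht.ne'
    fin_cases i
    · refine (hasDerivAt_id t).ofReal_comp.congr_deriv ?_
      simp [v, ht0]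
    · refine (hf t ht).congr_deriv ?_
      simp [v]
    · refine (hg t ht).congr_deriv ?_
      simp [v]
  have evalA : ∀ m, ∀ t > 0, A m t = MvPolynomial.eval (v t) (besselHankel ν (-σ) 1 m) :=
    fun m t ht => by
    rw [hA, ← det_iterate_mul_deriv_eval _ hv _ m ht]
    simp [v]
  have evalB : ∀ m, ∀ t > 0, B m t = MvPolynomial.eval (v t) (besselHankel ν (-σ) 2 m) :=
    fun m t ht => by
    rw [hB, ← det_iterate_mul_deriv_eval _ hv _ m ht]
    simp [v]
  have evalBₘ : ∀ t > 0, Bₘ t = MvPolynomial.eval (v t) (besselHankelPred ν (-σ) 2 n) :=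
    fun t ht => by
    cases n with
    | zero => simp [hB₀ rfl, besselHankelPred]
    | succ n => rw [hBₘ n rfl, evalB n t ht, besselHankelPred]
  have hderiv : ∀ {F : ℝ → ℂ} {P}, (∀ t > 0, F t = MvPolynomial.eval (v t) P) →
      HasDerivAt F (MvPolynomial.eval (v t) (besselDerivation ν (-σ) P) / t) t := fun hF =>
    (hasDerivAt_eval_of_derivation _ (hv t ht) _).congr_of_eventuallyEq
      (Filter.eventually_of_mem (Ioi_mem_nhds ht) hF)
  have h₁ := congrArg (MvPolynomial.eval (v t)) (besselHankel_toda_succ_pred ν hε n)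
  have h₂ := congrArg (MvPolynomial.eval (v t)) (besselHankel_toda_mul ν hε n)
  have h₃ := congrArg (MvPolynomial.eval (v t)) (besselHankel_toda_succ_swap_pred ν (ε := -σ) n)
  have h₄ := congrArg (MvPolynomial.eval (v t)) (besselHankel_toda_mul_swap ν (ε := -σ) n)
  have h₅ := congrArg (MvPolynomial.eval (v t)) (besselHankel_toda_mul_pred ν hε n)
  simp only [map_mul, map_add, map_sub, map_natCast, map_one, MvPolynomial.eval_C,
    MvPolynomial.eval_X, ← evalA _ t ht, ← evalB _ t ht, ← evalBₘ t ht,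
    show v t 0 = t from rfl] at h₁ h₂ h₃ h₄ h₅
  exact painleve_of_toda hσ (by exact_mod_cast ht.ne') (hderiv (evalA n)) (hderiv (evalA (n + 1)))
    (hderiv (evalB n)) (hderiv (evalB (n + 1))) (hderiv evalBₘ) hA0 hB0 hB'0 h₁ h₂ h₃ h₄ h₅ hq hp

/-- determinant formula for a family of classical transcendental
solutions of the Hamiltonian system S_III with parameters
`θ∞ = ν+n+1`, `θ₀ = -ν+n-1`, `η∞ = σ/2`, `η₀ = 1/2`, built from (modified)
Bessel functions. -/
theorem pIII_det_solution
    (ν : ℝ) (hν : ν ∉ Set.range ((↑·) : ℤ → ℝ))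
    (σ : ℝ) (hσ : σ = 1 ∨ σ = -1)
    (c₁ c₂ : ℂ)
    (Z : ℝ → ℝ → ℝ)
    (hZ : ∀ μ : ℝ, Z μ = if σ = 1 then besselJ μ else besselI μ)
    (φ : ℤ → ℝ → ℂ)
    (hφ : ∀ (j : ℤ) (t : ℝ), φ j t =
      c₁ * (Z (ν + j) t : ℂ) + c₂ * (((-σ) ^ j : ℝ) : ℂ) * (Z (-ν - j) t : ℂ))
    (τ : ℤ → ℤ → ℝ → ℂ)
    (hτ : ∀ (j m : ℤ) (t : ℝ), τ j m t =
      if m < 0 then 0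
      else Matrix.det (Matrix.of fun k l : Fin m.toNat =>
        (fun (f : ℝ → ℂ) (s : ℝ) => (s : ℂ) * deriv f s)^[(k : ℕ) + (l : ℕ)] (φ j) t))
    (n : ℕ) (U : Set ℝ) (hU : IsOpen U) (hU0 : U ⊆ Set.Ioi 0)
    (hden1 : ∀ t ∈ U, τ 0 n t ≠ 0)
    (hden2 : ∀ t ∈ U, τ 1 (n + 1) t ≠ 0)
    (hden3 : ∀ t ∈ U, τ 1 n t ≠ 0)
    (q p : ℝ → ℂ)
    (hq : ∀ t, q t = (σ : ℂ) * (τ 0 (n + 1) t * τ 1 n t) / (τ 0 n t * τ 1 (n + 1) t))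
    (hp : ∀ t, p t = -(1 / (2 * (t : ℂ))) *
      (τ 1 (n + 1) t * τ 1 (n - 1) t) / (τ 1 n t) ^ 2) :
    ∀ t ∈ U,
      q t = (σ : ℂ) * (deriv (τ 1 (n + 1)) t / τ 1 (n + 1) t
          - deriv (τ 0 n) t / τ 0 n t + ((ν : ℂ) + 1 - n) / (t : ℂ)) ∧
      (t : ℂ) * deriv q t =
        4 * (q t) ^ 2 * p t
          - (2 * ((σ : ℂ) / 2) * (t : ℂ) * (q t) ^ 2
              + (2 * (-(ν : ℂ) + n - 1) + 1) * q t + 2 * (1 / 2) * (t : ℂ)) ∧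
      (t : ℂ) * deriv p t =
        -(4 * q t * (p t) ^ 2
            - (4 * ((σ : ℂ) / 2) * (t : ℂ) * q t + (2 * (-(ν : ℂ) + n - 1) + 1)) * p t
            + ((σ : ℂ) / 2) * ((-(ν : ℂ) + n - 1) + ((ν : ℂ) + n + 1)) * (t : ℂ)) := by
  have hZ' : ∀ μ : ℝ, ∀ t > 0, Z μ t = besselZ (-σ) μ t := fun μ t ht => by
    rcases hσ with rfl | rfl
    · rw [hZ, if_pos rfl, besselJ_eq_besselZ μ ht]
    · rw [hZ, if_neg (by norm_num), besselI_eq_besselZ μ ht, neg_neg]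
  have hε : (-σ) ^ 2 = 1 := by rcases hσ with rfl | rfl <;> norm_num
  have hφ₀ : ∀ t > 0, φ 0 t =
      c₁ * (besselZ (-σ) ν t : ℂ) + c₂ * (besselZ (-σ) (-ν) t : ℂ) := fun t ht => by
    simp [hφ, hZ' _ t ht]
  have hφ₁ : ∀ t > 0, φ 1 t = c₁ * (besselZ (-σ) (ν + 1) t : ℂ) +
      c₂ * ((-σ : ℝ) : ℂ) * (besselZ (-σ) (-ν - 1) t : ℂ) := fun t ht => by
    simp [hφ, hZ' _ t ht]
  have hdφ₀ : ∀ t > 0, HasDerivAt (φ 0) ((ν * φ 0 t + -(σ : ℂ) * t * φ 1 t) / t) t :=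
    fun t ht => by
    rw [hφ₀ t ht, hφ₁ t ht, ← Complex.ofReal_neg]
    exact (hasDerivAt_bessel_combination hε hν c₁ c₂ ht).congr_of_eventuallyEq
      (Filter.eventually_of_mem (Ioi_mem_nhds ht) hφ₀)
  have hdφ₁ : ∀ t > 0, HasDerivAt (φ 1) ((t * φ 0 t - (ν + 1) * φ 1 t) / t) t :=
    fun t ht => by
    rw [hφ₀ t ht, hφ₁ t ht]
    exact (hasDerivAt_bessel_combination_succ hε hν c₁ c₂ ht).congr_of_eventuallyEq
      (Filter.eventually_of_mem (Ioi_mem_nhds ht) hφ₁)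
  have hτ' : ∀ (j : ℤ) (m : ℕ) (t : ℝ), τ j m t = Matrix.det (Matrix.of fun k l : Fin m =>
      (fun (f : ℝ → ℂ) (s : ℝ) => (s : ℂ) * deriv f s)^[(k : ℕ) + (l : ℕ)] (φ j) t) :=
    fun j m t => by rw [hτ, if_neg (by simp)]; rfl
  intro t htU
  refine painleve_of_bessel_system (A := fun m => τ 0 m) (B := fun m => τ 1 m)
    (by rw [← neg_sq]; exact_mod_cast hε) hdφ₀ hdφ₁ (hτ' 0) (hτ' 1) n (Bₘ := τ 1 (n - 1))
    ?_ ?_ (hU0 htU) (hden1 t htU) (hden3 t htU) (hden2 t htU) hq hp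
  · rintro rfl
    ext s
    simp [hτ]
  · rintro m rfl
    simp
end
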